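/- Let P(u,v) = P(u) ∩ P(v) ⊂ ℝ^4 be a bounded 4-dimensional spindle arising as the intersection of the two cones P(u) and P(v) of the facets incident to the vertices u and v, respectively. Then there is an edge walk from u to v such that in each step a new facet of P(v) becomes active: for each step, the new vertex lies on a facet incident to v that contained no earlier vertex of the walk. -/

import Mathlib

open scoped BigOperators

/-- Data defining a polyhedron `{z ∈ ℝ^d : A z ≥ b}` with rational data.
Under the `IsProper` assumption below it is full-dimensional with an
irredundant description, hence `d`-dimensional with exactly `f` facets. -/
structure PolyData (d f : ℕ) where
  A : Matrix (Fin f) (Fin d) ℚ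
  b : Fin f → ℚ

namespace PolyData

variable {d f : ℕ}

/-- The `i`-th row of `A` (outer normal of the `i`-th facet), as a real vector. -/
def row (P : PolyData d f) (i : Fin f) : Fin d → ℝ := fun j => (P.A i j : ℝ)

/-- The `i`-th right-hand side, as a real number. -/
def rhs (P : PolyData d f) (i : Fin f) : ℝ := (P.b i : ℝ)

/-- Value of the `i`-th linear form at `z`. -/
def eval (P : PolyData d f) (i : Fin f) (z : Fin d → ℝ) : ℝ := ∑ j, P.row i j * z j

/-- The feasible set `{z : A z ≥ b}`. -/
def toSet (P : PolyData d f) : Set (Fin d → ℝ) := {z | ∀ i, P.rhs i ≤ P.eval i z}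

/-- Indices of the constraints (facets) active (incident) at `z`. -/
def activeAt (P : PolyData d f) (z : Fin d → ℝ) : Set (Fin f) := {i | P.eval i z = P.rhs i}

/-- The `i`-th facet, as a subset of the polyhedron. -/
def facet (P : PolyData d f) (i : Fin f) : Set (Fin d → ℝ) :=
  {z ∈ P.toSet | P.eval i z = P.rhs i}

/-- The standing assumption: the polyhedron is full-dimensional and the
description is irredundant, i.e. every inequality is facet-defining. -/
def IsProper (P : PolyData d f) : Prop :=
  (∃ z, ∀ i, P.rhs i < P.eval i z) ∧
  ∀ i, ∃ z ∈ P.toSet, P.eval i z = P.rhs i ∧ ∀ i', i' ≠ i → P.rhs i' < P.eval i' z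

/-- A vertex: a feasible point whose active outer normals span `ℝ^d`. -/
def IsVertex (P : PolyData d f) (v : Fin d → ℝ) : Prop :=
  v ∈ P.toSet ∧ Submodule.span ℝ (P.row '' P.activeAt v) = ⊤

/-- A circuit direction of `P`: a nonzero `g` such that `A g` is
support-minimal in `{A x : x ≠ 0}` (taken here up to scaling). -/
def IsCircuit (P : PolyData d f) (g : Fin d → ℝ) : Prop :=
  g ≠ 0 ∧ ∀ x : Fin d → ℝ, x ≠ 0 →
    {i | P.eval i x ≠ 0} ⊆ {i | P.eval i g ≠ 0} →
    {i | P.eval i x ≠ 0} = {i | P.eval i g ≠ 0}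

/-- The set of circuits of `P`. -/
def circuits (P : PolyData d f) : Set (Fin d → ℝ) := {g | P.IsCircuit g}

/-- A (maximal) circuit walk `y 0, …, y k` of length `k`. -/
def IsCircuitWalk (P : PolyData d f) {k : ℕ} (y : Fin (k+1) → Fin d → ℝ) : Prop :=
  (∀ i, y i ∈ P.toSet) ∧
  ∀ i : Fin k, ∃ g ∈ P.circuits, ∃ α : ℝ, 0 < α ∧
    y i.succ = y i.castSucc + α • g ∧
    ∀ β : ℝ, α < β → y i.castSucc + β • g ∉ P.toSet

/-- The circuit distance from `u` to `v`: minimum length of a circuit walk. -/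
noncomputable def circuitDistance (P : PolyData d f) (u v : Fin d → ℝ) : ℕ∞ :=
  sInf {n : ℕ∞ | ∃ k : ℕ, n = (k : ℕ∞) ∧ ∃ y : Fin (k+1) → Fin d → ℝ,
    P.IsCircuitWalk y ∧ y 0 = u ∧ y (Fin.last k) = v}

/-- The circuit diameter: maximum circuit distance between two vertices. -/
noncomputable def circuitDiameter (P : PolyData d f) : ℕ∞ :=
  ⨆ (u : Fin d → ℝ) (v : Fin d → ℝ) (_ : P.IsVertex u) (_ : P.IsVertex v),
    P.circuitDistance u v

/-- `u` and `v` are joined by an edge of `P`. -/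
def IsEdge (P : PolyData d f) (u v : Fin d → ℝ) : Prop :=
  P.IsVertex u ∧ P.IsVertex v ∧ u ≠ v ∧
  segment ℝ u v = {z ∈ P.toSet | P.activeAt u ∩ P.activeAt v ⊆ P.activeAt z}

/-- An edge walk along vertices of `P`. -/
def IsEdgeWalk (P : PolyData d f) {k : ℕ} (y : Fin (k+1) → Fin d → ℝ) : Prop :=
  ∀ i : Fin k, P.IsEdge (y i.castSucc) (y i.succ)

/-- Combinatorial (edge) distance between two vertices. -/
noncomputable def edgeDistance (P : PolyData d f) (u v : Fin d → ℝ) : ℕ∞ :=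
  sInf {n : ℕ∞ | ∃ k : ℕ, n = (k : ℕ∞) ∧ ∃ y : Fin (k+1) → Fin d → ℝ,
    P.IsEdgeWalk y ∧ y 0 = u ∧ y (Fin.last k) = v}

/-- Combinatorial (edge) diameter. -/
noncomputable def edgeDiameter (P : PolyData d f) : ℕ∞ :=
  ⨆ (u : Fin d → ℝ) (v : Fin d → ℝ) (_ : P.IsVertex u) (_ : P.IsVertex v),
    P.edgeDistance u v

end PolyData

/-- `Δ_E(f,d)`: maximum combinatorial diameter of a `d`-dimensional
polyhedron with `f` facets. -/
noncomputable def maxEdgeDiameter (f d : ℕ) : ℕ∞ :=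
  ⨆ (P : PolyData d f) (_ : P.IsProper), P.edgeDiameter

/-- `Δ_C(f,d)`: maximum circuit diameter of a `d`-dimensional polyhedron
with `f` facets. -/
noncomputable def maxCircuitDiameter (f d : ℕ) : ℕ∞ :=
  ⨆ (P : PolyData d f) (_ : P.IsProper), P.circuitDiameter

/-- `Δ_C^u(f,d)`: maximum circuit diameter of an unbounded `d`-dimensional
polyhedron with `f` facets. -/
noncomputable def maxUnboundedCircuitDiameter (f d : ℕ) : ℕ∞ :=
  ⨆ (P : PolyData d f) (_ : P.IsProper ∧ ¬ Bornology.IsBounded P.toSet),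
    P.circuitDiameter

namespace PolyData

variable {d f : ℕ}

/-- A walk is simple if each step enters exactly one new facet. -/
def IsSimpleWalk (P : PolyData d f) {k : ℕ} (y : Fin (k+1) → Fin d → ℝ) : Prop :=
  ∀ i : Fin k, (P.activeAt (y i.succ) \ P.activeAt (y i.castSucc)).ncard = 1

/-- `P` is `C`-simple: all circuit walks of length at most `Δ_E(f,d)` are simple. -/
def IsCSimple (P : PolyData d f) : Prop :=
  ∀ k : ℕ, (k : ℕ∞) ≤ maxEdgeDiameter f d →
    ∀ y : Fin (k+1) → Fin d → ℝ, P.IsCircuitWalk y → P.IsSimpleWalk y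

/-- A non-revisiting walk: each step enters a facet containing no earlier
point of the walk. -/
def IsNonRevisiting (P : PolyData d f) {k : ℕ} (y : Fin (k+1) → Fin d → ℝ) : Prop :=
  ∀ i : Fin k, ∃ j : Fin f, j ∈ P.activeAt (y i.succ) ∧
    ∀ i' : Fin (k+1), i' ≤ i.castSucc → j ∉ P.activeAt (y i')

/-- `P` is a simple polyhedron: every vertex lies on exactly `d` facets. -/
def IsSimplePoly (P : PolyData d f) : Prop :=
  ∀ v, P.IsVertex v → (P.activeAt v).ncard = d

end PolyData

/-- Append a last coordinate: `(z, t) ∈ ℝ^{d+1}`. -/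
def snocVec {d : ℕ} (z : Fin d → ℝ) (t : ℝ) : Fin (d+1) → ℝ := Fin.snoc z t

namespace PolyData

variable {d f : ℕ}

/-- `W` is a wedge on `P` over the facet with index `i₀`:
`W = H^≤ ∩ (P × [0,∞))`, where the boundary hyperplane `H = {w : a·w = β}`
of the halfspace `H^≤` contains `P × {0}` on its feasible side, meets the
interior of `P × [0,∞)`, and meets `P × {0}` exactly in the facet `i₀`. -/
def IsWedgeOver (W : PolyData (d+1) (f+1)) (P : PolyData d f) (i₀ : Fin f) : Prop :=
  ∃ (a : Fin (d+1) → ℝ) (β : ℝ),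
    (∀ z ∈ P.toSet, ∑ j, a j * snocVec z 0 j ≤ β) ∧
    (∃ z, (∀ i, P.rhs i < P.eval i z) ∧ ∃ t : ℝ, 0 < t ∧ ∑ j, a j * snocVec z t j = β) ∧
    (∀ z ∈ P.toSet, (∑ j, a j * snocVec z 0 j = β ↔ z ∈ P.facet i₀)) ∧
    W.toSet = {w | ∑ j, a j * w j ≤ β} ∩
      {w | ∃ z ∈ P.toSet, ∃ t : ℝ, 0 ≤ t ∧ w = snocVec z t}

/-- `P` is wedge-simple: it is `C`-simple and over every facet there is a
`C`-simple wedge. -/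
def IsWedgeSimple (P : PolyData d f) : Prop :=
  P.IsCSimple ∧ ∀ i₀ : Fin f, ∃ W : PolyData (d+1) (f+1),
    W.IsProper ∧ W.IsWedgeOver P i₀ ∧ W.IsCSimple

end PolyData

/-- `k`-wedge-simplicity: `0`-wedge-simple means `C`-simple, and `P` is
`(k+1)`-wedge-simple if it is `C`-simple and over every facet there is a
`k`-wedge-simple wedge.  In particular `1`-wedge-simple = wedge-simple. -/
def IsKWedgeSimpleAux : ℕ → (d f : ℕ) → PolyData d f → Prop
  | 0, _, _, P => P.IsCSimple
  | (k+1), d, f, P => P.IsCSimple ∧ ∀ i₀ : Fin f,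
      ∃ W : PolyData (d+1) (f+1), W.IsProper ∧ W.IsWedgeOver P i₀ ∧
        IsKWedgeSimpleAux k (d+1) (f+1) W

def IsKWedgeSimple (k : ℕ) {d f : ℕ} (P : PolyData d f) : Prop :=
  IsKWedgeSimpleAux k d f P

namespace PolyData

variable {d : ℕ}

/-- `(P, u, v)` is a Dantzig figure: a `d`-dimensional polyhedron with `2d`
facets, `d` of which are incident to the vertex `u` and the other `d` to the
vertex `v`. -/
def IsDantzigFigure (P : PolyData d (2*d)) (u v : Fin d → ℝ) : Prop :=
  P.IsVertex u ∧ P.IsVertex v ∧ Disjoint (P.activeAt u) (P.activeAt v) ∧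
  P.activeAt u ∪ P.activeAt v = Set.univ ∧
  (P.activeAt u).ncard = d ∧ (P.activeAt v).ncard = d

end PolyData

/-- The (exposed) faces of a polyhedron, each obtained by turning a subset of
the inequalities into equations. -/
def PolyData.faces {d f : ℕ} (P : PolyData d f) : Set (Set (Fin d → ℝ)) :=
  {F | ∃ S : Set (Fin f), F = {z ∈ P.toSet | S ⊆ P.activeAt z}}

/-- Combinatorial equivalence: an inclusion-preserving bijection between the
face lattices. -/
def CombEquiv {d f d' f' : ℕ} (P : PolyData d f) (Q : PolyData d' f') : Prop :=
  ∃ φ : Set (Fin d → ℝ) → Set (Fin d' → ℝ),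
    Set.BijOn φ P.faces Q.faces ∧
    ∀ F ∈ P.faces, ∀ G ∈ P.faces, (F ⊆ G ↔ φ F ⊆ φ G)

/-- Two facets are adjacent if they share a ridge (a codimension-2 face). -/
def PolyData.AdjacentFacets {d f : ℕ} (P : PolyData d f) (i j : Fin f) : Prop :=
  i ≠ j ∧ Module.finrank ℝ (affineSpan ℝ (P.facet i ∩ P.facet j)).direction = d - 2

/-- The Klee–Walkup polyhedron `U_4`. -/
def U4 : PolyData 4 8 where
  A := !![-6,-3,0,1; -3,-6,1,0; -35,-45,6,3; -45,-35,3,6;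
          1,0,0,0; 0,1,0,0; 0,0,1,0; 0,0,0,1]
  b := ![-1,-1,-8,-8,0,0,0,0]

theorem exists_pivot {κ : Type*} {s : Set κ} (hs : s.Finite) (hne : s.Nonempty) (f g : κ → ℝ)
    (hg : ∀ k ∈ s, 0 < g k) :
    ∃ M : ℝ, (∀ k ∈ s, 0 ≤ f k + M * g k) ∧ ∃ k ∈ s, f k + M * g k = 0 := by
  obtain ⟨k₀, hk₀, hmin⟩ := Set.exists_min_image s (fun k => f k / g k) hs hne
  refine ⟨-(f k₀ / g k₀), fun k hk => ?_, k₀, hk₀, ?_⟩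
  · have h1 := hmin k hk
    have h2 := hg k hk
    have h3 : f k = f k / g k * g k := by field_simp
    rw [h3]
    nlinarith
  · have h2 := hg k₀ hk₀
    field_simp
    ring

theorem exists_extremal_direction {κ W : Type*} [AddCommGroup W] [Module ℝ W] {s : Set κ}
    (hs : s.Finite) (n : κ → W →ₗ[ℝ] ℝ) (θ : W →ₗ[ℝ] ℝ) (d : W) (hd : ∀ k ∈ s, 0 ≤ n k d)
    (hθ : θ d < 0) :
    ∃ r : W, (∀ k ∈ s, 0 ≤ n k r) ∧ θ r < 0 ∧
      ∀ δ : W, (∀ k ∈ s, n k r = 0 → n k δ = 0) → ∃ c : ℝ, ∀ k ∈ s, n k (δ - c • r) = 0 := by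
  obtain ⟨r, ⟨hr1, hr2⟩, hmin⟩ :=
    (measure fun r : W => {k ∈ s | n k r ≠ 0}.ncard).wf.has_min
      {r | (∀ k ∈ s, 0 ≤ n k r) ∧ θ r < 0} ⟨d, hd, hθ⟩
  have key : ∀ δ : W, (∀ k ∈ s, n k r = 0 → n k δ = 0) → θ δ = 0 → ∀ k ∈ s, 0 ≤ n k δ := by
    intro δ hδ hθδ k hk
    by_contra! hneg
    obtain ⟨t, ht1, k₀, ⟨hk₀, hk₀'⟩, ht2⟩ := exists_pivot (s := {k ∈ s | n k δ < 0})
      (hs.subset fun k hk => hk.1) ⟨k, hk, hneg⟩ (fun k => n k δ / n k r)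
      (fun k => 1) (fun _ _ => one_pos)
    have hpos : ∀ k ∈ s, n k δ < 0 → 0 < n k r := fun k hk hk' =>
      lt_of_le_of_ne (hr1 k hk) fun h => by rw [hδ k hk h.symm] at hk'; exact lt_irrefl _ hk'
    have hp₀ := hpos k₀ hk₀ hk₀'
    have ht : t = -(n k₀ δ / n k₀ r) := by linarith
    have htpos : 0 < t := by
      rw [ht, neg_pos]; exact div_neg_of_neg_of_pos hk₀' hp₀
    have hz : n k₀ (t • r + δ) = 0 := by
      simp only [map_add, map_smul, smul_eq_mul, ht]; field_simp; ring
    refine hmin (t • r + δ) ⟨fun k hk => ?_, ?_⟩ ?_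
    · simp only [map_add, map_smul, smul_eq_mul]
      rcases lt_or_ge (n k δ) 0 with h | h
      · have h1 := ht1 k ⟨hk, h⟩
        have h2 := hpos k hk h
        have h3 : n k δ = n k δ / n k r * n k r := by field_simp
        rw [h3]; nlinarith
      · have := hr1 k hk; positivity
    · simp only [map_add, map_smul, smul_eq_mul, hθδ]; nlinarith
    · change Set.ncard _ < Set.ncard _
      refine Set.ncard_lt_ncard ?_ (hs.subset fun k hk => hk.1)
      refine ⟨fun k hk => ⟨hk.1, fun h => hk.2 ?_⟩, fun h => ?_⟩
      · simp [h, hδ k hk.1 h]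
      · exact (h ⟨hk₀, hp₀.ne'⟩).2 hz
  refine ⟨r, hr1, hr2, fun δ hδ => ⟨θ δ / θ r, fun k hk => ?_⟩⟩
  have h1 : θ (δ - (θ δ / θ r) • r) = 0 := by
    simp only [map_sub, map_smul, smul_eq_mul]; field_simp [hr2.ne]; ring
  have h2 : ∀ k ∈ s, n k r = 0 → n k (δ - (θ δ / θ r) • r) = 0 := by
    intro k hk h; simp [h, hδ k hk h]
  refine le_antisymm ?_ (key _ h2 h1 k hk)
  have := key (-(δ - (θ δ / θ r) • r)) (fun k hk h => by rw [map_neg, h2 k hk h, neg_zero])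
    (by rw [map_neg, h1, neg_zero]) k hk
  rw [map_neg] at this; linarith

/-- A finite system of linear inequalities `b k ≤ n k x`. -/
structure IneqSystem (ι E : Type*) [AddCommGroup E] [Module ℝ E] where
  n : ι → E →ₗ[ℝ] ℝ
  b : ι → ℝ

namespace IneqSystem

variable {ι E : Type*} [AddCommGroup E] [Module ℝ E] (P : IneqSystem ι E)

/-- Feasible points. -/
def Feas (x : E) : Prop := ∀ k, P.b k ≤ P.n k x

/-- The inequalities that are tight at `x`. -/
def act (x : E) : Set ι := {k | P.n k x = P.b k}

/-- Vertices: feasible points determined by their tight inequalities. -/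
def Vert (x : E) : Prop := P.Feas x ∧ ∀ d, (∀ k ∈ P.act x, P.n k d = 0) → d = 0

/-- Two points are adjacent when their common tight inequalities cut out a line. -/
def Adj (x y : E) : Prop :=
  x ≠ y ∧ ∀ d, (∀ k ∈ P.act x, k ∈ P.act y → P.n k d = 0) → ∃ c : ℝ, d = c • (y - x)

variable {P}

theorem mem_act {x : E} {k : ι} : k ∈ P.act x ↔ P.n k x = P.b k := Iff.rfl

theorem Feas.nonneg {x y : E} (hy : P.Feas y) {k : ι} (hk : k ∈ P.act x) : 0 ≤ P.n k (y - x) := by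
  rw [map_sub, mem_act.1 hk]; linarith [hy k]

theorem Feas.eq_zero_iff {x y : E} {k : ι} (hk : k ∈ P.act x) :
    P.n k (y - x) = 0 ↔ k ∈ P.act y := by
  rw [map_sub, mem_act.1 hk, mem_act, sub_eq_zero]

theorem n_sub_eq_zero {x y : E} {k : ι} (hx : k ∈ P.act x) (hy : k ∈ P.act y) :
    P.n k (y - x) = 0 := (Feas.eq_zero_iff hx).2 hy

theorem Feas.pos {x y : E} (hy : P.Feas y) {k : ι} (hk : k ∈ P.act x) (hk' : k ∉ P.act y) :
    0 < P.n k (y - x) :=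
  lt_of_le_of_ne (hy.nonneg hk) fun h => hk' ((Feas.eq_zero_iff hk).1 h.symm)

theorem Adj.symm {x y : E} (h : P.Adj x y) : P.Adj y x := by
  refine ⟨h.1.symm, fun d hd => ?_⟩
  obtain ⟨c, hc⟩ := h.2 d fun k hk hk' => hd k hk' hk
  exact ⟨-c, by rw [hc, neg_smul, ← smul_neg, neg_sub]⟩

theorem Vert.eq_of_act_subset {x y : E} (hx : P.Vert x) (h : P.act x ⊆ P.act y) : x = y := by
  have := hx.2 (y - x) fun k hk => n_sub_eq_zero hk (h hk)
  exact (sub_eq_zero.1 this).symm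

/-- A vertex on a feasible line through two vertices is one of the two. -/
theorem Vert.eq_or_eq_of_collinear {x y p : E} (hx : P.Vert x) (hy : P.Vert y) (hp : P.Vert p)
    {β : ℝ} (h : p - x = β • (y - x)) : p = x ∨ p = y := by
  have hmid : ∀ {x y p : E}, P.Vert p → P.Feas x → P.Feas y → ∀ β : ℝ, 0 < β → β < 1 →
      p - x = β • (y - x) → x = y := by
    intro x y p hp hx hy β h0 h1 h
    have : y - x = 0 := hp.2 _ fun k hk => by
      have e1 := hx.nonneg hk
      have e2 := hy.nonneg hk
      have e3 : x - p = -(β • (y - x)) := by rw [← h]; abel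
      have e4 : y - p = (1 - β) • (y - x) := by
        rw [sub_smul, one_smul, ← h]; abel
      rw [e3, map_neg, map_smul, smul_eq_mul] at e1
      rw [e4, map_smul, smul_eq_mul] at e2
      have e5 : 0 ≤ P.n k (y - x) := nonneg_of_mul_nonneg_right e2 (by linarith)
      nlinarith
    exact (sub_eq_zero.1 this).symm
  have hp' : p = x + β • (y - x) := by rw [← h]; abel
  rcases lt_trichotomy β 0 with hβ | hβ | hβ
  · right
    have := hmid (x := p) (y := y) hx hp.1 hy.1 (-β / (1 - β)) (by apply div_pos <;> linarith)
      (by rw [div_lt_one] <;> linarith) (by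
        rw [hp']
        have : (1 - β) ≠ 0 := by linarith
        have e : y - (x + β • (y - x)) = (1 - β) • (y - x) := by module
        rw [e, smul_smul, div_mul_cancel₀ _ this]; module)
    exact this
  · left; rw [hp', hβ]; simp
  rcases lt_trichotomy β 1 with hβ1 | hβ1 | hβ1
  · have := hmid hp hx.1 hy.1 β hβ hβ1 h
    left; rw [hp', this]; simp
  · right; rw [hp', hβ1]; simp
  · left
    have := hmid (x := x) (y := p) hy hx.1 hp.1 (1 / β) (by positivity)
      (by rw [div_lt_one] <;> linarith) (by
        rw [h, smul_smul, one_div, inv_mul_cancel₀ hβ.ne', one_smul])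
    exact this.symm

variable [Finite ι]

/-- Moving a little along a direction that is nonnegative on the tight inequalities. -/
theorem Feas.exists_step {x : E} (hx : P.Feas x) {r : E} (hr : ∀ k ∈ P.act x, 0 ≤ P.n k r) :
    ∃ ε : ℝ, 0 < ε ∧ P.Feas (x + ε • r) ∧ P.act (x + ε • r) = {k ∈ P.act x | P.n k r = 0} := by
  have h1 : ∀ᶠ ε : ℝ in nhdsWithin 0 (Set.Ioi 0), ∀ k, k ∉ P.act x →
      P.b k < P.n k x + ε * P.n k r := by
    rw [Filter.eventually_all]
    intro k
    by_cases hk : k ∈ P.act x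
    · simp [hk]
    · have h2 : P.b k < P.n k x + 0 * P.n k r := by
        have := hx k
        rw [zero_mul, add_zero]
        exact lt_of_le_of_ne this fun h => hk h.symm
      have h3 : Continuous fun ε : ℝ => P.n k x + ε * P.n k r := by fun_prop
      have h4 := (h3.tendsto 0).eventually (lt_mem_nhds h2)
      exact (h4.filter_mono nhdsWithin_le_nhds).mono fun ε h _ => h
  obtain ⟨ε, hε, hε0⟩ := (h1.and self_mem_nhdsWithin).exists
  have hε0 : 0 < ε := hε0
  refine ⟨ε, hε0, fun k => ?_, Set.ext fun k => ?_⟩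
  · rw [map_add, map_smul, smul_eq_mul]
    by_cases hk : k ∈ P.act x
    · have := hr k hk
      have := mul_nonneg hε0.le this
      rw [mem_act.1 hk]; linarith
    · exact (hε k hk).le
  · simp only [mem_act, map_add, map_smul, smul_eq_mul, Set.mem_ofPred_eq]
    constructor
    · intro h
      have hk : k ∈ P.act x := by
        by_contra hk
        exact (hε k hk).ne' h
      have hk' := mem_act.1 hk
      refine ⟨hk', ?_⟩
      rw [hk'] at h
      have : ε * P.n k r = 0 := by linarith
      exact (mul_eq_zero.1 this).resolve_left hε0.ne'
    · rintro ⟨h1, h2⟩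
      rw [h1, h2]; ring

/-- Following an extremal direction from a vertex to the neighbouring vertex. -/
theorem Vert.exists_travel {x : E} (hx : P.Vert x) {r : E}
    (hrec : ∃ k, P.n k r < 0) (hr : ∀ k ∈ P.act x, 0 ≤ P.n k r)
    (hspan : ∀ d, (∀ k ∈ P.act x, P.n k r = 0 → P.n k d = 0) → ∃ c : ℝ, d = c • r) :
    ∃ τ : ℝ, 0 < τ ∧ P.Vert (x + τ • r) ∧ P.Adj x (x + τ • r) ∧
      ∀ k ∈ P.act x, k ∈ P.act (x + τ • r) ↔ P.n k r = 0 := by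
  obtain ⟨k₀, hk₀, hmin⟩ := Set.exists_min_image {k | P.n k r < 0}
    (fun k => (P.n k x - P.b k) / (-P.n k r)) (Set.toFinite _) hrec
  have hk₀ : P.n k₀ r < 0 := hk₀
  set τ := (P.n k₀ x - P.b k₀) / (-P.n k₀ r) with hτ
  have hτ0 : 0 < τ := by
    apply div_pos _ (by linarith)
    have := hx.1 k₀
    rcases this.lt_or_eq with h | h
    · linarith
    · exact absurd (hr k₀ h.symm) (not_le.2 hk₀)
  have hfeas : P.Feas (x + τ • r) := by
    intro k
    rw [map_add, map_smul, smul_eq_mul]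
    rcases lt_or_ge (P.n k r) 0 with h | h
    · have := hmin k h
      have h' : 0 < -P.n k r := by linarith
      have : τ * (-P.n k r) ≤ P.n k x - P.b k := by
        rwa [← le_div_iff₀ h']
      linarith
    · have := hx.1 k
      have := mul_nonneg hτ0.le h
      linarith
  have hact : ∀ k ∈ P.act x, k ∈ P.act (x + τ • r) ↔ P.n k r = 0 := by
    intro k hk
    rw [mem_act, map_add, map_smul, smul_eq_mul, mem_act.1 hk, add_eq_left, mul_eq_zero]
    exact or_iff_right hτ0.ne'
  have hk₀act : k₀ ∈ P.act (x + τ • r) := by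
    have h1 : τ * P.n k₀ r = -(P.n k₀ x - P.b k₀) := by
      rw [hτ, div_mul_eq_mul_div, mul_div_assoc, div_neg, div_self hk₀.ne, mul_neg, mul_one]
    rw [mem_act, map_add, map_smul, smul_eq_mul, h1]
    ring
  have hr0 : r ≠ 0 := by rintro rfl; simp at hk₀
  refine ⟨τ, hτ0, ⟨hfeas, fun d hd => ?_⟩, ⟨?_, fun d hd => ?_⟩, hact⟩
  · obtain ⟨c, rfl⟩ := hspan d fun k hk h => hd k ((hact k hk).2 h)
    have := hd k₀ hk₀act
    rw [map_smul, smul_eq_mul, mul_eq_zero] at this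
    rw [this.resolve_right hk₀.ne, zero_smul]
  · intro h
    have : τ • r = 0 := by simpa using h.symm
    exact (smul_ne_zero hτ0.ne' hr0) this
  · obtain ⟨c, rfl⟩ := hspan d fun k hk h => hd k hk ((hact k hk).2 h)
    refine ⟨c / τ, ?_⟩
    rw [add_sub_cancel_left, smul_smul, div_mul_cancel₀ _ hτ0.ne']

theorem finite_setOf_vert : {x | P.Vert x}.Finite :=
  Set.Finite.of_finite_image (f := P.act) (Set.toFinite _)
    fun _ hx _ _ h => Vert.eq_of_act_subset hx h.subset

end IneqSystem

theorem exists_smul_add_smul_of_finrank_two {E : Type*} [AddCommGroup E] [Module ℝ E]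
    {W : Submodule ℝ E} (hW : Module.finrank ℝ W ≤ 2) [FiniteDimensional ℝ E] {e₁ e₂ d : E}
    (h₁ : e₁ ∈ W) (h₂ : e₂ ∈ W) (hd : d ∈ W) (h₀ : e₁ ≠ 0) (hind : ∀ c : ℝ, e₂ ≠ c • e₁) :
    ∃ a b : ℝ, d = a • e₁ + b • e₂ := by
  have hli : LinearIndependent ℝ ![e₁, e₂] := by
    rw [LinearIndependent.pair_iff' h₀]
    exact fun a h => hind a h.symm
  have hle : Submodule.span ℝ (Set.range ![e₁, e₂]) ≤ W := by
    rw [Submodule.span_le]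
    rintro _ ⟨i, rfl⟩
    fin_cases i <;> assumption
  have heq := Submodule.eq_of_le_of_finrank_le hle
    (by rw [finrank_span_eq_card hli]; simpa using hW)
  rw [← heq, Matrix.range_cons, Matrix.range_cons, Matrix.range_empty, Set.union_empty,
    Set.singleton_union, Submodule.mem_span_pair] at hd
  obtain ⟨a, b, h⟩ := hd
  exact ⟨a, b, h.symm⟩

theorem exists_not_smul_of_two_le_finrank {E : Type*} [AddCommGroup E] [Module ℝ E]
    {W : Submodule ℝ E} (hW : 2 ≤ Module.finrank ℝ W) (e : E) :
    ∃ d ∈ W, ∀ c : ℝ, d ≠ c • e := by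
  by_contra! h
  have hle : W ≤ Submodule.span ℝ {e} := fun d hd => by
    obtain ⟨c, hc⟩ := h d hd
    exact Submodule.mem_span_singleton.2 ⟨c, hc.symm⟩
  have h1 := Submodule.finrank_mono hle
  have h2 := finrank_span_le_card (R := ℝ) ({e} : Set E)
  simp at h2
  omega

theorem exists_dual_of_not_smul {E : Type*} [AddCommGroup E] [Module ℝ E] {e d : E}
    (h : ∀ c : ℝ, d ≠ c • e) : ∃ θ : E →ₗ[ℝ] ℝ, θ e = 0 ∧ 0 < θ d := by
  have : d ∉ Submodule.span ℝ {e} := fun hm => by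
    obtain ⟨c, hc⟩ := Submodule.mem_span_singleton.1 hm
    exact h c hc.symm
  obtain ⟨θ, h1, h2⟩ := Submodule.exists_dual_map_eq_bot_of_notMem this inferInstance
  have he : θ e = 0 := by
    have : θ e ∈ (Submodule.span ℝ {e}).map θ :=
      Submodule.mem_map_of_mem (Submodule.mem_span_singleton_self e)
    rw [h2] at this; simpa using this
  rcases lt_or_gt_of_ne h1 with h | h
  · exact ⟨-θ, by simp [he], by simpa using h⟩
  · exact ⟨θ, he, h⟩

theorem finrank_ker_inf_ker_add_two {E : Type*} [AddCommGroup E] [Module ℝ E]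
    [FiniteDimensional ℝ E] {f g : E →ₗ[ℝ] ℝ} {e₁ e₂ : E} (h₁ : f e₁ = 0) (h₁' : g e₁ ≠ 0)
    (h₂ : f e₂ ≠ 0) : Module.finrank ℝ ↥(f.ker ⊓ g.ker) + 2 = Module.finrank ℝ E := by
  have hs : Function.Surjective (f.prod g) := by
    rintro ⟨a, b⟩
    refine ⟨(a / f e₂) • e₂ + ((b - a / f e₂ * g e₂) / g e₁) • e₁, ?_⟩
    refine Prod.ext ?_ ?_
    · simp only [LinearMap.prod_apply, Function.prod, map_add, map_smul, h₁,
        Prod.fst_add, Prod.smul_fst, smul_eq_mul]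
      field_simp
      ring
    · simp only [LinearMap.prod_apply, Function.prod, map_add, map_smul,
        Prod.snd_add, Prod.smul_snd, smul_eq_mul]
      field_simp
      ring
  have := LinearMap.finrank_range_add_finrank_ker (f.prod g)
  rw [LinearMap.range_eq_top.2 hs, finrank_top, LinearMap.ker_prod] at this
  simp at this
  omega

theorem finrank_le_ker_inf_ker_add_two {E : Type*} [AddCommGroup E] [Module ℝ E]
    [FiniteDimensional ℝ E] (f g : E →ₗ[ℝ] ℝ) :
    Module.finrank ℝ E ≤ Module.finrank ℝ ↥(f.ker ⊓ g.ker) + 2 := by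
  have := LinearMap.finrank_range_add_finrank_ker (f.prod g)
  rw [LinearMap.ker_prod] at this
  have h2 := Submodule.finrank_le (f.prod g).range
  simp at h2
  omega

section Wedge

variable {κ E : Type*} [AddCommGroup E] [Module ℝ E] {s : Set κ} {N : κ → E →ₗ[ℝ] ℝ}
  {W L : Submodule ℝ E} {d₀ : E} {θ : E →ₗ[ℝ] ℝ}

theorem exists_wedge_ray (hs : s.Finite) (hne : s.Nonempty) (hd₀W : d₀ ∈ W)
    (hd₀ : ∀ k ∈ s, 0 < N k d₀) (hθd₀ : θ d₀ = 0) {d₁ : E} (h₁ : d₁ ∈ W) (hθ₁ : 0 < θ d₁) :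
    ∃ r ∈ W, (∀ k ∈ s, 0 ≤ N k r) ∧ (∃ k ∈ s, N k r = 0) ∧ 0 < θ r := by
  obtain ⟨M, hM, k, hk, hk'⟩ := exists_pivot hs hne (fun k => N k d₁) (fun k => N k d₀) hd₀
  refine ⟨d₁ + M • d₀, W.add_mem h₁ (W.smul_mem _ hd₀W), ?_, ⟨k, hk, ?_⟩, ?_⟩
  · simpa using hM
  · simpa using hk'
  · simpa [hθd₀] using hθ₁

theorem wedge_decomposition (hL : ∀ k ∈ s, ∀ l ∈ L, N k l = 0)
    (hd₀ : ∀ k ∈ s, 0 < N k d₀) (hθL : ∀ l ∈ L, θ l = 0)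
    (hker : ∀ d ∈ W, θ d = 0 → ∃ c : ℝ, d - c • d₀ ∈ L)
    (hK : ∀ d ∈ W, (∀ k ∈ s, N k d = 0) → d ∈ L) {r r' : E} (hrW : r ∈ W) (hrW' : r' ∈ W)
    (hr : ∀ k ∈ s, 0 ≤ N k r) (hr' : ∀ k ∈ s, 0 ≤ N k r') (hrz : ∃ k ∈ s, N k r = 0)
    (hrz' : ∃ k ∈ s, N k r' = 0) (hθr : 0 < θ r) (hθr' : θ r' < 0) {d : E} (hd : d ∈ W)
    (hNd : ∀ k ∈ s, 0 ≤ N k d) :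
    ∃ a b : ℝ, 0 ≤ a ∧ 0 ≤ b ∧ d - a • r - b • r' ∈ L := by
  obtain ⟨k, hk, hkr⟩ := hrz
  obtain ⟨k', hk', hkr'⟩ := hrz'
  have hNL : ∀ {k}, k ∈ s → ∀ {e c}, e - c • d₀ ∈ L → N k e = c * N k d₀ := by
    intro k hk e c h
    have := hL k hk _ h
    rw [map_sub, map_smul, smul_eq_mul] at this
    linarith
  obtain ⟨c₀, hc₀⟩ := hker ((-θ r') • r + θ r • r')
    (W.add_mem (W.smul_mem _ hrW) (W.smul_mem _ hrW')) (by simp; ring)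
  have hc₀' : 0 ≤ c₀ := by
    have := hNL hk hc₀
    simp only [map_add, map_smul, smul_eq_mul, hkr, mul_zero, zero_add] at this
    have h1 := hr' k hk
    have h2 := hd₀ k hk
    by_contra! h
    have := mul_neg_of_neg_of_pos h h2
    have := mul_nonneg hθr.le h1
    linarith
  have hc₀pos : 0 < c₀ := by
    refine lt_of_le_of_ne hc₀' fun h => ?_
    have hz : ∀ k ∈ s, N k r = 0 := by
      intro k hk
      have := hNL hk hc₀
      simp only [map_add, map_smul, smul_eq_mul, ← h, zero_mul] at this
      have h1 := mul_nonneg hθr.le (hr' k hk)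
      have h2 := hr k hk
      have h3 := mul_nonneg (neg_pos.2 hθr').le h2
      have h4 : -θ r' * N k r = 0 := by linarith
      exact (mul_eq_zero.1 h4).resolve_left (by linarith)
    have := hθL r (hK r hrW hz)
    linarith
  have key : ∃ a b m : ℝ, 0 ≤ a ∧ 0 ≤ b ∧ 0 ≤ m ∧ d - a • r - b • r' - m • d₀ ∈ L := by
    rcases le_total 0 (θ d) with h | h
    · obtain ⟨m, hm⟩ := hker (d - (θ d / θ r) • r) (W.sub_mem hd (W.smul_mem _ hrW)) (by
        simp only [map_sub, map_smul, smul_eq_mul]; field_simp; ring)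
      refine ⟨θ d / θ r, 0, m, div_nonneg h hθr.le, le_rfl, ?_, by simpa using hm⟩
      have := hNL hk hm
      simp only [map_sub, map_smul, smul_eq_mul, hkr, mul_zero, sub_zero] at this
      have h1 := hNd k hk
      rw [this] at h1
      exact nonneg_of_mul_nonneg_left h1 (hd₀ k hk)
    · obtain ⟨m, hm⟩ := hker (d - (θ d / θ r') • r') (W.sub_mem hd (W.smul_mem _ hrW')) (by
        simp only [map_sub, map_smul, smul_eq_mul]; field_simp [hθr'.ne]; ring)
      refine ⟨0, θ d / θ r', m, le_rfl, div_nonneg_of_nonpos h hθr'.le, ?_, by simpa using hm⟩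
      have := hNL hk' hm
      simp only [map_sub, map_smul, smul_eq_mul, hkr', mul_zero, sub_zero] at this
      have h1 := hNd k' hk'
      rw [this] at h1
      exact nonneg_of_mul_nonneg_left h1 (hd₀ k' hk')
  obtain ⟨a, b, m, ha, hb, hm, hmem⟩ := key
  refine ⟨a + m / c₀ * (-θ r'), b + m / c₀ * θ r, ?_, ?_, ?_⟩
  · have : 0 ≤ m / c₀ := by positivity
    have := mul_nonneg this (neg_pos.2 hθr').le
    linarith
  · positivity
  · have h1 := L.sub_mem hmem (L.smul_mem (m / c₀) hc₀)
    convert h1 using 1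
    rw [smul_sub, smul_smul (m / c₀) c₀, div_mul_cancel₀ _ hc₀pos.ne']
    module

end Wedge

namespace IneqSystem

variable {ι E : Type*} [AddCommGroup E] [Module ℝ E] (P : IneqSystem ι E)

/-- The directions along which the inequalities in `Z` stay constant. -/
def ker (Z : Set ι) : Submodule ℝ E where
  carrier := {d | ∀ k ∈ Z, P.n k d = 0}
  add_mem' ha hb k hk := by rw [map_add, ha k hk, hb k hk, add_zero]
  zero_mem' k _ := map_zero _
  smul_mem' c d hd k hk := by rw [map_smul, hd k hk, smul_zero]

variable {P}

theorem mem_ker {Z : Set ι} {d : E} : d ∈ P.ker Z ↔ ∀ k ∈ Z, P.n k d = 0 := Iff.rfl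

theorem ker_pair (i j : ι) : P.ker {i, j} = (P.n i).ker ⊓ (P.n j).ker := by
  ext d; simp [mem_ker]

variable (P) in
/-- A bounded spindle with apices `u` and `v` in dimension four. -/
structure Spindle (u v : E) : Prop where
  finrank_eq : Module.finrank ℝ E = 4
  vert_u : P.Vert u
  vert_v : P.Vert v
  disj : ∀ k, k ∈ P.act u → k ∉ P.act v
  cover : ∀ k, k ∈ P.act u ∨ k ∈ P.act v
  bdd : ∀ r, r ≠ 0 → ∃ k, P.n k r < 0
  irr : ∀ k k', k ≠ k' → ∃ z, P.Feas z ∧ k ∈ P.act z ∧ k' ∉ P.act z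

variable (P) in
/-- The vertices other than the two apices. -/
def IsMid (u v x : E) : Prop := P.Vert x ∧ x ≠ u ∧ x ≠ v

variable (P) in
/-- The two-dimensional faces lying on exactly one facet at each apex. -/
def IsCell (u v : E) (c : Set ι) : Prop :=
  ∃ i j z, i ∈ P.act u ∧ j ∈ P.act v ∧ c = {i, j} ∧ P.Feas z ∧ P.act z = c

theorem IsMid.swap {u v x : E} (h : P.IsMid u v x) : P.IsMid v u x := ⟨h.1, h.2.2, h.2.1⟩

theorem IsCell.swap {u v : E} {c : Set ι} (h : P.IsCell u v c) : P.IsCell v u c := by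
  obtain ⟨i, j, z, hi, hj, hc, hz⟩ := h
  exact ⟨j, i, z, hj, hi, by rw [hc, Set.pair_comm], hz⟩

namespace Spindle

variable {u v : E} (h : P.Spindle u v)
include h

theorem swap : P.Spindle v u where
  finrank_eq := h.finrank_eq
  vert_u := h.vert_v
  vert_v := h.vert_u
  disj k hk hk' := h.disj k hk' hk
  cover k := (h.cover k).symm
  bdd := h.bdd
  irr := h.irr

theorem finiteDimensional : FiniteDimensional ℝ E :=
  FiniteDimensional.of_finrank_pos (by rw [h.finrank_eq]; norm_num)

theorem pos_of_mem_u {k : ι} (hk : k ∈ P.act u) : 0 < P.n k (v - u) :=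
  h.vert_v.1.pos hk (h.disj k hk)

theorem neg_of_mem_v {k : ι} (hk : k ∈ P.act v) : P.n k (v - u) < 0 := by
  have := h.swap.pos_of_mem_u hk
  rw [← neg_sub, map_neg]; linarith

theorem exists_mem_u {x : E} (hx : P.IsMid u v x) : ∃ k ∈ P.act u, k ∈ P.act x := by
  by_contra! hcon
  exact hx.2.2 (hx.1.eq_of_act_subset fun k hk => (h.cover k).resolve_left fun hk' => hcon k hk' hk)

theorem exists_mem_v {x : E} (hx : P.IsMid u v x) : ∃ k ∈ P.act v, k ∈ P.act x :=
  h.swap.exists_mem_u hx.swap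

theorem pos_u_sub {x : E} {j : ι} (hj : j ∈ P.act v) (hjx : j ∈ P.act x) : 0 < P.n j (u - x) :=
  h.vert_u.1.pos hjx fun hk => h.disj j hk hj

theorem pos_v_sub {x : E} {i : ι} (hi : i ∈ P.act u) (hix : i ∈ P.act x) : 0 < P.n i (v - x) :=
  h.swap.pos_u_sub hi hix

omit h in
theorem eq_of_sub_eq_smul (h : P.Spindle u v) {x y : E} (hx : P.IsMid u v x)
    (hy : P.IsMid u v y) {c : ℝ} (hc : x - u = c • (y - u)) : x = y :=
  (h.vert_u.eq_or_eq_of_collinear hy.1 hx.1 hc).resolve_left hx.2.1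

theorem eq_zero_of_sub_eq_smul {x y : E} (hx : P.IsMid u v x) (hy : P.IsMid u v y) {c : ℝ}
    (hc : x - y = c • (v - u)) : c = 0 := by
  have main : ∀ {x y : E} {c : ℝ}, P.IsMid u v x → P.IsMid u v y → x - y = c • (v - u) →
      c ≤ 0 := by
    intro x y c hx hy hc
    obtain ⟨i, hi, hix⟩ := h.exists_mem_u hx
    have h1 := hy.1.1.nonneg hix
    rw [← neg_sub, hc, map_neg, map_smul, smul_eq_mul] at h1
    have h2 := h.pos_of_mem_u hi
    nlinarith
  refine le_antisymm (main hx hy hc) ?_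
  have := main (c := -c) hy hx (by rw [← neg_sub, hc, neg_smul])
  linarith

theorem exists_edge_mem_u {x y : E} (hx : P.IsMid u v x) (hy : P.IsMid u v y) (hxy : P.Adj x y) :
    ∃ i ∈ P.act u, i ∈ P.act x ∧ i ∈ P.act y := by
  by_contra! hcon
  obtain ⟨c, hc⟩ := hxy.2 (v - x) fun k hk hk' => n_sub_eq_zero hk
    ((h.cover k).resolve_left fun hu => hcon k hu hk hk')
  rcases hx.1.eq_or_eq_of_collinear hy.1 h.vert_v hc with h | h
  · exact hx.2.2 h.symm
  · exact hy.2.2 h.symm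

theorem exists_edge_mem_v {x y : E} (hx : P.IsMid u v x) (hy : P.IsMid u v y) (hxy : P.Adj x y) :
    ∃ j ∈ P.act v, j ∈ P.act x ∧ j ∈ P.act y :=
  h.swap.exists_edge_mem_u hx.swap hy.swap hxy

/-- Two facets at `u` have independent normals. -/
theorem finrank_ker_pair {i i' : ι} (hi : i ∈ P.act u) (hi' : i' ∈ P.act u) (hne : i ≠ i') :
    Module.finrank ℝ (P.ker {i, i'}) = 2 := by
  have := h.finiteDimensional
  obtain ⟨z, hz, hz1, hz2⟩ := h.irr i i' hne
  have := finrank_ker_inf_ker_add_two (f := P.n i) (g := P.n i') (e₁ := z - u) (e₂ := v - u)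
    (n_sub_eq_zero hi hz1) (hz.pos hi' hz2).ne' (h.pos_of_mem_u hi).ne'
  rw [h.finrank_eq] at this
  rw [ker_pair]
  omega

theorem finrank_ker_mixed {i j : ι} {z : E} (hi : i ∈ P.act u) (hj : j ∈ P.act v)
    (hiz : i ∈ P.act z) (hjz : j ∈ P.act z) : Module.finrank ℝ (P.ker {i, j}) = 2 := by
  have := h.finiteDimensional
  have := finrank_ker_inf_ker_add_two (f := P.n i) (g := P.n j) (e₁ := u - z) (e₂ := v - z)
    (n_sub_eq_zero hiz hi) (h.pos_u_sub hj hjz).ne' (h.pos_v_sub hi hiz).ne'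
  rw [h.finrank_eq] at this
  rw [ker_pair]
  omega

theorem two_le_finrank_ker_pair (i j : ι) : 2 ≤ Module.finrank ℝ (P.ker {i, j}) := by
  have := h.finiteDimensional
  have := finrank_le_ker_inf_ker_add_two (P.n i) (P.n j)
  rw [h.finrank_eq] at this
  rw [ker_pair]
  omega

theorem finrank_ker_cell {c : Set ι} (hc : P.IsCell u v c) : Module.finrank ℝ (P.ker c) = 2 := by
  obtain ⟨i, j, z, hi, hj, rfl, hz, hz'⟩ := hc
  exact h.finrank_ker_mixed hi hj (z := z) (by rw [hz']; simp) (by rw [hz']; simp)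

theorem subsingleton_act_u {z : E} {j : ι} (hj : j ∈ P.act v) (hjz : j ∈ P.act z) {e₁ e₂ : E}
    (h₁ : e₁ ∈ P.ker (P.act z)) (h₂ : e₂ ∈ P.ker (P.act z)) (h₀ : e₁ ≠ 0)
    (hind : ∀ c : ℝ, e₂ ≠ c • e₁) {i i' : ι} (hi : i ∈ P.act u) (hi' : i' ∈ P.act u)
    (hiz : i ∈ P.act z) (hiz' : i' ∈ P.act z) : i = i' := by
  have := h.finiteDimensional
  by_contra hne
  have hmem : ∀ {e}, e ∈ P.ker (P.act z) → e ∈ P.ker {i, i'} := fun he k hk => he k (by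
    rcases hk with rfl | rfl <;> assumption)
  have hu : u - z ∈ P.ker {i, i'} := by
    rintro k (rfl | rfl)
    · exact n_sub_eq_zero hiz hi
    · exact n_sub_eq_zero hiz' hi'
  obtain ⟨a, b, hab⟩ := exists_smul_add_smul_of_finrank_two (h.finrank_ker_pair hi hi' hne).le
    (hmem h₁) (hmem h₂) hu h₀ hind
  have := h.pos_u_sub hj hjz
  rw [hab] at this
  simp [h₁ j hjz, h₂ j hjz] at this

/-- A point on a facet at each apex with two independent directions is on no further facet. -/
theorem act_eq_pair {z : E} {i j : ι} (hi : i ∈ P.act u) (hj : j ∈ P.act v)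
    (hiz : i ∈ P.act z) (hjz : j ∈ P.act z) {e₁ e₂ : E}
    (h₁ : e₁ ∈ P.ker (P.act z)) (h₂ : e₂ ∈ P.ker (P.act z)) (h₀ : e₁ ≠ 0)
    (hind : ∀ c : ℝ, e₂ ≠ c • e₁) : P.act z = {i, j} := by
  refine Set.Subset.antisymm (fun k hk => ?_) ?_
  · rcases h.cover k with hu | hv
    · exact Or.inl (h.subsingleton_act_u hj hjz h₁ h₂ h₀ hind hu hi hk hiz)
    · exact Or.inr (h.swap.subsingleton_act_u hi hiz h₁ h₂ h₀ hind hv hj hk hjz)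
  · rintro k (rfl | rfl) <;> assumption

end Spindle

end IneqSystem

namespace IneqSystem

variable {ι E : Type*} [AddCommGroup E] [Module ℝ E] {P : IneqSystem ι E} {u v : E}

theorem IsCell.isMid (h : P.Spindle u v) {c : Set ι} (hc : P.IsCell u v c) {p : E} (hp : P.Vert p)
    (hcp : c ⊆ P.act p) : P.IsMid u v p := by
  obtain ⟨i, j, z, hi, hj, rfl, hz, hz'⟩ := hc
  refine ⟨hp, ?_, ?_⟩
  · rintro rfl
    exact h.disj j (hcp (Or.inr rfl)) hj
  · rintro rfl
    exact h.disj i hi (hcp (Or.inl rfl))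

variable [Finite ι]

namespace Spindle

variable (h : P.Spindle u v)
include h

theorem exists_side {x : E} {c : Set ι} (hx : P.IsMid u v x) (hc : P.IsCell u v c)
    (hcx : c ⊆ P.act x) {d₀ : E} {θ : E →ₗ[ℝ] ℝ} (hd₀c : d₀ ∈ P.ker c)
    (hd₀ : ∀ k ∈ P.act x \ c, 0 < P.n k d₀) (hθd₀ : θ d₀ = 0)
    (hker : ∀ d ∈ P.ker c, θ d = 0 → ∃ a : ℝ, d = a • d₀) {d₁ : E} (hd₁ : d₁ ∈ P.ker c)
    (hθ₁ : 0 < θ d₁) :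
    ∃ y, P.IsMid u v y ∧ P.Adj x y ∧ c ⊆ P.act y ∧ 0 < θ (y - x) ∧
      ∃ k ∈ P.act x \ c, P.n k (y - x) = 0 := by
  have hne : (P.act x \ c).Nonempty := by
    rw [Set.nonempty_iff_ne_empty]
    intro he
    have : d₁ = 0 := hx.1.2 d₁ fun k hk => hd₁ k (by
      by_contra hkc
      exact (he ▸ (⟨hk, hkc⟩ : k ∈ P.act x \ c) : k ∈ (∅ : Set ι)))
    rw [this, map_zero] at hθ₁
    exact lt_irrefl _ hθ₁
  obtain ⟨r, hrW, hr, ⟨k₀, hk₀, hk₀'⟩, hθr⟩ :=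
    exists_wedge_ray (N := P.n) (Set.toFinite (P.act x \ c)) hne hd₀c hd₀ hθd₀ hd₁ hθ₁
  have hr0 : r ≠ 0 := by rintro rfl; simp at hθr
  obtain ⟨τ, hτ, hv, hadj, hact⟩ := hx.1.exists_travel (h.bdd r hr0)
    (fun k hk => by
      by_cases hkc : k ∈ c
      · exact (hrW k hkc).ge
      · exact hr k ⟨hk, hkc⟩)
    (fun d hd => by
      have hdW : d ∈ P.ker c := fun k hk => hd k (hcx hk) (hrW k hk)
      obtain ⟨a, ha⟩ := hker (d - (θ d / θ r) • r)
        (Submodule.sub_mem _ hdW (Submodule.smul_mem _ _ hrW))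
        (by simp only [map_sub, map_smul, smul_eq_mul]; field_simp; ring)
      have h1 := congrArg (P.n k₀) ha
      simp only [map_sub, map_smul, smul_eq_mul, hk₀', hd k₀ hk₀.1 hk₀', mul_zero, sub_zero] at h1
      have h2 : a = 0 := (mul_eq_zero.1 h1.symm).resolve_right (hd₀ k₀ hk₀).ne'
      rw [h2, zero_smul, sub_eq_zero] at ha
      exact ⟨_, ha⟩)
  have hcy : c ⊆ P.act (x + τ • r) := fun k hk => (hact k (hcx hk)).2 (hrW k hk)
  refine ⟨_, hc.isMid h hv hcy, hadj, hcy, ?_, k₀, hk₀, ?_⟩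
  · rw [add_sub_cancel_left, map_smul, smul_eq_mul]; positivity
  · rw [add_sub_cancel_left, map_smul, smul_eq_mul, hk₀', mul_zero]

/-- Every vertex of a cell has two neighbours in the cell, and these span the cell. -/
theorem exists_sides {x : E} {c : Set ι} (hx : P.IsMid u v x) (hc : P.IsCell u v c)
    (hcx : c ⊆ P.act x) :
    ∃ y₁ y₂, P.IsMid u v y₁ ∧ P.IsMid u v y₂ ∧ P.Adj x y₁ ∧ P.Adj x y₂ ∧ c ⊆ P.act y₁ ∧
      c ⊆ P.act y₂ ∧ y₁ ≠ y₂ ∧ ∀ p, P.Feas p → c ⊆ P.act p →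
        ∃ a b : ℝ, 0 ≤ a ∧ 0 ≤ b ∧ p - x = a • (y₁ - x) + b • (y₂ - x) := by
  have := h.finiteDimensional
  have hsub : ∀ {p}, c ⊆ P.act p → p - x ∈ P.ker c := fun hp k hk => n_sub_eq_zero (hcx hk) (hp hk)
  obtain ⟨z, hz, hzc⟩ : ∃ z, P.Feas z ∧ P.act z = c := by
    obtain ⟨_, _, z, _, _, _, hz⟩ := hc
    exact ⟨z, hz⟩
  have hd₀c : z - x ∈ P.ker c := hsub hzc.ge
  have hd₀ : ∀ k ∈ P.act x \ c, 0 < P.n k (z - x) := fun k hk => hz.pos hk.1 (by rw [hzc]; exact hk.2)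
  obtain ⟨d₁, hd₁, hind⟩ := exists_not_smul_of_two_le_finrank (h.finrank_ker_cell hc).ge (z - x)
  obtain ⟨θ, hθd₀, hθd₁⟩ := exists_dual_of_not_smul hind
  have hz0 : z - x ≠ 0 := by
    intro h0
    have := hx.1.2 d₁ fun k hk => by
      by_cases hkc : k ∈ c
      · exact hd₁ k hkc
      · have := hd₀ k ⟨hk, hkc⟩
        rw [h0, map_zero] at this
        exact absurd this (lt_irrefl _)
    rw [this, map_zero] at hθd₁
    exact lt_irrefl _ hθd₁
  have hker : ∀ d ∈ P.ker c, θ d = 0 → ∃ a : ℝ, d = a • (z - x) := by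
    intro d hd hθd
    obtain ⟨a, b, hab⟩ := exists_smul_add_smul_of_finrank_two (h.finrank_ker_cell hc).le
      hd₀c hd₁ hd hz0 hind
    rw [hab] at hθd
    simp only [map_add, map_smul, smul_eq_mul, hθd₀, mul_zero, zero_add] at hθd
    have : b = 0 := (mul_eq_zero.1 hθd).resolve_right hθd₁.ne'
    exact ⟨a, by rw [hab, this]; simp⟩
  obtain ⟨y₁, hy₁, hadj₁, hcy₁, hθ₁, k₁, hk₁, hk₁'⟩ :=
    h.exists_side hx hc hcx hd₀c hd₀ hθd₀ hker hd₁ hθd₁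
  obtain ⟨y₂, hy₂, hadj₂, hcy₂, hθ₂, k₂, hk₂, hk₂'⟩ :=
    h.exists_side hx hc hcx (θ := -θ) hd₀c hd₀ (by simp [hθd₀]) (fun d hd hθ => hker d hd (by
      simpa using hθ)) (d₁ := -d₁) (Submodule.neg_mem _ hd₁) (by simpa using hθd₁)
  have hθ₂' : θ (y₂ - x) < 0 := by rw [LinearMap.neg_apply] at hθ₂; linarith
  refine ⟨y₁, y₂, hy₁, hy₂, hadj₁, hadj₂, hcy₁, hcy₂, ?_, fun p hp hcp => ?_⟩
  · rintro rfl; linarith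
  · obtain ⟨a, b, ha, hb, hab⟩ := wedge_decomposition (s := P.act x \ c) (N := P.n)
      (W := P.ker c) (L := ⊥) (d₀ := z - x) (θ := θ)
      (by rintro k - l hl; rw [(Submodule.mem_bot ℝ).1 hl, map_zero]) hd₀
      (by rintro l hl; rw [(Submodule.mem_bot ℝ).1 hl, map_zero])
      (fun d hd hθ => by
        obtain ⟨a, ha⟩ := hker d hd hθ
        exact ⟨a, by rw [ha, sub_self]; exact Submodule.zero_mem _⟩)
      (fun d hd hk => by
        rw [Submodule.mem_bot]
        refine hx.1.2 d fun k hk' => ?_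
        by_cases hkc : k ∈ c
        · exact hd k hkc
        · exact hk k ⟨hk', hkc⟩)
      (hsub hcy₁) (hsub hcy₂) (fun k hk => hy₁.1.1.nonneg hk.1) (fun k hk => hy₂.1.1.nonneg hk.1)
      ⟨k₁, hk₁, hk₁'⟩ ⟨k₂, hk₂, hk₂'⟩ hθ₁ hθ₂' (hsub hcp) (fun k hk => hp.nonneg hk.1)
    refine ⟨a, b, ha, hb, ?_⟩
    rw [Submodule.mem_bot] at hab
    rw [sub_sub, sub_eq_zero] at hab
    exact hab

omit [Finite ι] h in
/-- A neighbour whose direction is a nonnegative combination of two others is one of them. -/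
theorem eq_or_eq_of_decomposition {x y y₁ y₂ : E} (hx : P.Vert x) (hy : P.Vert y)
    (hy₁ : P.Vert y₁) (hy₂ : P.Vert y₂) (hxy : P.Adj x y) (h₁ : x ≠ y₁) {a b : ℝ} (ha : 0 ≤ a) (hb : 0 ≤ b)
    (hab : y - x = a • (y₁ - x) + b • (y₂ - x)) : y = y₁ ∨ y = y₂ := by
  rcases ha.eq_or_lt with rfl | ha
  · right
    rw [zero_smul, zero_add] at hab
    exact (hx.eq_or_eq_of_collinear hy₂ hy hab).resolve_left hxy.1.symm
  left
  obtain ⟨c, hc⟩ := hxy.2 (y₁ - x) fun k hk hk' => by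
    have h3 := n_sub_eq_zero hk hk'
    have h4 := hy₁.1.nonneg hk
    have h5 := hy₂.1.nonneg hk
    rw [hab] at h3
    simp only [map_add, map_smul, smul_eq_mul] at h3
    have h6 := mul_nonneg ha.le h4
    have h7 := mul_nonneg hb h5
    exact (mul_eq_zero.1 (by linarith : a * P.n k (y₁ - x) = 0)).resolve_left ha.ne'
  exact ((hx.eq_or_eq_of_collinear hy hy₁ hc).resolve_left h₁.symm).symm

end Spindle

variable (P) in
/-- The combination of the inequalities of a facet at each apex that vanishes on `v - u`. -/
noncomputable def pairForm (u v : E) (k : ι × ι) : E →ₗ[ℝ] ℝ :=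
  (P.n k.1 (v - u))⁻¹ • P.n k.1 - (P.n k.2 (v - u))⁻¹ • P.n k.2

variable (P) in
/-- Pairs of facets at `u` and at `v` containing both `x` and `y`. -/
def edgePairs (u v x y : E) : Set (ι × ι) :=
  {k | (k.1 ∈ P.act u ∧ k.1 ∈ P.act x ∧ k.1 ∈ P.act y) ∧
    (k.2 ∈ P.act v ∧ k.2 ∈ P.act x ∧ k.2 ∈ P.act y)}

omit [Finite ι] in
theorem pairForm_apply (k : ι × ι) (d : E) : P.pairForm u v k d =
    (P.n k.1 (v - u))⁻¹ * P.n k.1 d - (P.n k.2 (v - u))⁻¹ * P.n k.2 d := rfl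

omit [Finite ι] in
theorem pairForm_mid {k : ι × ι} {x y : E} (hk : k ∈ P.edgePairs u v x y) :
    P.pairForm u v k (y - x) = 0 := by
  rw [pairForm_apply, n_sub_eq_zero hk.1.2.1 hk.1.2.2, n_sub_eq_zero hk.2.2.1 hk.2.2.2]
  simp

namespace Spindle

variable (h : P.Spindle u v)
include h

omit [Finite ι]

theorem pairForm_apex {k : ι × ι} (hi : k.1 ∈ P.act u) (hj : k.2 ∈ P.act v) :
    P.pairForm u v k (v - u) = 0 := by
  rw [pairForm_apply, inv_mul_cancel₀ (h.pos_of_mem_u hi).ne',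
    inv_mul_cancel₀ (h.neg_of_mem_v hj).ne, sub_self]

theorem pairForm_nonneg {k : ι × ι} (hi : k.1 ∈ P.act u) (hj : k.2 ∈ P.act v) {d : E}
    (hdi : 0 ≤ P.n k.1 d) (hdj : 0 ≤ P.n k.2 d) : 0 ≤ P.pairForm u v k d := by
  rw [pairForm_apply]
  have h1 := mul_nonneg (inv_nonneg.2 (h.pos_of_mem_u hi).le) hdi
  have h2 := mul_nonneg (inv_nonneg.2 (neg_pos.2 (h.neg_of_mem_v hj)).le) hdj
  rw [inv_neg] at h2
  linarith

theorem eq_zero_of_pairForm {k : ι × ι} (hi : k.1 ∈ P.act u) (hj : k.2 ∈ P.act v) {d : E}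
    (hdi : 0 ≤ P.n k.1 d) (hdj : 0 ≤ P.n k.2 d) (h0 : P.pairForm u v k d = 0) :
    P.n k.1 d = 0 ∧ P.n k.2 d = 0 := by
  rw [pairForm_apply] at h0
  have h3 := inv_pos.2 (h.pos_of_mem_u hi)
  have h4 := inv_pos.2 (neg_pos.2 (h.neg_of_mem_v hj))
  have h1 := mul_nonneg h3.le hdi
  have h2 := mul_nonneg h4.le hdj
  rw [inv_neg] at h2 h4
  constructor
  · exact (mul_eq_zero.1 (by linarith : (P.n k.1 (v - u))⁻¹ * P.n k.1 d = 0)).resolve_left h3.ne'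
  · exact (mul_eq_zero.1 (by linarith : (-(P.n k.2 (v - u))⁻¹) * P.n k.2 d = 0)).resolve_left h4.ne'

theorem pairForm_u_sub {k : ι × ι} {x : E} (hi : k.1 ∈ P.act u) (hj : k.2 ∈ P.act v)
    (hix : k.1 ∈ P.act x) (hjx : k.2 ∈ P.act x) : 0 < P.pairForm u v k (u - x) := by
  rw [pairForm_apply, n_sub_eq_zero hix hi]
  have h1 := h.pos_u_sub hj hjx
  have h2 := mul_pos (inv_pos.2 (neg_pos.2 (h.neg_of_mem_v hj))) h1
  rw [inv_neg] at h2
  linarith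

/-- The common kernel of the pair forms along an edge. -/
theorem mem_span_of_pairForm {x y : E} (hx : P.IsMid u v x) (hy : P.IsMid u v y)
    (hxy : P.Adj x y) {d : E} (hd : ∀ k ∈ P.edgePairs u v x y, P.pairForm u v k d = 0) :
    d ∈ Submodule.span ℝ {v - u, y - x} := by
  obtain ⟨i₀, hi₀⟩ := h.exists_edge_mem_u hx hy hxy
  obtain ⟨j₀, hj₀⟩ := h.exists_edge_mem_v hx hy hxy
  set t := (P.n i₀ (v - u))⁻¹ * P.n i₀ d with ht
  have htj : ∀ j, j ∈ P.act v → j ∈ P.act x → j ∈ P.act y →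
      P.n j d = t * P.n j (v - u) := by
    intro j h1 h2 h3
    have := hd (i₀, j) ⟨hi₀, h1, h2, h3⟩
    rw [pairForm_apply] at this
    have h4 := (h.neg_of_mem_v h1).ne
    have h5 : t = (P.n j (v - u))⁻¹ * P.n j d := by rw [ht]; linarith
    rw [h5]; field_simp
  have hti : ∀ i, i ∈ P.act u → i ∈ P.act x → i ∈ P.act y →
      P.n i d = t * P.n i (v - u) := by
    intro i h1 h2 h3
    have := hd (i, j₀) ⟨⟨h1, h2, h3⟩, hj₀⟩
    rw [pairForm_apply] at this
    have h4 := (h.pos_of_mem_u h1).ne'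
    have h6 := htj j₀ hj₀.1 hj₀.2.1 hj₀.2.2
    have h7 := (h.neg_of_mem_v hj₀.1).ne
    simp only [h6] at this
    have h5 : t = (P.n i (v - u))⁻¹ * P.n i d := by
      field_simp at this ⊢
      linarith
    rw [h5]; field_simp
  obtain ⟨c, hc⟩ := hxy.2 (d - t • (v - u)) fun k hk hk' => by
    rw [map_sub, map_smul, smul_eq_mul]
    rcases h.cover k with hu | hv
    · rw [hti k hu hk hk', sub_self]
    · rw [htj k hv hk hk', sub_self]
  rw [Submodule.mem_span_pair]
  exact ⟨t, c, by rw [← hc]; abel⟩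

theorem exists_edge_dual {x y : E} (hx : P.IsMid u v x) (hy : P.IsMid u v y) (hxy : P.Adj x y) :
    ∃ θ : E →ₗ[ℝ] ℝ, θ (v - u) = 0 ∧ θ (y - x) = 0 ∧ θ (u - x) = 0 ∧ (∃ d, 0 < θ d) ∧
      ∀ d, θ d = 0 → ∃ c : ℝ, d - c • (u - x) ∈ Submodule.span ℝ {v - u, y - x} := by
  have := h.finiteDimensional
  obtain ⟨i, hi⟩ := h.exists_edge_mem_u hx hy hxy
  obtain ⟨j, hj⟩ := h.exists_edge_mem_v hx hy hxy
  have hij : (i, j) ∈ P.edgePairs u v x y := ⟨hi, hj⟩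
  have hli : LinearIndependent ℝ ![v - u, y - x, u - x] := by
    rw [Fintype.linearIndependent_iff]
    intro g hg
    rw [Fin.sum_univ_three] at hg
    simp only [Matrix.cons_val] at hg
    have h2 : g 2 = 0 := by
      have h1 := congrArg (P.pairForm u v (i, j)) hg
      simp only [map_add, map_smul, smul_eq_mul, h.pairForm_apex (k := (i, j)) hi.1 hj.1,
        pairForm_mid hij, mul_zero, zero_add, map_zero] at h1
      exact (mul_eq_zero.1 h1).resolve_right
        (h.pairForm_u_sub (k := (i, j)) hi.1 hj.1 hi.2.1 hj.2.1).ne'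
    have h0 : g 0 = 0 := by
      have h1 := congrArg (P.n i) hg
      simp only [map_add, map_smul, smul_eq_mul, h2, n_sub_eq_zero hi.2.1 hi.2.2, mul_zero,
        add_zero, zero_mul, map_zero] at h1
      exact (mul_eq_zero.1 h1).resolve_right (h.pos_of_mem_u hi.1).ne'
    have h1 : g 1 = 0 := by
      rw [h0, h2, zero_smul, zero_smul, zero_add, add_zero] at hg
      exact (smul_eq_zero.1 hg).resolve_right (sub_ne_zero.2 hxy.1.symm)
    intro k; fin_cases k <;> assumption
  have hfr := finrank_span_eq_card hli
  set S := Submodule.span ℝ (Set.range ![v - u, y - x, u - x]) with hS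
  have hlt : S < ⊤ := by
    rw [lt_top_iff_ne_top]
    intro h0
    rw [h0, finrank_top, h.finrank_eq] at hfr
    simp at hfr
  obtain ⟨θ, hθ0, hθ⟩ := Submodule.exists_le_ker_of_lt_top S hlt
  have hmem : ∀ k, θ (![v - u, y - x, u - x] k) = 0 := fun k =>
    LinearMap.mem_ker.1 (hθ (Submodule.subset_span ⟨k, rfl⟩))
  have hex : ∃ d, 0 < θ d := by
    obtain ⟨d, hd⟩ : ∃ d, θ d ≠ 0 := by
      by_contra! h0
      exact hθ0 (LinearMap.ext h0)
    rcases lt_or_gt_of_ne hd with hd | hd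
    · exact ⟨-d, by simpa using hd⟩
    · exact ⟨d, hd⟩
  refine ⟨θ, hmem 0, hmem 1, hmem 2, hex, fun d hd => ?_⟩
  have heq : S = θ.ker := by
    refine Submodule.eq_of_le_of_finrank_le hθ ?_
    have h1 := LinearMap.finrank_range_add_finrank_ker θ
    have h2 : Module.finrank ℝ θ.range = 1 := by
      have : θ.range = ⊤ := by
        rw [LinearMap.range_eq_top]
        obtain ⟨e, he⟩ := hex
        intro t
        exact ⟨(t / θ e) • e, by rw [map_smul, smul_eq_mul, div_mul_cancel₀ _ he.ne']⟩
      rw [this, finrank_top, Module.finrank_self]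
    rw [hfr, Fintype.card_fin]
    rw [h.finrank_eq] at h1
    omega
  have hdS : d ∈ S := by rw [heq]; exact hd
  rw [hS, Matrix.range_cons, Matrix.range_cons, Matrix.range_cons, Matrix.range_empty,
    Set.union_empty, Set.singleton_union, Set.singleton_union, Submodule.mem_span_triple] at hdS
  obtain ⟨a, b, c, habc⟩ := hdS
  refine ⟨c, Submodule.mem_span_pair.2 ⟨a, b, ?_⟩⟩
  rw [← habc]; abel

end Spindle

end IneqSystem

namespace IneqSystem

variable {ι E : Type*} [AddCommGroup E] [Module ℝ E] {P : IneqSystem ι E} {u v : E}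

theorem IsCell.eq_of_subset (h : P.Spindle u v) {c c' : Set ι} (hc : P.IsCell u v c)
    (hc' : P.IsCell u v c') (hsub : c ⊆ c') : c = c' := by
  obtain ⟨i, j, z, hi, hj, rfl, -⟩ := hc
  obtain ⟨i', j', z', hi', hj', rfl, -⟩ := hc'
  have h1 : i = i' := (hsub (Or.inl rfl)).resolve_right fun e => h.disj i hi (by
    rw [show i = j' from e]; exact hj')
  have h2 : j = j' := (hsub (Or.inr rfl)).resolve_left fun e => h.disj i' hi' (by
    rw [← show j = i' from e]; exact hj)
  rw [h1, h2]

theorem IsCell.exists_pair {c : Set ι} (hc : P.IsCell u v c) :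
    ∃ k : ι × ι, k.1 ∈ P.act u ∧ k.2 ∈ P.act v ∧ c = {k.1, k.2} := by
  obtain ⟨i, j, z, hi, hj, hc, -⟩ := hc
  exact ⟨(i, j), hi, hj, hc⟩

theorem IsCell.exists_witness {c : Set ι} (hc : P.IsCell u v c) :
    ∃ z, P.Feas z ∧ P.act z = c := by
  obtain ⟨i, j, z, hi, hj, hc, hz⟩ := hc
  exact ⟨z, hz⟩

/-- A functional whose kernel is spanned by the edge `xy` together with both apices. -/
structure EdgeDual (u v x y : E) (θ : E →ₗ[ℝ] ℝ) : Prop where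
  apex : θ (v - u) = 0
  edge : θ (y - x) = 0
  base : θ (u - x) = 0
  ker : ∀ d, θ d = 0 → ∃ a : ℝ, d - a • (u - x) ∈ Submodule.span ℝ {v - u, y - x}

theorem EdgeDual.neg {x y : E} {θ : E →ₗ[ℝ] ℝ} (hθ : EdgeDual u v x y θ) :
    EdgeDual u v x y (-θ) where
  apex := by simp [hθ.apex]
  edge := by simp [hθ.edge]
  base := by simp [hθ.base]
  ker d hd := hθ.ker d (by simpa using hd)

namespace Spindle

variable (h : P.Spindle u v) {x y : E} (hx : P.IsMid u v x) (hy : P.IsMid u v y)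
  (hxy : P.Adj x y) {θ : E →ₗ[ℝ] ℝ} (hθ : EdgeDual u v x y θ)
include h hxy

theorem exists_edge_mem_not_mem {c : Set ι} (hc : P.IsCell u v c) :
    ∃ k ∈ P.act x, k ∈ P.act y ∧ k ∉ c := by
  by_contra! hcon
  obtain ⟨d, hd, hind⟩ :=
    exists_not_smul_of_two_le_finrank (h.finrank_ker_cell hc).ge (y - x)
  obtain ⟨a, ha⟩ := hxy.2 d fun k hk hk' => hd k (hcon k hk hk')
  exact hind a ha

omit h hxy in
theorem mem_edgePairs {k : ι × ι} (hi : k.1 ∈ P.act u) (hj : k.2 ∈ P.act v)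
    (hcx : {k.1, k.2} ⊆ P.act x) (hcy : {k.1, k.2} ⊆ P.act y) : k ∈ P.edgePairs u v x y :=
  ⟨⟨hi, hcx (Or.inl rfl), hcy (Or.inl rfl)⟩, ⟨hj, hcx (Or.inr rfl), hcy (Or.inr rfl)⟩⟩

omit hxy in
theorem pairForm_feas_nonneg {k : ι × ι} (hk : k ∈ P.edgePairs u v x y) {p : E} (hp : P.Feas p) :
    0 ≤ P.pairForm u v k (p - x) :=
  h.pairForm_nonneg hk.1.1 hk.2.1 (hp.nonneg hk.1.2.1) (hp.nonneg hk.2.2.1)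

include hθ

omit hxy in
theorem eq_smul_of_edgeDual_eq_zero {c : Set ι} (hc : P.IsCell u v c) (hcx : c ⊆ P.act x)
    (hcy : c ⊆ P.act y) {p : E} (hcp : c ⊆ P.act p) (h0 : θ (p - x) = 0) :
    ∃ β : ℝ, p - x = β • (y - x) := by
  obtain ⟨k, hi, hj, rfl⟩ := hc.exists_pair
  have hk := mem_edgePairs hi hj hcx hcy
  have hki : P.n k.1 (p - x) = 0 := n_sub_eq_zero hk.1.2.1 (hcp (Or.inl rfl))
  have hkj : P.n k.2 (p - x) = 0 := n_sub_eq_zero hk.2.2.1 (hcp (Or.inr rfl))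
  obtain ⟨m, hm⟩ := hθ.ker _ h0
  obtain ⟨a, b, hab⟩ := Submodule.mem_span_pair.1 hm
  have h1 := congrArg (P.pairForm u v k) hab
  simp only [map_add, map_sub, map_smul, smul_eq_mul] at h1
  rw [← map_sub, ← map_sub, ← map_sub, ← map_sub, h.pairForm_apex hi hj, pairForm_mid hk,
    pairForm_apply k (p - x), hki, hkj] at h1
  have hm0 : m = 0 := by
    have := (h.pairForm_u_sub hi hj hk.1.2.1 hk.2.2.1).ne'
    have h2 : m * P.pairForm u v k (u - x) = 0 := by linarith
    exact (mul_eq_zero.1 h2).resolve_right this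
  rw [hm0, zero_smul, sub_zero] at hab
  have h2 := congrArg (P.n k.1) hab
  rw [hki, map_add, map_smul, map_smul, n_sub_eq_zero hk.1.2.1 hk.1.2.2, smul_eq_mul, smul_zero,
    add_zero] at h2
  have ha0 : a = 0 := (mul_eq_zero.1 h2).resolve_right (h.pos_of_mem_u hi).ne'
  exact ⟨b, by rw [← hab, ha0, zero_smul, zero_add]⟩

omit hxy in
theorem exists_eq_of_edgeDual_mul_pos {c c' : Set ι} (hc : P.IsCell u v c)
    (hc' : P.IsCell u v c') (hcx : c ⊆ P.act x) (hcy : c ⊆ P.act y) (hcx' : c' ⊆ P.act x)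
    (hcy' : c' ⊆ P.act y) {p p' : E} (hp : P.Feas p) (hp' : P.Feas p') (hcp : c ⊆ P.act p)
    (hcp' : c' ⊆ P.act p') (hpos : 0 < θ (p - x) * θ (p' - x)) :
    ∃ ρ β : ℝ, 0 < ρ ∧ p - x = ρ • (p' - x) + β • (y - x) := by
  obtain ⟨k, hi, hj, rfl⟩ := hc.exists_pair
  obtain ⟨k', hi', hj', rfl⟩ := hc'.exists_pair
  have hk := mem_edgePairs hi hj hcx hcy
  have hk' := mem_edgePairs hi' hj' hcx' hcy'
  have hθ0 : θ (p' - x) ≠ 0 := right_ne_zero_of_mul hpos.ne'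
  set ρ := θ (p - x) / θ (p' - x) with hρ
  have hρ0 : 0 < ρ := by
    rw [hρ, ← mul_div_mul_right _ _ hθ0]
    exact div_pos hpos (mul_self_pos.2 hθ0)
  obtain ⟨m, hm⟩ := hθ.ker ((p - x) - ρ • (p' - x)) (by
    rw [map_sub θ (p - x), map_smul, smul_eq_mul, hρ, div_mul_cancel₀ _ hθ0, sub_self])
  obtain ⟨a, b, hab⟩ := Submodule.mem_span_pair.1 hm
  have hab' : p - x = ρ • (p' - x) + m • (u - x) + a • (v - u) + b • (y - x) := by
    rw [add_assoc, hab]; abel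
  have h1 := congrArg (P.pairForm u v k) hab'
  have h1' := congrArg (P.pairForm u v k') hab'
  rw [map_add, map_add, map_add, map_smul, map_smul, map_smul, map_smul, h.pairForm_apex hi hj,
    pairForm_mid hk, pairForm_apply k (p - x), n_sub_eq_zero hk.1.2.1 (hcp (Or.inl rfl)),
    n_sub_eq_zero hk.2.2.1 (hcp (Or.inr rfl))] at h1
  rw [map_add, map_add, map_add, map_smul, map_smul, map_smul, map_smul, h.pairForm_apex hi' hj',
    pairForm_mid hk', pairForm_apply k' (p' - x), n_sub_eq_zero hk'.1.2.1 (hcp' (Or.inl rfl)),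
    n_sub_eq_zero hk'.2.2.1 (hcp' (Or.inr rfl))] at h1'
  simp only [smul_eq_mul, mul_zero, sub_zero, zero_add, add_zero] at h1 h1'
  have e1 := mul_nonneg hρ0.le (h.pairForm_feas_nonneg hk hp')
  have e2 := h.pairForm_u_sub hi hj hk.1.2.1 hk.2.2.1
  have e3 := h.pairForm_feas_nonneg hk' hp
  have e4 := h.pairForm_u_sub hi' hj' hk'.1.2.1 hk'.2.2.1
  have hm0 : m = 0 := by
    refine le_antisymm ?_ ?_
    · by_contra! hm
      have := mul_pos hm e2
      linarith
    · rw [h1'] at e3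
      exact nonneg_of_mul_nonneg_left e3 e4
  have h2 := congrArg (P.n k.1) hab'
  have h2' := congrArg (P.n k'.1) hab'
  rw [map_add, map_add, map_add, map_smul, map_smul, map_smul, map_smul, hm0,
    n_sub_eq_zero hk.1.2.1 (hcp (Or.inl rfl)), n_sub_eq_zero hk.1.2.1 hk.1.2.2] at h2
  rw [map_add, map_add, map_add, map_smul, map_smul, map_smul, map_smul, hm0,
    n_sub_eq_zero hk'.1.2.1 (hcp' (Or.inl rfl)), n_sub_eq_zero hk'.1.2.1 hk'.1.2.2] at h2'
  simp only [smul_eq_mul, mul_zero, zero_mul, zero_add, add_zero] at h2 h2'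
  have e5 := mul_nonneg hρ0.le (hp'.nonneg hk.1.2.1)
  have e6 := h.pos_of_mem_u hi
  have e7 := hp.nonneg hk'.1.2.1
  have e8 := h.pos_of_mem_u hi'
  have ha0 : a = 0 := by
    refine le_antisymm ?_ ?_
    · by_contra! ha
      have := mul_pos ha e6
      linarith
    · rw [h2'] at e7
      exact nonneg_of_mul_nonneg_left e7 e8
  exact ⟨ρ, b, hρ0, by rw [hab', hm0, ha0, zero_smul, zero_smul, add_zero, add_zero]⟩

omit hxy in
theorem cell_eq_of_edgeDual_mul_pos {c c' : Set ι} (hc : P.IsCell u v c)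
    (hc' : P.IsCell u v c') (hcx : c ⊆ P.act x) (hcy : c ⊆ P.act y) (hcx' : c' ⊆ P.act x)
    (hcy' : c' ⊆ P.act y) {p z : E} (hp : P.Feas p) (hz : P.Feas z) (hcp : c ⊆ P.act p)
    (hzc : P.act z = c') (hpos : 0 < θ (p - x) * θ (z - x)) : c = c' := by
  obtain ⟨ρ, β, hρ, hab⟩ := h.exists_eq_of_edgeDual_mul_pos hθ hc hc' hcx hcy hcx' hcy' hp hz hcp
    hzc.ge hpos
  refine hc.eq_of_subset h hc' fun k hk => ?_
  rw [← hzc, ← Feas.eq_zero_iff (hcx hk)]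
  have h1 := congrArg (P.n k) hab
  rw [n_sub_eq_zero (hcx hk) (hcp hk), map_add, map_smul, map_smul,
    n_sub_eq_zero (hcx hk) (hcy hk), smul_zero, add_zero, smul_eq_mul] at h1
  exact (mul_eq_zero.1 h1.symm).resolve_left hρ.ne'

theorem edgeDual_mul_witness_pos {c : Set ι} (hc : P.IsCell u v c) (hcx : c ⊆ P.act x)
    (hcy : c ⊆ P.act y) {p z : E} (hp : P.Feas p) (hz : P.Feas z) (hcp : c ⊆ P.act p)
    (hzc : P.act z = c) (h0 : θ (p - x) ≠ 0) : 0 < θ (p - x) * θ (z - x) := by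
  have := h.finiteDimensional
  obtain ⟨k, hkx, hky, hkc⟩ := h.exists_edge_mem_not_mem hxy hc
  have hsub : ∀ {p}, c ⊆ P.act p → p - x ∈ P.ker c := fun hp k hk => n_sub_eq_zero (hcx hk) (hp hk)
  have hkz : 0 < P.n k (z - x) := hz.pos hkx (by rw [hzc]; exact hkc)
  have hky' := n_sub_eq_zero hkx hky
  obtain ⟨a, b, hab⟩ := exists_smul_add_smul_of_finrank_two (h.finrank_ker_cell hc).le
    (hsub hcy) (hsub hzc.ge) (hsub hcp) (sub_ne_zero.2 hxy.1.symm) (fun a ha => by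
      rw [ha, map_smul, hky', smul_zero] at hkz
      exact lt_irrefl _ hkz)
  have h1 := hp.nonneg hkx
  rw [hab, map_add, map_smul, map_smul, hky', smul_zero, zero_add, smul_eq_mul] at h1
  have hb : 0 ≤ b := nonneg_of_mul_nonneg_left h1 hkz
  have h2 : θ (p - x) = b * θ (z - x) := by
    rw [hab, map_add, map_smul, map_smul, hθ.edge, smul_zero, zero_add, smul_eq_mul]
  rw [h2] at h0 ⊢
  have hb' : 0 < b := lt_of_le_of_ne hb (left_ne_zero_of_mul h0).symm
  have := mul_self_pos.2 (right_ne_zero_of_mul h0)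
  rw [mul_assoc]
  exact mul_pos hb' this

include hx hy

theorem exists_cell_of_edgeDual [Finite ι] {d₁ : E} (hd₁ : 0 < θ d₁) :
    ∃ c z, P.IsCell u v c ∧ c ⊆ P.act x ∧ c ⊆ P.act y ∧ P.Feas z ∧ P.act z = c ∧
      0 < θ (z - x) := by
  obtain ⟨i₁, hi₁⟩ := h.exists_edge_mem_u hx hy hxy
  obtain ⟨j₁, hj₁⟩ := h.exists_edge_mem_v hx hy hxy
  obtain ⟨r, -, hr, ⟨⟨i₀, j₀⟩, hk₀, hk₀'⟩, hθr⟩ :=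
    exists_wedge_ray (N := P.pairForm u v) (W := ⊤) (θ := θ) (d₀ := u - x)
      (Set.toFinite (P.edgePairs u v x y))
      ⟨(i₁, j₁), hi₁, hj₁⟩ trivial
      (fun k hk => h.pairForm_u_sub hk.1.1 hk.2.1 hk.1.2.1 hk.2.2.1) hθ.base trivial hd₁
  have hi₀ : i₀ ∈ P.act u ∧ i₀ ∈ P.act x ∧ i₀ ∈ P.act y := hk₀.1
  have hj₀ : j₀ ∈ P.act v ∧ j₀ ∈ P.act x ∧ j₀ ∈ P.act y := hk₀.2
  set t := (P.n i₀ (v - u))⁻¹ * P.n i₀ r with ht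
  have htj : (P.n j₀ (v - u))⁻¹ * P.n j₀ r = t := by
    rw [pairForm_apply] at hk₀'
    simp only at hk₀'
    rw [ht]; linarith
  have hpi := h.pos_of_mem_u hi₀.1
  have hnj := h.neg_of_mem_v hj₀.1
  have hti₀ : P.n i₀ (r - t • (v - u)) = 0 := by
    rw [map_sub, map_smul, smul_eq_mul, ht]; field_simp; ring
  have htj₀ : P.n j₀ (r - t • (v - u)) = 0 := by
    have := hnj.ne
    rw [map_sub, map_smul, smul_eq_mul, ← htj]; field_simp; ring
  set r' := r - t • (v - u) with hr'
  have hθr' : θ r' = θ r := by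
    rw [hr', map_sub, map_smul, hθ.apex, smul_zero, sub_zero]
  have hri : ∀ i, i ∈ P.act u → i ∈ P.act x → i ∈ P.act y → 0 ≤ P.n i r' := by
    intro i h1 h2 h3
    have h4 := hr (i, j₀) ⟨⟨h1, h2, h3⟩, hj₀⟩
    rw [pairForm_apply] at h4
    simp only [htj] at h4
    have h5 := h.pos_of_mem_u h1
    rw [hr', map_sub, map_smul, smul_eq_mul]
    have h6 := mul_nonneg h5.le h4
    have h7 : P.n i (v - u) * ((P.n i (v - u))⁻¹ * P.n i r - t) = P.n i r - t * P.n i (v - u) := by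
      field_simp
    linarith
  have hrj : ∀ j, j ∈ P.act v → j ∈ P.act x → j ∈ P.act y → 0 ≤ P.n j r' := by
    intro j h1 h2 h3
    have h4 := hr (i₀, j) ⟨hi₀, h1, h2, h3⟩
    rw [pairForm_apply] at h4
    simp only [← ht] at h4
    have h5 := h.neg_of_mem_v h1
    rw [hr', map_sub, map_smul, smul_eq_mul]
    have h6 := mul_nonneg (neg_pos.2 h5).le h4
    have h7 : -P.n j (v - u) * (t - (P.n j (v - u))⁻¹ * P.n j r) =
        P.n j r - t * P.n j (v - u) := by
      have := h5.ne
      field_simp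
      ring
    linarith
  set m := x + (1 / 2 : ℝ) • (y - x) with hm
  have hmk : ∀ k, P.n k m = (P.n k x + P.n k y) / 2 := by
    intro k; rw [hm, map_add, map_smul, map_sub, smul_eq_mul]; ring
  have hmf : P.Feas m := fun k => by
    rw [hmk]; linarith [hx.1.1 k, hy.1.1 k]
  have hmact : P.act m = P.act x ∩ P.act y := by
    ext k
    rw [mem_act, hmk, Set.mem_inter_iff, mem_act, mem_act]
    have h1 := hx.1.1 k
    have h2 := hy.1.1 k
    constructor
    · intro h3; constructor <;> linarith
    · rintro ⟨h3, h4⟩; linarith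
  obtain ⟨ε, hε, hzf, hza⟩ := hmf.exists_step (r := r') (fun k hk => by
    rw [hmact] at hk
    rcases h.cover k with hu | hv
    · exact hri k hu hk.1 hk.2
    · exact hrj k hv hk.1 hk.2)
  rw [hmact] at hza
  have hiz : i₀ ∈ P.act (m + ε • r') := by rw [hza]; exact ⟨hi₀.2, hti₀⟩
  have hjz : j₀ ∈ P.act (m + ε • r') := by rw [hza]; exact ⟨hj₀.2, htj₀⟩
  have hpair := h.act_eq_pair hi₀.1 hj₀.1 hiz hjz (e₁ := y - x) (e₂ := r')
    (fun k hk => by rw [hza] at hk; exact n_sub_eq_zero hk.1.1 hk.1.2)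
    (fun k hk => by rw [hza] at hk; exact hk.2) (sub_ne_zero.2 hxy.1.symm)
    (fun a ha => by
      rw [← hθr', ha, map_smul, hθ.edge, smul_zero] at hθr
      exact lt_irrefl _ hθr)
  refine ⟨{i₀, j₀}, _, ⟨i₀, j₀, _, hi₀.1, hj₀.1, rfl, hzf, hpair⟩, ?_, ?_, hzf, hpair, ?_⟩
  · rintro k (rfl | rfl)
    · exact hi₀.2.1
    · exact hj₀.2.1
  · rintro k (rfl | rfl)
    · exact hi₀.2.2
    · exact hj₀.2.2
  · have : m + ε • r' - x = (1 / 2 : ℝ) • (y - x) + ε • r' := by rw [hm]; abel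
    rw [this, map_add, map_smul, map_smul, hθ.edge, hθr', smul_zero, zero_add, smul_eq_mul]
    positivity

omit hθ

/-- Every edge between middle vertices lies in exactly two cells. -/
theorem exists_two_cells [Finite ι] :
    ∃ c₁ c₂, P.IsCell u v c₁ ∧ P.IsCell u v c₂ ∧ c₁ ⊆ P.act x ∧ c₁ ⊆ P.act y ∧ c₂ ⊆ P.act x ∧
      c₂ ⊆ P.act y ∧ c₁ ≠ c₂ ∧ ∀ c, P.IsCell u v c → c ⊆ P.act x → c ⊆ P.act y →
        c = c₁ ∨ c = c₂ := by
  obtain ⟨θ, h1, h2, h3, ⟨d, hd⟩, h4⟩ := h.exists_edge_dual hx hy hxy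
  have hθ : EdgeDual u v x y θ := ⟨h1, h2, h3, h4⟩
  obtain ⟨c₁, z₁, hc₁, hx₁, hy₁, hz₁, ha₁, hθ₁⟩ := h.exists_cell_of_edgeDual hx hy hxy hθ hd
  obtain ⟨c₂, z₂, hc₂, hx₂, hy₂, hz₂, ha₂, hθ₂⟩ :=
    h.exists_cell_of_edgeDual hx hy hxy hθ.neg (d₁ := -d) (by simpa using hd)
  have hθ₂' : θ (z₂ - x) < 0 := by rw [LinearMap.neg_apply] at hθ₂; linarith
  refine ⟨c₁, c₂, hc₁, hc₂, hx₁, hy₁, hx₂, hy₂, ?_, fun c hc hcx hcy => ?_⟩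
  · rintro rfl
    have := h.edgeDual_mul_witness_pos hxy hθ hc₁ hx₁ hy₁ hz₁ hz₂ ha₁.ge ha₂ hθ₁.ne'
    nlinarith
  · obtain ⟨z, hz, hza⟩ := hc.exists_witness
    rcases lt_trichotomy (θ (z - x)) 0 with hs | hs | hs
    · exact Or.inr (h.cell_eq_of_edgeDual_mul_pos hθ hc hc₂ hcx hcy hx₂ hy₂ hz hz₂ hza.ge ha₂
        (mul_pos_of_neg_of_neg hs hθ₂'))
    · obtain ⟨β, hβ⟩ := h.eq_smul_of_edgeDual_eq_zero hθ hc hcx hcy hza.ge hs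
      obtain ⟨k, hkx, hky, hkc⟩ := h.exists_edge_mem_not_mem hxy hc
      rw [← hza] at hkc
      have := hz.pos hkx hkc
      rw [hβ, map_smul, n_sub_eq_zero hkx hky, smul_zero] at this
      exact absurd this (lt_irrefl _)
    · exact Or.inl (h.cell_eq_of_edgeDual_mul_pos hθ hc hc₁ hcx hcy hx₁ hy₁ hz hz₁ hza.ge ha₁
        (mul_pos hs hθ₁))

/-- Feasible points are, modulo the edge and the axis, nonnegative combinations of points in the
two cells at the edge. -/
theorem edge_decomposition {c₁ c₂ : Set ι} (hc₁ : P.IsCell u v c₁)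
    (hc₂ : P.IsCell u v c₂) (hne : c₁ ≠ c₂) (hx₁ : c₁ ⊆ P.act x) (hy₁ : c₁ ⊆ P.act y)
    (hx₂ : c₂ ⊆ P.act x) (hy₂ : c₂ ⊆ P.act y) {p₁ p₂ : E} (hp₁ : P.IsMid u v p₁)
    (hp₂ : P.IsMid u v p₂) (hcp₁ : c₁ ⊆ P.act p₁) (hcp₂ : c₂ ⊆ P.act p₂) (hp₁x : p₁ ≠ x)
    (hp₁y : p₁ ≠ y) (hp₂x : p₂ ≠ x) (hp₂y : p₂ ≠ y) {p : E} (hp : P.Feas p) :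
    ∃ α β a b : ℝ, 0 ≤ a ∧ 0 ≤ b ∧
      p - x = α • (v - u) + β • (y - x) + a • (p₁ - x) + b • (p₂ - x) := by
  obtain ⟨θ, h1, h2, h3, -, h4⟩ := h.exists_edge_dual hx hy hxy
  have hθ : EdgeDual u v x y θ := ⟨h1, h2, h3, h4⟩
  have hnz : ∀ {c p}, P.IsCell u v c → c ⊆ P.act x → c ⊆ P.act y → P.IsMid u v p → c ⊆ P.act p →
      p ≠ x → p ≠ y → θ (p - x) ≠ 0 := by
    intro c p hc hcx hcy hp hcp hpx hpy h0
    obtain ⟨β, hβ⟩ := h.eq_smul_of_edgeDual_eq_zero hθ hc hcx hcy hcp h0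
    rcases hx.1.eq_or_eq_of_collinear hy.1 hp.1 hβ with e | e
    · exact hpx e
    · exact hpy e
  have hn₁ := hnz hc₁ hx₁ hy₁ hp₁ hcp₁ hp₁x hp₁y
  have hn₂ := hnz hc₂ hx₂ hy₂ hp₂ hcp₂ hp₂x hp₂y
  have hmul : θ (p₁ - x) * θ (p₂ - x) < 0 := by
    refine lt_of_le_of_ne (le_of_not_gt fun hpos => hne ?_) (mul_ne_zero hn₁ hn₂)
    obtain ⟨z, hz, hza⟩ := hc₂.exists_witness
    have h5 := h.edgeDual_mul_witness_pos hxy hθ hc₂ hx₂ hy₂ hp₂.1.1 hz hcp₂ hza hn₂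
    refine h.cell_eq_of_edgeDual_mul_pos hθ hc₁ hc₂ hx₁ hy₁ hx₂ hy₂ hp₁.1.1 hz hcp₁ hza ?_
    have h6 := mul_pos hpos h5
    have h7 : θ (p₁ - x) * θ (p₂ - x) * (θ (p₂ - x) * θ (z - x)) =
      (θ (p₁ - x) * θ (z - x)) * (θ (p₂ - x) * θ (p₂ - x)) := by ring
    rw [h7] at h6
    exact pos_of_mul_pos_left h6 (mul_self_nonneg _)
  have hpair : ∀ {c p}, P.IsCell u v c → c ⊆ P.act x → c ⊆ P.act y → c ⊆ P.act p →
      ∃ k ∈ P.edgePairs u v x y, P.pairForm u v k (p - x) = 0 := by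
    intro c p hc hcx hcy hcp
    obtain ⟨k, hi, hj, rfl⟩ := hc.exists_pair
    refine ⟨k, mem_edgePairs hi hj hcx hcy, ?_⟩
    rw [pairForm_apply, n_sub_eq_zero (hcx (Or.inl rfl)) (hcp (Or.inl rfl)),
      n_sub_eq_zero (hcx (Or.inr rfl)) (hcp (Or.inr rfl)), mul_zero, mul_zero, sub_zero]
  have main : ∀ {r r' : E}, P.Feas r → P.Feas r' → 0 < θ (r - x) → θ (r' - x) < 0 →
      (∃ k ∈ P.edgePairs u v x y, P.pairForm u v k (r - x) = 0) →
      (∃ k ∈ P.edgePairs u v x y, P.pairForm u v k (r' - x) = 0) →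
      ∃ α β a b : ℝ, 0 ≤ a ∧ 0 ≤ b ∧
        p - x = α • (v - u) + β • (y - x) + a • (r - x) + b • (r' - x) := by
    intro r r' hr hr' hθr hθr' hk hk'
    obtain ⟨a, b, ha, hb, hab⟩ := wedge_decomposition (s := P.edgePairs u v x y)
      (N := P.pairForm u v) (W := ⊤) (L := Submodule.span ℝ {v - u, y - x}) (d₀ := u - x) (θ := θ)
      (fun k hk l hl => by
        obtain ⟨a, b, rfl⟩ := Submodule.mem_span_pair.1 hl
        rw [map_add, map_smul, map_smul, h.pairForm_apex hk.1.1 hk.2.1, pairForm_mid hk, smul_zero,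
          smul_zero, add_zero])
      (fun k hk => h.pairForm_u_sub hk.1.1 hk.2.1 hk.1.2.1 hk.2.2.1)
      (fun l hl => by
        obtain ⟨a, b, rfl⟩ := Submodule.mem_span_pair.1 hl
        rw [map_add, map_smul, map_smul, h1, h2, smul_zero, smul_zero, add_zero])
      (fun d _ hd => h4 d hd) (fun d _ hd => h.mem_span_of_pairForm hx hy hxy hd)
      trivial trivial (fun k hk => h.pairForm_feas_nonneg hk hr)
      (fun k hk => h.pairForm_feas_nonneg hk hr') hk hk' hθr hθr' (d := p - x) trivial
      (fun k hk => h.pairForm_feas_nonneg hk hp)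
    obtain ⟨α, β, hαβ⟩ := Submodule.mem_span_pair.1 hab
    exact ⟨α, β, a, b, ha, hb, by rw [hαβ]; abel⟩
  have hk₁ := hpair hc₁ hx₁ hy₁ hcp₁
  have hk₂ := hpair hc₂ hx₂ hy₂ hcp₂
  rcases mul_neg_iff.1 hmul with ⟨ha, hb⟩ | ⟨ha, hb⟩
  · exact main hp₁.1.1 hp₂.1.1 ha hb hk₁ hk₂
  · obtain ⟨α, β, a, b, h5, h6, h7⟩ := main hp₂.1.1 hp₁.1.1 hb ha hk₂ hk₁
    exact ⟨α, β, b, a, h6, h5, by rw [h7]; abel⟩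

end Spindle

end IneqSystem

theorem exists_generic_dual {E : Type*} [AddCommGroup E] [Module ℝ E] [FiniteDimensional ℝ E]
    {D : Set E} (hD : D.Finite) (q : E) (h : ∀ d ∈ D, ∀ c : ℝ, d ≠ c • q) :
    ∃ φ : E →ₗ[ℝ] ℝ, φ q = 0 ∧ ∀ d ∈ D, φ d ≠ 0 := by
  have := hD.to_subtype
  obtain ⟨φ, h1, h2⟩ := Module.Dual.exists_forall_mem_ne_zero_of_forall_exists
    (p := (Module.Dual.eval ℝ E q).ker)
    (fun d : D => Module.Dual.eval ℝ E d.1) (fun d => by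
      obtain ⟨θ, h1, h2⟩ := exists_dual_of_not_smul (h d.1 d.2)
      exact ⟨θ, h1, h2.ne'⟩)
  exact ⟨φ, h1, fun d hd => h2 ⟨d, hd⟩⟩

namespace IneqSystem

variable {ι E : Type*} [AddCommGroup E] [Module ℝ E] {P : IneqSystem ι E} {u v : E} [Finite ι]

variable (P) in
/-- The sum of the linear forms in `Z`. -/
noncomputable def sumForm (Z : Set ι) : E →ₗ[ℝ] ℝ := ∑ k ∈ (Set.toFinite Z).toFinset, P.n k

theorem sumForm_apply (Z : Set ι) (d : E) :
    P.sumForm Z d = ∑ k ∈ (Set.toFinite Z).toFinset, P.n k d := by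
  rw [sumForm, LinearMap.sum_apply]

theorem sumForm_nonneg {Z : Set ι} {d : E} (h : ∀ k ∈ Z, 0 ≤ P.n k d) : 0 ≤ P.sumForm Z d := by
  rw [sumForm_apply]
  exact Finset.sum_nonneg fun k hk => h k (by simpa using hk)

theorem sumForm_eq_zero {Z : Set ι} {d : E} (h : ∀ k ∈ Z, P.n k d = 0) : P.sumForm Z d = 0 := by
  rw [sumForm_apply]
  exact Finset.sum_eq_zero fun k hk => h k (by simpa using hk)

theorem sumForm_pos {Z : Set ι} {d : E} (h : ∀ k ∈ Z, 0 ≤ P.n k d) {k : ι} (hk : k ∈ Z)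
    (hpos : 0 < P.n k d) : 0 < P.sumForm Z d := by
  rw [sumForm_apply]
  exact Finset.sum_pos' (fun k hk => h k (by simpa using hk)) ⟨k, by simpa using hk, hpos⟩

theorem sumForm_sub_pos {Z : Set ι} {x p : E} (hZ : Z ⊆ P.act x) (hp : P.Feas p)
    (h : ¬ Z ⊆ P.act p) : 0 < P.sumForm Z (p - x) := by
  obtain ⟨k, hk, hkp⟩ := Set.not_subset.1 h
  exact sumForm_pos (fun k hk => hp.nonneg (hZ hk)) hk (hp.pos (hZ hk) hkp)

theorem finite_setOf_isMid : {x | P.IsMid u v x}.Finite :=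
  finite_setOf_vert.subset fun _ hx => hx.1

namespace Spindle

variable (h : P.Spindle u v)
include h

theorem exists_other_side {x y : E} {c : Set ι} (hx : P.IsMid u v x) (hc : P.IsCell u v c)
    (hcx : c ⊆ P.act x) (hy : P.IsMid u v y) (hxy : P.Adj x y) (hcy : c ⊆ P.act y) :
    ∃ y', P.IsMid u v y' ∧ P.Adj x y' ∧ c ⊆ P.act y' ∧ y' ≠ y ∧
      ∀ p, P.IsMid u v p → P.Adj x p → c ⊆ P.act p → p = y ∨ p = y' := by
  obtain ⟨y₁, y₂, hy₁, hy₂, hadj₁, hadj₂, hcy₁, hcy₂, hne, hdec⟩ := h.exists_sides hx hc hcx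
  have huniq : ∀ p, P.IsMid u v p → P.Adj x p → c ⊆ P.act p → p = y₁ ∨ p = y₂ := by
    intro p hp hxp hcp
    obtain ⟨a, b, ha, hb, hab⟩ := hdec p hp.1.1 hcp
    exact eq_or_eq_of_decomposition hx.1 hp.1 hy₁.1 hy₂.1 hxp hadj₁.1 ha hb hab
  rcases huniq y hy hxy hcy with rfl | rfl
  · exact ⟨y₂, hy₂, hadj₂, hcy₂, hne.symm, huniq⟩
  · exact ⟨y₁, hy₁, hadj₁, hcy₁, hne, fun p h1 h2 h3 => (huniq p h1 h2 h3).symm⟩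

/-- The vertices of a cell on one side of a hyperplane are connected by edges of the cell. -/
theorem eq_of_adj_eq_in_cell {α : Type*} {c : Set ι} (hc : P.IsCell u v c) (ℓ : E →ₗ[ℝ] ℝ) (t : ℝ)
    (f : E → α) (hf : ∀ x y, P.IsMid u v x → P.IsMid u v y → c ⊆ P.act x → c ⊆ P.act y →
      P.Adj x y → t < ℓ x → t < ℓ y → f x = f y) {x y : E} (hx : P.IsMid u v x)
    (hy : P.IsMid u v y) (hcx : c ⊆ P.act x) (hcy : c ⊆ P.act y) (htx : t < ℓ x) (hty : t < ℓ y) :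
    f x = f y := by
  by_contra hxy
  obtain ⟨p, ⟨hp, hcp, htp, hfp⟩, hmin⟩ := Set.exists_min_image
    {p | P.IsMid u v p ∧ c ⊆ P.act p ∧ t < ℓ p ∧ f p ≠ f y}
    (fun p => P.sumForm (P.act y) (p - y) / (ℓ p - t))
    (finite_setOf_isMid.subset fun p hp => hp.1) ⟨x, hx, hcx, htx, hxy⟩
  have hpy : p ≠ y := by rintro rfl; exact hfp rfl
  set ψ := P.sumForm (P.act y) with hψ
  set s := ψ (p - y) / (ℓ p - t) with hs
  have htp' : 0 < ℓ p - t := by linarith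
  have hψp : 0 < ψ (p - y) := sumForm_sub_pos subset_rfl hp.1.1 fun hsub =>
    hpy (hy.1.eq_of_act_subset hsub).symm
  have hs0 : 0 < s := div_pos hψp htp'
  have hsp : ψ p - ψ y = s * (ℓ p - t) := by
    rw [hs, div_mul_cancel₀ _ htp'.ne', map_sub]
  obtain ⟨y₁, y₂, hy₁, hy₂, hadj₁, hadj₂, hcy₁, hcy₂, -, hdec⟩ := h.exists_sides hp hc hcp
  obtain ⟨a, b, ha, hb, hab⟩ := hdec y hy.1.1 hcy
  have step : ∀ z, P.IsMid u v z → P.Adj p z → c ⊆ P.act z → ¬ (ψ - s • ℓ) (z - p) < 0 := by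
    intro z hz hpz hcz hneg
    simp only [LinearMap.sub_apply, LinearMap.smul_apply, map_sub, smul_eq_mul] at hneg
    have h0 : 0 ≤ ψ (z - y) := sumForm_nonneg fun k hk => hz.1.1.nonneg hk
    rw [map_sub] at h0
    have h1 : ψ z - ψ y < s * (ℓ z - t) := by linarith
    have h2 : 0 < ℓ z - t := by
      by_contra! hcon
      have := mul_nonneg hs0.le (neg_nonneg.2 hcon)
      linarith
    have h3 := hmin z ⟨hz, hcz, by linarith, by
      rw [← hf p z hp hz hcp hcz hpz htp (by linarith)]; exact hfp⟩
    change s ≤ ψ (z - y) / (ℓ z - t) at h3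
    rw [le_div_iff₀ h2, map_sub] at h3
    linarith
  have h1 := congrArg (ψ - s • ℓ) hab
  rw [map_add, map_smul, map_smul, smul_eq_mul, smul_eq_mul] at h1
  have h2 := mul_nonneg ha (not_lt.1 (step y₁ hy₁ hadj₁ hcy₁))
  have h3 := mul_nonneg hb (not_lt.1 (step y₂ hy₂ hadj₂ hcy₂))
  have h4 : (ψ - s • ℓ) (y - p) < 0 := by
    simp only [LinearMap.sub_apply, LinearMap.smul_apply, map_sub, smul_eq_mul]
    have := mul_pos hs0 (sub_pos.2 hty)
    linarith
  linarith

/-- The upper neighbours of a vertex are connected through the cells at that vertex. -/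
theorem eq_of_cell_eq_of_upper {α : Type*} {φ : E →ₗ[ℝ] ℝ} (hφ : φ (v - u) = 0) {x : E}
    (hx : P.IsMid u v x) (f : E → α)
    (hf : ∀ y y' c, P.IsMid u v y → P.IsMid u v y' → P.Adj x y → P.Adj x y' → P.IsCell u v c →
      c ⊆ P.act x → c ⊆ P.act y → c ⊆ P.act y' → φ x < φ y → φ x < φ y' → f y = f y')
    {y z : E} (hy : P.IsMid u v y) (hz : P.IsMid u v z) (hxy : P.Adj x y) (hxz : P.Adj x z)
    (hφy : φ x < φ y) (hφz : φ x < φ z) : f y = f z := by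
  by_contra hyz
  set ψ : E →ₗ[ℝ] ℝ := ∑ k ∈ (Set.toFinite (P.edgePairs u v x z)).toFinset, P.pairForm u v k
    with hψ
  have hψapp : ∀ d, ψ d = ∑ k ∈ (Set.toFinite (P.edgePairs u v x z)).toFinset,
      P.pairForm u v k d := fun d => by rw [hψ, LinearMap.sum_apply]
  have hψnn : ∀ p, P.Feas p → 0 ≤ ψ (p - x) := fun p hp => by
    rw [hψapp]
    exact Finset.sum_nonneg fun k hk => h.pairForm_feas_nonneg (by simpa using hk) hp
  have hψq : ψ (v - u) = 0 := by
    rw [hψapp]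
    refine Finset.sum_eq_zero fun k hk => ?_
    have hk : k ∈ P.edgePairs u v x z := by simpa using hk
    exact h.pairForm_apex hk.1.1 hk.2.1
  have hψz : ψ (z - x) = 0 := by
    rw [hψapp]
    exact Finset.sum_eq_zero fun k hk => pairForm_mid (by simpa using hk)
  obtain ⟨p, ⟨hp, hxp, hφp, hfp⟩, hmin⟩ := Set.exists_min_image
    {p | P.IsMid u v p ∧ P.Adj x p ∧ φ x < φ p ∧ f p ≠ f z}
    (fun p => ψ (p - x) / φ (p - x))
    (finite_setOf_isMid.subset fun p hp => hp.1) ⟨y, hy, hxy, hφy, hyz⟩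
  have hpz : p ≠ z := by rintro rfl; exact hfp rfl
  set s := ψ (p - x) / φ (p - x) with hs
  have hφp' : 0 < φ (p - x) := by rw [map_sub]; linarith
  have hψp : 0 < ψ (p - x) := by
    refine lt_of_le_of_ne (hψnn p hp.1.1) fun h0 => hpz ?_
    have h1 : ∀ k ∈ P.edgePairs u v x z, P.pairForm u v k (p - x) = 0 := by
      rw [hψapp, eq_comm, Finset.sum_eq_zero_iff_of_nonneg (fun k hk =>
        h.pairForm_feas_nonneg (by simpa using hk) hp.1.1)] at h0
      exact fun k hk => h0 k (by simpa using hk)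
    have h2 : ∀ k ∈ P.edgePairs u v x z, P.n k.1 (p - x) = 0 ∧ P.n k.2 (p - x) = 0 :=
      fun k hk => h.eq_zero_of_pairForm hk.1.1 hk.2.1 (hp.1.1.nonneg hk.1.2.1)
        (hp.1.1.nonneg hk.2.2.1) (h1 k hk)
    obtain ⟨i, hi⟩ := h.exists_edge_mem_u hx hz hxz
    obtain ⟨j, hj⟩ := h.exists_edge_mem_v hx hz hxz
    obtain ⟨c, hc⟩ := hxz.2 (p - x) fun k hk hk' => by
      rcases h.cover k with hu | hv
      · exact (h2 (k, j) ⟨⟨hu, hk, hk'⟩, hj⟩).1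
      · exact (h2 (i, k) ⟨hi, hv, hk, hk'⟩).2
    exact (hx.1.eq_or_eq_of_collinear hz.1 hp.1 hc).resolve_left hxp.1.symm
  have hs0 : 0 < s := div_pos hψp hφp'
  have hsp : ψ (p - x) = s * φ (p - x) := by rw [hs, div_mul_cancel₀ _ hφp'.ne']
  have step : ∀ w c, P.IsCell u v c → c ⊆ P.act x → c ⊆ P.act p → P.IsMid u v w → P.Adj x w →
      c ⊆ P.act w → ¬ (ψ - s • φ) (w - x) < 0 := by
    intro w c hc hcx hcp hw hxw hcw hneg
    simp only [LinearMap.sub_apply, LinearMap.smul_apply, smul_eq_mul] at hneg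
    have h0 := hψnn w hw.1.1
    have h2 : 0 < φ (w - x) := by
      by_contra! hcon
      have := mul_nonneg hs0.le (neg_nonneg.2 hcon)
      linarith
    have hφw : φ x < φ w := by rw [map_sub] at h2; linarith
    have h3 := hmin w ⟨hw, hxw, hφw, by
      rw [← hf p w c hp hw hxp hxw hc hcx hcp hcw hφp hφw]; exact hfp⟩
    change s ≤ ψ (w - x) / φ (w - x) at h3
    rw [le_div_iff₀ h2] at h3
    linarith
  obtain ⟨c₁, c₂, hc₁, hc₂, hx₁, hp₁, hx₂, hp₂, hne, -⟩ := h.exists_two_cells hx hp hxp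
  obtain ⟨w₁, hw₁, hadj₁, hcw₁, hwp₁, -⟩ := h.exists_other_side hx hc₁ hx₁ hp hxp hp₁
  obtain ⟨w₂, hw₂, hadj₂, hcw₂, hwp₂, -⟩ := h.exists_other_side hx hc₂ hx₂ hp hxp hp₂
  obtain ⟨α, β, a, b, ha, hb, hab⟩ := h.edge_decomposition hx hp hxp hc₁ hc₂ hne hx₁ hp₁ hx₂ hp₂
    hw₁ hw₂ hcw₁ hcw₂ hadj₁.1.symm hwp₁ hadj₂.1.symm hwp₂ hz.1.1
  have h1 := congrArg (ψ - s • φ) hab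
  have e1 : (ψ - s • φ) (v - u) = 0 := by
    rw [LinearMap.sub_apply, LinearMap.smul_apply, hψq, hφ, smul_zero, sub_zero]
  have e2 : (ψ - s • φ) (p - x) = 0 := by
    rw [LinearMap.sub_apply, LinearMap.smul_apply, hsp, smul_eq_mul, sub_self]
  rw [map_add, map_add, map_add, map_smul, map_smul, map_smul, map_smul, smul_eq_mul, smul_eq_mul,
    smul_eq_mul, smul_eq_mul, e1, e2] at h1
  have h2 := mul_nonneg ha (not_lt.1 (step w₁ c₁ hc₁ hx₁ hp₁ hw₁ hadj₁ hcw₁))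
  have h3 := mul_nonneg hb (not_lt.1 (step w₂ c₂ hc₂ hx₂ hp₂ hw₂ hadj₂ hcw₂))
  have h4 : (ψ - s • φ) (z - x) < 0 := by
    rw [LinearMap.sub_apply, LinearMap.smul_apply, hψz, map_sub, smul_eq_mul]
    have := mul_pos hs0 (sub_pos.2 hφz)
    linarith
  linarith

/-- A generic functional constant along the axis separates the middle vertices. -/
theorem exists_injOn_dual : ∃ φ : E →ₗ[ℝ] ℝ, φ (v - u) = 0 ∧
    ∀ x y, P.IsMid u v x → P.IsMid u v y → φ x = φ y → x = y := by
  have := h.finiteDimensional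
  obtain ⟨φ, h1, h2⟩ := exists_generic_dual
    (D := (fun p : E × E => p.1 - p.2) ''
      {p | P.IsMid u v p.1 ∧ P.IsMid u v p.2 ∧ p.1 ≠ p.2})
    (Set.Finite.image _ ((finite_setOf_isMid.prod finite_setOf_isMid).subset
      fun p hp => ⟨hp.1, hp.2.1⟩)) (v - u) (by
        rintro _ ⟨p, ⟨hp1, hp2, hp3⟩, rfl⟩ c hc
        have := h.eq_zero_of_sub_eq_smul hp1 hp2 hc
        rw [this, zero_smul] at hc
        exact hp3 (sub_eq_zero.1 hc))
  refine ⟨φ, h1, fun x y hx hy hxy => ?_⟩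
  by_contra hne
  refine h2 _ ⟨(x, y), ⟨hx, hy, hne⟩, rfl⟩ ?_
  rw [map_sub, hxy, sub_self]

/-- A cochain on the edges that is exact on every cell is exact. -/
theorem exists_potential (ω : E → E → ℝ)
    (hω : ∀ c, P.IsCell u v c → ∃ p : E → ℝ, ∀ x y, P.IsMid u v x → P.IsMid u v y → P.Adj x y →
      c ⊆ P.act x → c ⊆ P.act y → ω x y = p y - p x) :
    ∃ p : E → ℝ, ∀ x y, P.IsMid u v x → P.IsMid u v y → P.Adj x y → ω x y = p y - p x := by
  classical
  obtain ⟨φ, hφ, hinj⟩ := h.exists_injOn_dual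
  have hanti : ∀ x y, P.IsMid u v x → P.IsMid u v y → P.Adj x y → ω y x = -ω x y := by
    intro x y hx hy hxy
    obtain ⟨c, -, hc, -, hcx, hcy, -⟩ := h.exists_two_cells hx hy hxy
    obtain ⟨p, hp⟩ := hω c hc
    rw [hp x y hx hy hxy hcx hcy, hp y x hy hx hxy.symm hcy hcx]
    ring
  have key : ∀ s : Finset E, (∀ x ∈ s, P.IsMid u v x) →
      (∀ x ∈ s, ∀ y, P.IsMid u v y → φ x < φ y → y ∈ s) →
      ∃ p : E → ℝ, ∀ x ∈ s, ∀ y ∈ s, P.Adj x y → ω x y = p y - p x := by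
    intro s
    induction s using Finset.induction_on_min_value φ with
    | empty => exact fun _ _ => ⟨0, by simp⟩
    | insert a s has hmin ih =>
      intro hmid hup
      have ha := hmid a (Finset.mem_insert_self _ _)
      have hmid' : ∀ x ∈ s, P.IsMid u v x := fun x hx => hmid x (Finset.mem_insert_of_mem hx)
      obtain ⟨p, hp⟩ := ih hmid' (by
        intro x hx y hy hxy
        refine (Finset.mem_insert.1
          (hup x (Finset.mem_insert_of_mem hx) y hy hxy)).resolve_left ?_
        rintro rfl
        exact absurd (hmin x hx) (not_le.2 hxy))
      have hups : ∀ y, P.IsMid u v y → φ a < φ y → y ∈ s := fun y hy hay =>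
        (Finset.mem_insert.1 (hup a (Finset.mem_insert_self _ _) y hy hay)).resolve_left (by
          rintro rfl; exact lt_irrefl _ hay)
      have hlt : ∀ y ∈ s, φ a < φ y := fun y hy => lt_of_le_of_ne (hmin y hy) fun e =>
        has (by rw [hinj a y ha (hmid' y hy) e]; exact hy)
      have hconst : ∀ y z, P.IsMid u v y → P.IsMid u v z → P.Adj a y → P.Adj a z → φ a < φ y →
          φ a < φ z → p y - ω a y = p z - ω a z := by
        intro y z hy hz hay haz hφy hφz
        refine h.eq_of_cell_eq_of_upper hφ ha (fun y => p y - ω a y) ?_ hy hz hay haz hφy hφz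
        intro y y' c hy hy' hay hay' hc hca hcy hcy' hφy hφy'
        obtain ⟨g, hg⟩ := hω c hc
        have h1 := h.eq_of_adj_eq_in_cell hc φ (φ a) (fun y => p y - g y) (by
          intro x y hx hy hcx hcy hxy hφx hφy
          have e1 := hp x (hups x hx hφx) y (hups y hy hφy) hxy
          have e2 := hg x y hx hy hxy hcx hcy
          linarith) hy hy' hcy hcy' hφy hφy'
        have e1 := hg a y ha hy hay hca hcy
        have e2 := hg a y' ha hy' hay' hca hcy'
        linarith
      obtain ⟨t, ht⟩ : ∃ t, ∀ y ∈ s, P.Adj a y → ω a y = p y - t := by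
        by_cases hex : ∃ y ∈ s, P.Adj a y
        · obtain ⟨y, hy, hay⟩ := hex
          refine ⟨p y - ω a y, fun z hz haz => ?_⟩
          rw [hconst y z (hmid' y hy) (hmid' z hz) hay haz (hlt y hy) (hlt z hz)]
          ring
        · push Not at hex
          exact ⟨0, fun y hy hay => absurd hay (hex y hy)⟩
      have hne : ∀ y ∈ s, y ≠ a := by rintro y hy rfl; exact has hy
      refine ⟨Function.update p a t, fun x hx y hy hxy => ?_⟩
      rcases Finset.mem_insert.1 hx with rfl | hx' <;> rcases Finset.mem_insert.1 hy with rfl | hy'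
      · exact absurd rfl hxy.1
      · rw [Function.update_self, Function.update_of_ne (hne y hy')]
        exact ht y hy' hxy
      · rw [Function.update_self, Function.update_of_ne (hne x hx'),
          hanti y x ha (hmid' x hx') hxy.symm, ht x hx' hxy.symm]
        ring
      · rw [Function.update_of_ne (hne x hx'), Function.update_of_ne (hne y hy')]
        exact hp x hx' y hy' hxy
  obtain ⟨p, hp⟩ := key finite_setOf_isMid.toFinset
    (fun x hx => by simpa using hx) (fun x _ y hy _ => by simpa using hy)
  exact ⟨p, fun x y hx hy => hp x (by simpa using hx) y (by simpa using hy)⟩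

end Spindle

end IneqSystem

namespace IneqSystem

variable {ι E : Type*} [AddCommGroup E] [Module ℝ E] {P : IneqSystem ι E} {u v : E}

variable (P) in
/-- The point `x` lies on at most one facet at `u`. -/
def Thin (u x : E) : Prop := (P.act x ∩ P.act u).Subsingleton

variable (P) in
/-- The edge `xy` lies on at most one facet at `u`. -/
def EdgeThin (u x y : E) : Prop := (P.act x ∩ P.act y ∩ P.act u).Subsingleton

variable (P) in
/-- The vertex `x` lies on several facets at each apex. -/
def Mixed (u v x : E) : Prop := ¬ P.Thin u x ∧ ¬ P.Thin v x

variable (P) in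
/-- The edge `xy` varies in the facets at `u` only. -/
def VType (u v x y : E) : Prop := P.EdgeThin u x y ∨ ¬ P.EdgeThin v x y ∧ P.Adj u x

variable (P) in
/-- No edge walk with at most four steps activates new facets at `v` all along. -/
structure NoShortWalk (u v : E) : Prop where
  two_step : ∀ x, P.IsMid u v x → P.Adj u x → ¬ P.Adj v x
  three_step : ∀ a w, P.IsMid u v a → P.IsMid u v w → P.Adj u a → P.Adj v w → P.Adj a w →
    ¬ P.act a ∩ P.act v ⊆ P.act w
  four_step : ∀ a x w, P.IsMid u v a → P.IsMid u v x → P.IsMid u v w → P.Adj u a → P.Adj v w →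
    P.Adj a x → P.Adj x w → P.act a ∩ P.act v ⊆ P.act x → ¬ P.act x ∩ P.act v ⊆ P.act a →
    ¬ P.act x ∩ P.act v ⊆ P.act w

theorem Thin.edgeThin {x : E} (h : P.Thin u x) (y : E) : P.EdgeThin u x y :=
  h.anti fun _ hk => ⟨hk.1.1, hk.2⟩

theorem EdgeThin.symm {x y : E} (h : P.EdgeThin u x y) : P.EdgeThin u y x := by
  rwa [EdgeThin, Set.inter_comm (P.act y)]

theorem Mixed.swap {x : E} (h : P.Mixed u v x) : P.Mixed v u x := ⟨h.2, h.1⟩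

theorem not_mixed_iff {x : E} : ¬ P.Mixed u v x ↔ P.Thin u x ∨ P.Thin v x := by
  rw [Mixed, not_and_or, not_not, not_not]

namespace Spindle

variable (h : P.Spindle u v)
include h

theorem not_edgeThin [Finite ι] {x y : E} (hx : P.IsMid u v x) (hy : P.IsMid u v y)
    (hxy : P.Adj x y) (hu : P.EdgeThin u x y) : ¬ P.EdgeThin v x y := by
  intro hv
  obtain ⟨c₁, c₂, hc₁, hc₂, hx₁, hy₁, hx₂, hy₂, hne, -⟩ := h.exists_two_cells hx hy hxy
  obtain ⟨k₁, hi₁, hj₁, rfl⟩ := hc₁.exists_pair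
  obtain ⟨k₂, hi₂, hj₂, rfl⟩ := hc₂.exists_pair
  have e1 := hu ⟨⟨hx₁ (Or.inl rfl), hy₁ (Or.inl rfl)⟩, hi₁⟩ ⟨⟨hx₂ (Or.inl rfl), hy₂ (Or.inl rfl)⟩, hi₂⟩
  have e2 := hv ⟨⟨hx₁ (Or.inr rfl), hy₁ (Or.inr rfl)⟩, hj₁⟩ ⟨⟨hx₂ (Or.inr rfl), hy₂ (Or.inr rfl)⟩, hj₂⟩
  exact hne (by rw [e1, e2])

theorem not_thin {x : E} (hx : P.IsMid u v x) (hu : P.Thin u x) : ¬ P.Thin v x := by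
  intro hv
  have := h.finiteDimensional
  obtain ⟨i, hi, hix⟩ := h.exists_mem_u hx
  obtain ⟨j, hj, hjx⟩ := h.exists_mem_v hx
  obtain ⟨d, hd, hd0⟩ := exists_not_smul_of_two_le_finrank (h.two_le_finrank_ker_pair i j) 0
  refine hd0 0 ?_
  rw [zero_smul]
  refine hx.1.2 d fun k hk => hd k ?_
  rcases h.cover k with hku | hkv
  · exact Or.inl (hu ⟨hk, hku⟩ ⟨hix, hi⟩)
  · exact Or.inr (hv ⟨hk, hkv⟩ ⟨hjx, hj⟩)

theorem adj_of_thin {x : E} (hx : P.IsMid u v x) (hu : P.Thin u x) : P.Adj v x := by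
  refine ⟨hx.2.2.symm, fun d hd => ?_⟩
  obtain ⟨i, hi, hix⟩ := h.exists_mem_u hx
  have hpos := h.pos_v_sub hi hix
  refine ⟨P.n i d / P.n i (x - v), ?_⟩
  rw [← sub_eq_zero]
  refine hx.1.2 _ fun k hk => ?_
  have hne : P.n i (x - v) ≠ 0 := by rw [← neg_sub, map_neg]; linarith
  rw [map_sub, map_smul, smul_eq_mul]
  rcases h.cover k with hku | hkv
  · rw [hu ⟨hk, hku⟩ ⟨hix, hi⟩, div_mul_cancel₀ _ hne, sub_self]
  · rw [hd k hkv hk, n_sub_eq_zero hkv hk, mul_zero, sub_zero]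

theorem edge_ker {x y : E} (hx : P.IsMid u v x) (hux : ¬ P.Adj u x) (ht : ¬ P.EdgeThin u x y)
    {d : E} (hd : ∀ k ∈ P.act x, k ∈ P.act y → k ∈ P.act u → P.n k d = 0) {k : ι}
    (hk : k ∈ P.act x) (hku : k ∈ P.act u) : P.n k d = 0 := by
  have := h.finiteDimensional
  obtain ⟨e, he, hind⟩ : ∃ e, (∀ k ∈ P.act u, k ∈ P.act x → P.n k e = 0) ∧
      ∀ c : ℝ, e ≠ c • (x - u) := by
    by_contra! hcon
    exact hux ⟨hx.2.1.symm, hcon⟩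
  rw [EdgeThin, Set.not_subsingleton_iff] at ht
  obtain ⟨i, hi, i', hi', hne⟩ := ht
  have hmem : ∀ {e : E}, (∀ k ∈ P.act x, k ∈ P.act y → k ∈ P.act u → P.n k e = 0) →
      e ∈ P.ker {i, i'} := by
    rintro e he k (rfl | rfl)
    · exact he _ hi.1.1 hi.1.2 hi.2
    · exact he _ hi'.1.1 hi'.1.2 hi'.2
  obtain ⟨a, b, rfl⟩ := exists_smul_add_smul_of_finrank_two
    (h.finrank_ker_pair hi.2 hi'.2 hne).le
    (hmem fun k hk _ hku => n_sub_eq_zero hku hk) (hmem fun k hk _ hku => he k hku hk) (hmem hd)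
    (sub_ne_zero.2 hx.2.1) hind
  rw [map_add, map_smul, map_smul, n_sub_eq_zero hku hk, he k hku hk, smul_zero, smul_zero,
    add_zero]

theorem subset_of_not_edgeThin {x y : E} (hx : P.IsMid u v x)
    (hux : ¬ P.Adj u x) (ht : ¬ P.EdgeThin u x y) :
    P.act x ∩ P.act u ⊆ P.act y := fun k hk => by
  rw [← Feas.eq_zero_iff hk.1]
  exact h.edge_ker hx hux ht (fun k hk hk' _ => n_sub_eq_zero hk hk') hk.1 hk.2

theorem adj_apex_of_not_edgeThin {x y : E} (hx : P.IsMid u v x) (hxy : P.Adj x y)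
    (hu : ¬ P.EdgeThin u x y) (hv : ¬ P.EdgeThin v x y) : P.Adj u x ∨ P.Adj v x := by
  by_contra! hcon
  have h0 : y - x = 0 := hx.1.2 _ fun k hk => by
    rcases h.cover k with hku | hkv
    · exact h.edge_ker hx hcon.1 hu (fun k hk hk' _ => n_sub_eq_zero hk hk') hk hku
    · exact h.swap.edge_ker hx.swap hcon.2 hv (fun k hk hk' _ => n_sub_eq_zero hk hk') hk hkv
  exact hxy.1 (sub_eq_zero.1 h0).symm

theorem not_adj_of_thin_of_thin [Finite ι] {x y : E} (hx : P.IsMid u v x) (hy : P.IsMid u v y)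
    (hxy : P.Adj x y) (hu : P.Thin u x) : ¬ P.Thin v y := fun hv =>
  h.not_edgeThin hx hy hxy (hu.edgeThin y) (hv.edgeThin x).symm

/-- Adjacent vertices on one facet at `u` lie on the same facet at `u`. -/
theorem thin_inter_eq {x y : E} (hx : P.IsMid u v x) (hy : P.IsMid u v y)
    (hxy : P.Adj x y) (hux : P.Thin u x) (huy : P.Thin u y) {i : ι} (hi : i ∈ P.act u) :
    i ∈ P.act x ↔ i ∈ P.act y := by
  obtain ⟨k, hk, hkx, hky⟩ := h.exists_edge_mem_u hx hy hxy
  constructor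
  · intro hix; rwa [hux ⟨hix, hi⟩ ⟨hkx, hk⟩]
  · intro hiy; rwa [huy ⟨hiy, hi⟩ ⟨hky, hk⟩]

section NoShortWalk

variable [Finite ι] (hM : P.NoShortWalk u v)
include hM

omit [Finite ι] in
theorem adj_u_of_not_edgeThin {x y : E} (hx : P.IsMid u v x) (hy : P.IsMid u v y)
    (hxy : P.Adj x y) (hu : ¬ P.EdgeThin u x y) (hv : ¬ P.EdgeThin v x y) (hux : P.Adj u x) :
    P.Adj u y := by
  by_contra huy
  have hvy := (h.adj_apex_of_not_edgeThin hy hxy.symm (fun h => hu h.symm)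
    (fun h => hv h.symm)).resolve_left huy
  exact hM.three_step x y hx hy hux hvy hxy
    (h.swap.subset_of_not_edgeThin hx.swap (hM.two_step x hx hux) hv)

omit [Finite ι] in
theorem vType_symm {x y : E} (hx : P.IsMid u v x) (hy : P.IsMid u v y) (hxy : P.Adj x y)
    (ht : P.VType u v x y) : P.VType u v y x := by
  by_cases hu : P.EdgeThin u x y
  · exact Or.inl hu.symm
  · obtain ⟨hv, hux⟩ := ht.resolve_left hu
    exact Or.inr ⟨fun h => hv h.symm, h.adj_u_of_not_edgeThin hM hx hy hxy hu hv hux⟩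

omit hM in
theorem vType_iff_of_not_adj_v {x y : E} (hx : P.IsMid u v x) (hy : P.IsMid u v y)
    (hxy : P.Adj x y) (hm : P.Mixed u v x) (hvx : ¬ P.Adj v x) :
    P.VType u v x y ↔ P.act x ∩ P.act v ⊆ P.act y := by
  constructor
  · intro ht
    refine h.swap.subset_of_not_edgeThin hx.swap hvx ?_
    rcases ht with ht | ht
    · exact h.not_edgeThin hx hy hxy ht
    · exact ht.1
  · intro hs
    have hv : ¬ P.EdgeThin v x y := fun hv => hm.2 (hv.anti fun k hk => ⟨⟨hk.1, hs hk⟩, hk.2⟩)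
    by_cases hu : P.EdgeThin u x y
    · exact Or.inl hu
    · exact Or.inr ⟨hv, (h.adj_apex_of_not_edgeThin hx hxy hu hv).resolve_right hvx⟩

omit hM [Finite ι] in
theorem not_vType_iff_of_not_adj_u {x y : E} (hx : P.IsMid u v x)
    (hm : P.Mixed u v x) (hux : ¬ P.Adj u x) :
    ¬ P.VType u v x y ↔ P.act x ∩ P.act u ⊆ P.act y := by
  constructor
  · intro ht
    exact h.subset_of_not_edgeThin hx hux fun hu => ht (Or.inl hu)
  · rintro hs (hu | hu)
    · exact hm.1 (hu.anti fun k hk => ⟨⟨hk.1, hs hk⟩, hk.2⟩)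
    · exact hux hu.2

omit h hM [Finite ι] in
theorem vType_of_thin_u {x y : E} (hu : P.Thin u x) : P.VType u v x y := Or.inl (hu.edgeThin y)

omit hM in
theorem not_vType_of_thin_v {x y : E} (hx : P.IsMid u v x) (hy : P.IsMid u v y) (hxy : P.Adj x y)
    (hv : P.Thin v x) : ¬ P.VType u v x y := by
  rintro (hu | hu)
  · exact h.not_edgeThin hx hy hxy hu (hv.edgeThin y)
  · exact hu.1 (hv.edgeThin y)

/-- A mixed neighbour of a vertex on one facet at `u` is not adjacent to `u`. -/
theorem not_adj_u_of_exit {w z : E} (hw : P.IsMid u v w) (hz : P.IsMid u v z) (hwz : P.Adj w z)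
    (hu : P.Thin u w) : ¬ P.Adj u z := fun huz =>
  hM.three_step z w hz hw huz (h.adj_of_thin hw hu) hwz.symm
    (h.swap.subset_of_not_edgeThin hz.swap (hM.two_step z hz huz)
      (h.not_edgeThin hz hw hwz.symm (hu.edgeThin z).symm))

omit [Finite ι] in
theorem not_adj_v_of_exit {w z : E} (hw : P.IsMid u v w) (hz : P.IsMid u v z) (hwz : P.Adj w z)
    (hv : P.Thin v w) : ¬ P.Adj v z := fun hvz => by
  obtain ⟨j, hj, hjw, hjz⟩ := h.exists_edge_mem_v hw hz hwz
  refine hM.three_step w z hw hz (h.swap.adj_of_thin hw.swap hv) hvz hwz fun k hk => ?_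
  rwa [hv hk ⟨hjw, hj⟩]

/-- A mixed vertex is not adjacent to thin vertices of both kinds. -/
theorem not_adj_thin_thin {a x w : E} (ha : P.IsMid u v a) (hx : P.IsMid u v x)
    (hw : P.IsMid u v w) (hm : P.Mixed u v x) (hva : P.Thin v a) (huw : P.Thin u w)
    (hax : P.Adj a x) (hxw : P.Adj x w) : False := by
  obtain ⟨j, hj, hja, hjx⟩ := h.exists_edge_mem_v ha hx hax
  have hvx := h.not_adj_v_of_exit hM ha hx hax hva
  refine hM.four_step a x w ha hx hw (h.swap.adj_of_thin ha.swap hva) (h.adj_of_thin hw huw)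
    hax hxw (fun k hk => ?_) (fun hs => ?_)
    ((h.vType_iff_of_not_adj_v hx hw hxw hm hvx).1 (Or.inl (huw.edgeThin x).symm))
  · rwa [hva hk ⟨hja, hj⟩]
  · exact hm.2 (hva.anti fun k hk => ⟨hs hk, hk.2⟩)

end NoShortWalk

/-- From a vertex one can move along its facets at `u` in a prescribed direction. -/
theorem exists_neighbor [Finite ι] {x : E} (hx : P.IsMid u v x) (θ : E →ₗ[ℝ] ℝ)
    (hθ : θ (u - x) = 0) {d : E} (hd : ∀ k ∈ P.act x, k ∈ P.act u → P.n k d = 0) (hθd : 0 < θ d) :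
    ∃ y, P.IsMid u v y ∧ P.Adj x y ∧ P.act x ∩ P.act u ⊆ P.act y ∧ 0 < θ (y - x) := by
  obtain ⟨M, hM⟩ : ∃ M : ℝ, ∀ k ∈ P.act x, k ∈ P.act v → 0 ≤ P.n k (d + M • (u - x)) := by
    obtain ⟨M, hM⟩ := (Set.toFinite ((fun k => -P.n k d / P.n k (u - x)) '' P.act x)).bddAbove
    refine ⟨M, fun k hk hkv => ?_⟩
    have h1 := hM ⟨k, hk, rfl⟩
    simp only at h1
    rw [div_le_iff₀ (h.pos_u_sub hkv hk)] at h1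
    rw [map_add, map_smul, smul_eq_mul]
    linarith
  let W := P.ker (P.act x ∩ P.act u)
  have hmem : d + M • (u - x) ∈ W := fun k hk => by
    rw [map_add, map_smul, hd k hk.1 hk.2, n_sub_eq_zero hk.1 hk.2, smul_zero, add_zero]
  obtain ⟨⟨r, hrW⟩, hr, hθr, hext⟩ := exists_extremal_direction (Set.toFinite (P.act x))
    (fun k => (P.n k).comp W.subtype) (-θ.comp W.subtype) ⟨_, hmem⟩ (fun k hk => by
      rcases h.cover k with hku | hkv
      · exact (hmem k ⟨hk, hku⟩).ge
      · exact hM k hk hkv) (by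
      simp only [LinearMap.neg_apply, LinearMap.comp_apply, Submodule.subtype_apply, map_add,
        map_smul, hθ, smul_zero, add_zero]
      linarith)
  simp only [LinearMap.neg_apply, LinearMap.comp_apply, Submodule.subtype_apply] at hr hθr hext
  have hr0 : r ≠ 0 := by rintro rfl; simp at hθr
  obtain ⟨τ, hτ, hvert, hadj, hact⟩ := hx.1.exists_travel (h.bdd r hr0) hr (fun d hd => by
    obtain ⟨c, hc⟩ := hext ⟨d, fun k hk => hd k hk.1 (hrW k hk)⟩ fun k hk h0 => hd k hk h0
    refine ⟨c, sub_eq_zero.1 (hx.1.2 _ fun k hk => ?_)⟩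
    simpa using hc k hk)
  have hsub : P.act x ∩ P.act u ⊆ P.act (x + τ • r) := fun k hk => (hact k hk.1).2 (hrW k hk)
  have hpos : 0 < θ (x + τ • r - x) := by
    rw [add_sub_cancel_left, map_smul, smul_eq_mul]
    exact mul_pos hτ (by linarith)
  refine ⟨_, ⟨hvert, ?_, ?_⟩, hadj, hsub, hpos⟩
  · intro e; rw [e, hθ] at hpos; exact lt_irrefl _ hpos
  · intro e
    obtain ⟨i, hi, hix⟩ := h.exists_mem_u hx
    exact h.disj i hi (e ▸ hsub ⟨hix, hi⟩)

end Spindle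

end IneqSystem

namespace IneqSystem

variable {ι E : Type*} [AddCommGroup E] [Module ℝ E] {P : IneqSystem ι E} {u v : E}

variable (P) in
/-- The point `y` is the far end of an edge of the cell `c` at `x`. -/
def Side (u v : E) (c : Set ι) (x y : E) : Prop := P.IsMid u v y ∧ P.Adj x y ∧ c ⊆ P.act y

variable (P) in
/-- The two edges of the cell `c` at `x` have different types. -/
def Turn (u v : E) (c : Set ι) (x : E) : Prop :=
  ∃ y y', P.Side u v c x y ∧ P.Side u v c x y' ∧ P.VType u v x y ∧ ¬ P.VType u v x y'

namespace Spindle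

variable (h : P.Spindle u v)
include h

theorem eq_of_subset_of_cell {x y y' : E} {c : Set ι} (hx : P.IsMid u v x) (hy : P.IsMid u v y)
    (hy' : P.IsMid u v y') (hc : P.IsCell u v c) (hcx : c ⊆ P.act x) (hcy : c ⊆ P.act y)
    (hcy' : c ⊆ P.act y') (hxy : P.Adj x y) (hxy' : P.Adj x y') (ht : ¬ P.Thin u x)
    (hs : P.act x ∩ P.act u ⊆ P.act y) (hs' : P.act x ∩ P.act u ⊆ P.act y') : y = y' := by
  have := h.finiteDimensional
  obtain ⟨⟨i₀, j⟩, -, hj, rfl⟩ := hc.exists_pair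
  have hjx : j ∈ P.act x := hcx (Or.inr rfl)
  rw [Thin, Set.not_subsingleton_iff] at ht
  obtain ⟨i, hi, i', hi', hne⟩ := ht
  have hmem : ∀ {p}, P.act x ∩ P.act u ⊆ P.act p → p - x ∈ P.ker {i, i'} := by
    rintro p hp k (rfl | rfl)
    · exact n_sub_eq_zero hi.1 (hp hi)
    · exact n_sub_eq_zero hi'.1 (hp hi')
  have hxu : u - x ≠ 0 := sub_ne_zero.2 hx.2.1.symm
  obtain ⟨a, b, hab⟩ := exists_smul_add_smul_of_finrank_two
    (h.finrank_ker_pair hi.2 hi'.2 hne).le (hmem hs)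
    (hmem fun k hk => hk.2) (hmem hs') (sub_ne_zero.2 hxy.1.symm) (fun e he => by
      rcases hx.1.eq_or_eq_of_collinear hy.1 h.vert_u he with h1 | h1
      · exact hx.2.1 h1.symm
      · exact hy.2.1 h1.symm)
  have h1 := congrArg (P.n j) hab
  rw [n_sub_eq_zero hjx (hcy' (Or.inr rfl)), map_add, map_smul, map_smul,
    n_sub_eq_zero hjx (hcy (Or.inr rfl)), smul_zero, zero_add, smul_eq_mul, zero_eq_mul] at h1
  rw [h1.resolve_right (h.pos_u_sub hj hjx).ne', zero_smul, add_zero] at hab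
  exact ((hx.1.eq_or_eq_of_collinear hy.1 hy'.1 hab).resolve_left hxy'.1.symm).symm

variable [Finite ι]

theorem exists_four_cells {x : E} (hx : P.IsMid u v x) (ht : ¬ P.Thin u x) (hux : ¬ P.Adj u x) :
    ∃ T : Finset (Set ι), T.card = 4 ∧ ∀ c ∈ T, P.IsCell u v c ∧ c ⊆ P.act x ∧
      ∃ y y', P.Side u v c x y ∧ P.Side u v c x y' ∧ P.act x ∩ P.act u ⊆ P.act y ∧
        ¬ P.act x ∩ P.act u ⊆ P.act y' := by
  classical
  obtain ⟨d, hd, hind⟩ : ∃ d, (∀ k ∈ P.act u, k ∈ P.act x → P.n k d = 0) ∧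
      ∀ c : ℝ, d ≠ c • (x - u) := by
    by_contra! hcon
    exact hux ⟨hx.2.1.symm, hcon⟩
  obtain ⟨θ, hθ, hθd⟩ := exists_dual_of_not_smul hind
  have hθ' : θ (u - x) = 0 := by rw [← neg_sub, map_neg, hθ, neg_zero]
  obtain ⟨y, hy, hxy, hs, hpos⟩ := h.exists_neighbor hx θ hθ' (fun k hk hku => hd k hku hk) hθd
  obtain ⟨y', hy', hxy', hs', hpos'⟩ := h.exists_neighbor hx (-θ) (d := -d) (by simp [hθ'])
    (fun k hk hku => by rw [map_neg, hd k hku hk, neg_zero]) (by simpa using hθd)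
  have hyy : y ≠ y' := by
    rintro rfl
    rw [LinearMap.neg_apply] at hpos'
    linarith
  have huniq : ∀ {p q c}, P.IsMid u v p → P.IsMid u v q → P.Adj x p → P.Adj x q →
      P.act x ∩ P.act u ⊆ P.act p → P.act x ∩ P.act u ⊆ P.act q → P.IsCell u v c → c ⊆ P.act x →
      c ⊆ P.act p → c ⊆ P.act q → p = q := fun hp hq hxp hxq hsp hsq hc hcx hcp hcq =>
    h.eq_of_subset_of_cell hx hp hq hc hcx hcp hcq hxp hxq ht hsp hsq
  have hside : ∀ {p c}, P.IsMid u v p → P.Adj x p → P.act x ∩ P.act u ⊆ P.act p →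
      P.IsCell u v c → c ⊆ P.act x → c ⊆ P.act p →
      P.IsCell u v c ∧ c ⊆ P.act x ∧
      ∃ y y', P.Side u v c x y ∧ P.Side u v c x y' ∧ P.act x ∩ P.act u ⊆ P.act y ∧
        ¬ P.act x ∩ P.act u ⊆ P.act y' := by
    intro p c hp hxp hsp hc hcx hcp
    obtain ⟨q, hq, hxq, hcq, hne, -⟩ := h.exists_other_side hx hc hcx hp hxp hcp
    exact ⟨hc, hcx, p, q, ⟨hp, hxp, hcp⟩, ⟨hq, hxq, hcq⟩, hsp, fun hsq =>
      hne (huniq hq hp hxq hxp hsq hsp hc hcx hcq hcp)⟩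
  obtain ⟨c₁, c₂, hc₁, hc₂, hx₁, hy₁, hx₂, hy₂, hne, -⟩ := h.exists_two_cells hx hy hxy
  obtain ⟨c₃, c₄, hc₃, hc₄, hx₃, hy₃, hx₄, hy₄, hne', -⟩ := h.exists_two_cells hx hy' hxy'
  have hdif : ∀ {c c'}, P.IsCell u v c → c ⊆ P.act x → c ⊆ P.act y → c' ⊆ P.act y' → c ≠ c' := by
    rintro c c' hc hcx hcy hcy' rfl
    exact hyy (huniq hy hy' hxy hxy' hs hs' hc hcx hcy hcy')
  refine ⟨{c₁, c₂, c₃, c₄}, ?_, fun c hc => ?_⟩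
  · rw [Finset.card_insert_of_notMem, Finset.card_insert_of_notMem, Finset.card_pair hne']
    · simp [hdif hc₂ hx₂ hy₂ hy₃, hdif hc₂ hx₂ hy₂ hy₄]
    · simp [hne, hdif hc₁ hx₁ hy₁ hy₃, hdif hc₁ hx₁ hy₁ hy₄]
  · simp only [Finset.mem_insert, Finset.mem_singleton] at hc
    rcases hc with rfl | rfl | rfl | rfl
    · exact hside hy hxy hs hc₁ hx₁ hy₁
    · exact hside hy hxy hs hc₂ hx₂ hy₂
    · exact hside hy' hxy' hs' hc₃ hx₃ hy₃
    · exact hside hy' hxy' hs' hc₄ hx₄ hy₄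

/-- A mixed vertex is a turn of at least four cells. -/
theorem four_le_card_turn (hM : P.NoShortWalk u v) {x : E} (hx : P.IsMid u v x)
    (hm : P.Mixed u v x) :
    4 ≤ {c | P.IsCell u v c ∧ c ⊆ P.act x ∧ P.Turn u v c x}.ncard := by
  obtain ⟨T, hT, hT'⟩ : ∃ T : Finset (Set ι), T.card = 4 ∧ ∀ c ∈ T, P.IsCell u v c ∧
      c ⊆ P.act x ∧ P.Turn u v c x := by
    by_cases hux : P.Adj u x
    · have hvx := hM.two_step x hx hux
      obtain ⟨T, hT, hT'⟩ := h.swap.exists_four_cells hx.swap hm.2 hvx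
      refine ⟨T, hT, fun c hc => ?_⟩
      obtain ⟨hc, hcx, y, y', hy, hy', hs, hs'⟩ := hT' c hc
      exact ⟨hc.swap, hcx, y, y', ⟨hy.1.swap, hy.2⟩, ⟨hy'.1.swap, hy'.2⟩,
        (h.vType_iff_of_not_adj_v hx hy.1.swap hy.2.1 hm hvx).2 hs,
        fun ht => hs' ((h.vType_iff_of_not_adj_v hx hy'.1.swap hy'.2.1 hm hvx).1 ht)⟩
    · obtain ⟨T, hT, hT'⟩ := h.exists_four_cells hx hm.1 hux
      refine ⟨T, hT, fun c hc => ?_⟩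
      obtain ⟨hc, hcx, y, y', hy, hy', hs, hs'⟩ := hT' c hc
      refine ⟨hc, hcx, y', y, hy', hy, ?_, (h.not_vType_iff_of_not_adj_u hx hm hux).2 hs⟩
      by_contra ht
      exact hs' ((h.not_vType_iff_of_not_adj_u hx hm hux).1 ht)
  rw [← hT, ← Set.ncard_coe_finset]
  exact Set.ncard_le_ncard hT' (Set.toFinite _)

theorem not_turn_of_not_mixed {c : Set ι} {x : E} (hx : P.IsMid u v x) (hm : ¬ P.Mixed u v x) :
    ¬ P.Turn u v c x := by
  rintro ⟨y, y', hy, hy', ht, ht'⟩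
  rcases not_mixed_iff.1 hm with hu | hv
  · exact ht' (vType_of_thin_u hu)
  · exact h.not_vType_of_thin_v hx hy.1 hy.2.1 hv ht

theorem exists_two_sides {x : E} {c : Set ι} (hx : P.IsMid u v x) (hc : P.IsCell u v c)
    (hcx : c ⊆ P.act x) : ∃ y y', P.Side u v c x y ∧ P.Side u v c x y' ∧ y ≠ y' ∧
      ∀ p, P.Side u v c x p ↔ p = y ∨ p = y' := by
  obtain ⟨y, -, hy, -, hxy, -, hcy, -⟩ := h.exists_sides hx hc hcx
  obtain ⟨y', hy', hxy', hcy', hne, huniq⟩ := h.exists_other_side hx hc hcx hy hxy hcy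
  refine ⟨y, y', ⟨hy, hxy, hcy⟩, ⟨hy', hxy', hcy'⟩, hne.symm, fun p =>
    ⟨fun hp => huniq p hp.1 hp.2.1 hp.2.2, ?_⟩⟩
  rintro (rfl | rfl)
  · exact ⟨hy, hxy, hcy⟩
  · exact ⟨hy', hxy', hcy'⟩

/-- Along the boundary of a cell the edge type changes an even number of times. -/
theorem even_card_turn (hM : P.NoShortWalk u v) {c : Set ι} (hc : P.IsCell u v c) :
    Even {x | P.IsMid u v x ∧ c ⊆ P.act x ∧ P.Turn u v c x}.ncard := by
  classical
  have hfin : Finite {x // P.IsMid u v x ∧ c ⊆ P.act x} :=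
    (finite_setOf_isMid.subset fun x hx => hx.1 : {x | P.IsMid u v x ∧ c ⊆ P.act x}.Finite)
  have := Fintype.ofFinite {x // P.IsMid u v x ∧ c ⊆ P.act x}
  let G : SimpleGraph {x // P.IsMid u v x ∧ c ⊆ P.act x} :=
    { Adj := fun x y => P.Adj x.1 y.1 ∧ P.VType u v x.1 y.1
      symm := ⟨fun x y hxy => ⟨hxy.1.symm, h.vType_symm hM x.2.1 y.2.1 hxy.1 hxy.2⟩⟩
      loopless := ⟨fun x hx => hx.1.1 rfl⟩ }
  have key : ∀ x, Odd (G.degree x) ↔ P.Turn u v c x.1 := by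
    intro x
    obtain ⟨y, y', hy, hy', hne, huniq⟩ := h.exists_two_sides x.2.1 hc x.2.2
    have hadj : ∀ p, G.Adj x p ↔ (p.1 = y ∨ p.1 = y') ∧ P.VType u v x.1 p.1 := fun p => by
      rw [← huniq]
      exact ⟨fun hp => ⟨⟨p.2.1, hp.1, p.2.2⟩, hp.2⟩, fun hp => ⟨hp.1.2.1, hp.2⟩⟩
    let Y : {x // P.IsMid u v x ∧ c ⊆ P.act x} := ⟨y, hy.1, hy.2.2⟩
    let Y' : {x // P.IsMid u v x ∧ c ⊆ P.act x} := ⟨y', hy'.1, hy'.2.2⟩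
    have hY : Y ≠ Y' := fun e => hne (congrArg Subtype.val e)
    have hnb : G.neighborFinset x = ({Y, Y'} : Finset _).filter fun p => P.VType u v x.1 p.1 := by
      ext p
      rw [SimpleGraph.mem_neighborFinset, hadj, Finset.mem_filter, Finset.mem_insert,
        Finset.mem_singleton, Subtype.ext_iff, Subtype.ext_iff]
    have hturn : P.Turn u v c x.1 ↔ ¬ (P.VType u v x.1 y ↔ P.VType u v x.1 y') := by
      constructor
      · rintro ⟨p, q, hp, hq, hvp, hvq⟩ hiff
        rcases (huniq p).1 hp with rfl | rfl <;> rcases (huniq q).1 hq with rfl | rfl <;> tauto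
      · intro hiff
        by_cases h1 : P.VType u v x.1 y
        · exact ⟨y, y', hy, hy', h1, fun h2 => hiff ⟨fun _ => h2, fun _ => h1⟩⟩
        · refine ⟨y', y, hy', hy, ?_, h1⟩
          by_contra h2
          exact hiff ⟨fun h3 => absurd h3 h1, fun h3 => absurd h3 h2⟩
    rw [← SimpleGraph.card_neighborFinset_eq_degree, hnb, hturn, Finset.filter_insert,
      Finset.filter_singleton]
    change Odd (Finset.card (if P.VType u v x.1 y then _ else _)) ↔ _
    have e : P.VType u v x.1 Y'.1 = P.VType u v x.1 y' := rfl
    by_cases h1 : P.VType u v x.1 y <;> by_cases h2 : P.VType u v x.1 y' <;>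
      simp [h1, h2, e, hY, Nat.odd_iff]
  have := G.even_card_odd_degree_vertices
  convert this using 1
  rw [← Set.ncard_coe_finset, ← Set.ncard_image_of_injective _ Subtype.val_injective]
  congr 1
  ext x
  simp only [Finset.coe_filter, Finset.mem_univ, true_and, key, Set.mem_image, Set.mem_ofPred_eq]
  constructor
  · rintro ⟨h1, h2, h3⟩
    exact ⟨⟨x, h1, h2⟩, h3, rfl⟩
  · rintro ⟨⟨x, h1, h2⟩, h3, rfl⟩
    exact ⟨h1, h2, h3⟩

end Spindle

end IneqSystem

namespace IneqSystem

variable {ι E : Type*} [AddCommGroup E] [Module ℝ E] {P : IneqSystem ι E} {u v : E}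

variable (P) in
/-- A nonempty set of vertices on the single facet `i` at `u`, closed under passing to
neighbours that are not mixed. -/
structure Node (u v : E) (i : ι) (S : Set E) : Prop where
  mem_apex : i ∈ P.act u
  nonempty : S.Nonempty
  isMid : ∀ w ∈ S, P.IsMid u v w
  thin : ∀ w ∈ S, P.Thin u w
  mem_act : ∀ w ∈ S, i ∈ P.act w
  closed : ∀ w ∈ S, ∀ y, P.IsMid u v y → P.Adj w y → ¬ P.Mixed u v y → y ∈ S

variable (P) in
/-- The edges leading from `S` to mixed vertices. -/
def exits (u v : E) (S : Set E) : Set (E × E) :=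
  {p | p.1 ∈ S ∧ P.IsMid u v p.2 ∧ P.Mixed u v p.2 ∧ P.Adj p.1 p.2}

variable (P) in
/-- The cells joining two edges of `exits u v S` whose mixed ends share their facets at `u`. -/
def gaps (u v : E) (S : Set E) : Set (Set ι) :=
  {c | P.IsCell u v c ∧ ∃ p ∈ P.exits u v S, ∃ q ∈ P.exits u v S, p ≠ q ∧
    (c ⊆ P.act p.1 ∧ c ⊆ P.act p.2) ∧ (c ⊆ P.act q.1 ∧ c ⊆ P.act q.2) ∧
      P.act p.2 ∩ P.act u = P.act q.2 ∩ P.act u}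

theorem Thin.eq_of_mem {u x : E} (h : P.Thin u x) {i k : ι} (hi : i ∈ P.act u) (hix : i ∈ P.act x)
    (hk : k ∈ P.act u) (hkx : k ∈ P.act x) : k = i := h ⟨hkx, hk⟩ ⟨hix, hi⟩

namespace Spindle

variable [Finite ι] (h : P.Spindle u v)
include h

theorem sumForm_apex_pos {x : E} (hx : P.IsMid u v x) : 0 < P.sumForm (P.act u) (x - u) :=
  sumForm_sub_pos subset_rfl hx.1.1 fun hs => hx.2.1 (h.vert_u.eq_of_act_subset hs).symm

omit h in
theorem sumForm_line_pos {w z : E} (hw : P.IsMid u v w) (hwt : P.Thin u w) (hz : P.Mixed u v z) :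
    0 < P.sumForm (P.act z ∩ P.act u) (w - u) :=
  sumForm_sub_pos Set.inter_subset_right hw.1.1 fun hs =>
    hz.1 (hwt.anti fun _ hk => ⟨hs hk, hk.2⟩)

omit h in
theorem sumForm_line_self (z : E) : P.sumForm (P.act z ∩ P.act u) (z - u) = 0 :=
  sumForm_eq_zero fun _ hk => n_sub_eq_zero hk.2 hk.1

theorem exists_exit {i : ι} {S : Set E} (hS : P.Node u v i S) (g : E →ₗ[ℝ] ℝ) {d₁ d₂ : E}
    (h₁ : P.n i d₁ = 0) (h₂ : P.n i d₂ = 0)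
    (hne : g d₁ * P.sumForm (P.act u) d₂ ≠ g d₂ * P.sumForm (P.act u) d₁) :
    ∃ p ∈ P.exits u v S, g (p.1 - u) * P.sumForm (P.act u) (p.2 - u) <
      g (p.2 - u) * P.sumForm (P.act u) (p.1 - u) := by
  set β := P.sumForm (P.act u) with hβ
  obtain ⟨w, hwS, hmax⟩ := Set.exists_max_image S (fun w => g (w - u) / β (w - u))
    (finite_setOf_isMid.subset hS.isMid) hS.nonempty
  have hw := hS.isMid w hwS
  have hβw : 0 < β (w - u) := h.sumForm_apex_pos hw
  set s := g (w - u) / β (w - u) with hs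
  have hsw : g (w - u) = s * β (w - u) := by rw [hs, div_mul_cancel₀ _ hβw.ne']
  obtain ⟨d, hd, hθd⟩ : ∃ d, P.n i d = 0 ∧ (g - s • β) d ≠ 0 := by
    by_contra! hcon
    have e₁ := hcon d₁ h₁
    have e₂ := hcon d₂ h₂
    rw [LinearMap.sub_apply, LinearMap.smul_apply, smul_eq_mul, sub_eq_zero] at e₁ e₂
    exact hne (by rw [e₁, e₂]; ring)
  obtain ⟨d, hd, hθd⟩ : ∃ d, P.n i d = 0 ∧ 0 < (g - s • β) d := by
    rcases lt_or_gt_of_ne hθd with hlt | hgt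
    · exact ⟨-d, by rw [map_neg, hd, neg_zero], by rw [map_neg]; linarith⟩
    · exact ⟨d, hd, hgt⟩
  have hθw : (g - s • β) (w - u) = 0 := by
    rw [LinearMap.sub_apply, LinearMap.smul_apply, smul_eq_mul, hsw, sub_self]
  obtain ⟨y, hy, hwy, -, hpos⟩ := h.exists_neighbor hw (g - s • β)
    (by rw [← neg_sub w u, map_neg, hθw, neg_zero]) (d := d) (fun k hk hku => by
      rwa [(hS.thin w hwS).eq_of_mem hS.mem_apex (hS.mem_act w hwS) hku hk]) hθd
  rw [show y - w = (y - u) - (w - u) by abel, map_sub, hθw, sub_zero, LinearMap.sub_apply,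
    LinearMap.smul_apply, smul_eq_mul, sub_pos] at hpos
  have hβy : 0 < β (y - u) := h.sumForm_apex_pos hy
  refine ⟨(w, y), ⟨hwS, hy, ?_, hwy⟩, ?_⟩
  · by_contra hm
    have hle := hmax y (hS.closed w hwS y hy hwy hm)
    change g (y - u) / β (y - u) ≤ s at hle
    rw [div_le_iff₀ hβy] at hle
    linarith
  · change g (w - u) * β (y - u) < g (y - u) * β (w - u)
    rw [hsw]
    nlinarith

theorem exits_nonempty {i : ι} {S : Set E} (hS : P.Node u v i S) : (P.exits u v S).Nonempty := by
  have := h.finiteDimensional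
  obtain ⟨w, hw⟩ := hS.nonempty
  obtain ⟨d, hd, hind⟩ := exists_not_smul_of_two_le_finrank (h.two_le_finrank_ker_pair i i) (w - u)
  obtain ⟨g, hg, hgd⟩ := exists_dual_of_not_smul hind
  obtain ⟨p, hp, -⟩ := h.exists_exit hS g (d₁ := d) (d₂ := w - u) (hd i (Or.inl rfl))
    (n_sub_eq_zero hS.mem_apex (hS.mem_act w hw)) (by
      rw [hg, zero_mul]
      exact (mul_pos hgd (h.sumForm_apex_pos (hS.isMid w hw))).ne')
  exact ⟨p, hp⟩

/-- The exits of a node do not all share their facets at `u`. -/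
theorem exists_exit_ne {i : ι} {S : Set E} (hS : P.Node u v i S) {q : E × E}
    (hq : q ∈ P.exits u v S) :
    ∃ p ∈ P.exits u v S, P.act p.2 ∩ P.act u ≠ P.act q.2 ∩ P.act u := by
  obtain ⟨hw, hz, hm, hwz⟩ := hq
  have hwm := hS.isMid _ hw
  obtain ⟨k, hku, hkw, hkz⟩ := h.exists_edge_mem_u hwm hz hwz
  rw [(hS.thin _ hw).eq_of_mem hS.mem_apex (hS.mem_act _ hw) hku hkw] at hkz
  obtain ⟨p, hp, hlt⟩ := h.exists_exit hS (P.sumForm (P.act q.2 ∩ P.act u)) (d₁ := q.1 - u)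
    (d₂ := q.2 - u) (n_sub_eq_zero hS.mem_apex (hS.mem_act _ hw)) (n_sub_eq_zero hS.mem_apex hkz)
    (by
      rw [sumForm_line_self, zero_mul]
      exact (mul_pos (sumForm_line_pos hwm (hS.thin _ hw) hm) (h.sumForm_apex_pos hz)).ne')
  refine ⟨p, hp, fun e => ?_⟩
  have hp1 := hS.isMid _ hp.1
  have h1 := mul_pos (sumForm_line_pos hp1 (hS.thin _ hp.1) hm) (h.sumForm_apex_pos hp.2.1)
  rw [← e, sumForm_line_self, zero_mul, e] at hlt
  linarith

end Spindle

variable [Finite ι]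

variable (P) in
/-- The position of an exit, measured by the functional `α`. -/
noncomputable def exitKey (u : E) (α : E →ₗ[ℝ] ℝ) (p : E × E) : ℝ ×ₗ ℝ :=
  toLex (-α (p.2 - u) / P.sumForm (P.act u) (p.2 - u),
    (α (p.2 - u) * P.sumForm (P.act u) (p.1 - u) - P.sumForm (P.act u) (p.2 - u) * α (p.1 - u)) /
      P.sumForm (P.act p.2 ∩ P.act u) (p.1 - u))

variable (P) in
/-- A functional vanishing on both ends of an exit. -/
noncomputable def exitForm (u : E) (α : E →ₗ[ℝ] ℝ) (p : E × E) : E →ₗ[ℝ] ℝ :=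
  P.sumForm (P.act p.2 ∩ P.act u) (p.1 - u) •
      (α (p.2 - u) • P.sumForm (P.act u) - P.sumForm (P.act u) (p.2 - u) • α) -
    (α (p.2 - u) * P.sumForm (P.act u) (p.1 - u) - P.sumForm (P.act u) (p.2 - u) * α (p.1 - u)) •
      P.sumForm (P.act p.2 ∩ P.act u)

theorem exitForm_apply (α : E →ₗ[ℝ] ℝ) (p : E × E) (d : E) : P.exitForm u α p d =
    P.sumForm (P.act p.2 ∩ P.act u) (p.1 - u) *
      (α (p.2 - u) * P.sumForm (P.act u) d - P.sumForm (P.act u) (p.2 - u) * α d) -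
    (α (p.2 - u) * P.sumForm (P.act u) (p.1 - u) - P.sumForm (P.act u) (p.2 - u) * α (p.1 - u)) *
      P.sumForm (P.act p.2 ∩ P.act u) d := by
  simp [exitForm]

variable (P) in
/-- The functional `α` is in general position with respect to the vertices. -/
structure Generic (u v : E) (α : E →ₗ[ℝ] ℝ) : Prop where
  pair : ∀ z z', P.IsMid u v z → P.IsMid u v z' →
    α (z - u) * P.sumForm (P.act u) (z' - u) = α (z' - u) * P.sumForm (P.act u) (z - u) → z = z'
  triple : ∀ z w w', P.IsMid u v z → P.IsMid u v w → P.IsMid u v w' → ∀ {A B C : ℝ},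
    A = P.sumForm (P.act u) (w - u) * P.sumForm (P.act z ∩ P.act u) (w' - u) -
      P.sumForm (P.act u) (w' - u) * P.sumForm (P.act z ∩ P.act u) (w - u) →
    B = P.sumForm (P.act u) (z - u) * P.sumForm (P.act z ∩ P.act u) (w' - u) →
    C = P.sumForm (P.act u) (z - u) * P.sumForm (P.act z ∩ P.act u) (w - u) →
    A * α (z - u) - B * α (w - u) + C * α (w' - u) = 0 →
    A • (z - u) - B • (w - u) + C • (w' - u) = 0

namespace Spindle

variable (h : P.Spindle u v)
include h

theorem exists_generic : ∃ α, P.Generic u v α := by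
  have := h.finiteDimensional
  have hfin : {x | P.IsMid u v x}.Finite := finite_setOf_isMid
  let f : E × E → E := fun p =>
    P.sumForm (P.act u) (p.2 - u) • (p.1 - u) - P.sumForm (P.act u) (p.1 - u) • (p.2 - u)
  let g : E × E × E → E := fun p =>
    (P.sumForm (P.act u) (p.2.1 - u) * P.sumForm (P.act p.1 ∩ P.act u) (p.2.2 - u) -
      P.sumForm (P.act u) (p.2.2 - u) * P.sumForm (P.act p.1 ∩ P.act u) (p.2.1 - u)) • (p.1 - u) -
    (P.sumForm (P.act u) (p.1 - u) * P.sumForm (P.act p.1 ∩ P.act u) (p.2.2 - u)) • (p.2.1 - u) +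
    (P.sumForm (P.act u) (p.1 - u) * P.sumForm (P.act p.1 ∩ P.act u) (p.2.1 - u)) • (p.2.2 - u)
  obtain ⟨α, -, hα⟩ := exists_generic_dual
    (D := (f '' ({x | P.IsMid u v x} ×ˢ {x | P.IsMid u v x}) ∪
      g '' ({x | P.IsMid u v x} ×ˢ {x | P.IsMid u v x} ×ˢ {x | P.IsMid u v x})) \ {0})
    ((((hfin.prod hfin).image f).union ((hfin.prod (hfin.prod hfin)).image g)).sdiff) 0
    (fun d hd c hc => hd.2 (by rw [hc, smul_zero]; rfl))
  refine ⟨α, fun z z' hz hz' e => ?_, fun z w w' hz hw hw' A B C hA hB hC e => ?_⟩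
  · have h0 : f (z, z') = 0 := by
      by_contra hne
      refine hα _ ⟨Or.inl ⟨(z, z'), ⟨hz, hz'⟩, rfl⟩, hne⟩ ?_
      simp only [f, map_sub α (_ • _), map_smul, smul_eq_mul]
      linarith
    have hpos' := h.sumForm_apex_pos hz'
    refine h.eq_of_sub_eq_smul hz hz'
      (c := (P.sumForm (P.act u) (z' - u))⁻¹ * P.sumForm (P.act u) (z - u)) ?_
    rw [mul_smul, eq_inv_smul_iff₀ hpos'.ne']
    exact sub_eq_zero.1 h0
  · subst hA hB hC
    by_contra hne
    refine hα (g (z, w, w')) ⟨Or.inr ⟨(z, w, w'), ⟨hz, hw, hw'⟩, rfl⟩, hne⟩ ?_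
    simp only [g, map_sub α (_ • _), map_add α, map_smul, smul_eq_mul]
    exact e

section

variable {α : E →ₗ[ℝ] ℝ} (hα : P.Generic u v α) {i : ι} {S : Set E} (hS : P.Node u v i S)
include hα hS

theorem exitKey_ne {p q : E × E} (hp : p ∈ P.exits u v S) (hq : q ∈ P.exits u v S) (hpq : p ≠ q)
    {c : Set ι} (hc : P.IsCell u v c) (hp₁ : c ⊆ P.act p.1) (hp₂ : c ⊆ P.act p.2)
    (hq₁ : c ⊆ P.act q.1) : P.exitKey u α p ≠ P.exitKey u α q := by
  obtain ⟨w, z⟩ := p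
  obtain ⟨w', z'⟩ := q
  obtain ⟨hw, hz, hm, hwz⟩ := hp
  obtain ⟨hw', hz', hm', hwz'⟩ := hq
  simp only at hw hz hm hwz hw' hz' hm' hwz' hp₁ hp₂ hq₁
  intro e
  have e := toLex_inj.1 e
  simp only [Prod.mk.injEq] at e
  have hβ := h.sumForm_apex_pos hz
  have hβ' := h.sumForm_apex_pos hz'
  obtain ⟨e1, e2⟩ := e
  rw [div_eq_div_iff hβ.ne' hβ'.ne'] at e1
  obtain rfl := hα.pair z z' hz hz' (by linarith)
  have hwm := hS.isMid w hw
  have hwm' := hS.isMid w' hw'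
  have hℓ := sumForm_line_pos hwm (hS.thin w hw) hm
  have hℓ' := sumForm_line_pos hwm' (hS.thin w' hw') hm
  rw [div_eq_div_iff hℓ.ne' hℓ'.ne'] at e2
  obtain ⟨A, hA⟩ : ∃ A, A = P.sumForm (P.act u) (w - u) * P.sumForm (P.act z ∩ P.act u) (w' - u) -
      P.sumForm (P.act u) (w' - u) * P.sumForm (P.act z ∩ P.act u) (w - u) := ⟨_, rfl⟩
  obtain ⟨B, hB⟩ : ∃ B, B = P.sumForm (P.act u) (z - u) * P.sumForm (P.act z ∩ P.act u) (w' - u) :=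
    ⟨_, rfl⟩
  obtain ⟨C, hC⟩ : ∃ C, C = P.sumForm (P.act u) (z - u) * P.sumForm (P.act z ∩ P.act u) (w - u) :=
    ⟨_, rfl⟩
  have hCpos : 0 < C := by rw [hC]; exact mul_pos hβ hℓ
  have h0 := hα.triple z w w' hz hwm hwm' hA hB hC (by rw [hA, hB, hC]; linarith)
  obtain ⟨k, -, hj, rfl⟩ := hc.exists_pair
  have hzj : k.2 ∈ P.act z := hp₂ (Or.inr rfl)
  have hJ := h.pos_u_sub hj hzj
  have hn : ∀ {x}, k.2 ∈ P.act x → P.n k.2 (x - u) = -P.n k.2 (u - z) := fun hx => by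
    have := n_sub_eq_zero hzj hx
    rw [map_sub] at this ⊢
    rw [map_sub]
    linarith
  have h1 := congrArg (P.n k.2) h0
  rw [map_add, map_sub, map_smul, map_smul, map_smul, hn hzj, hn (hp₁ (Or.inr rfl)),
    hn (hq₁ (Or.inr rfl)), map_zero, smul_eq_mul, smul_eq_mul, smul_eq_mul] at h1
  have h2 : A - B + C = 0 := by
    have : (A - B + C) * P.n k.2 (u - z) = 0 := by linarith
    exact (mul_eq_zero.1 this).resolve_right hJ.ne'
  have h3 : w' - z = (C⁻¹ * B) • (w - z) := by
    rw [mul_smul, eq_inv_smul_iff₀ hCpos.ne', ← sub_eq_zero, ← h0]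
    obtain rfl : A = B - C := by linarith
    module
  rcases hz.1.eq_or_eq_of_collinear hwm.1 hwm'.1 h3 with h4 | h4
  · exact hwz'.1 h4
  · exact hpq (by rw [h4])

theorem exitForm_pos_of_lt {p q : E × E} (hp : p ∈ P.exits u v S) (hq : q ∈ P.exits u v S)
    (hline : P.act p.2 ∩ P.act u = P.act q.2 ∩ P.act u) (hlt : P.exitKey u α p < P.exitKey u α q) :
    0 < P.exitForm u α p (q.1 - u) ∨ 0 < P.exitForm u α p (q.2 - u) := by
  obtain ⟨w, z⟩ := p
  obtain ⟨w', z'⟩ := q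
  obtain ⟨hw, hz, hm, hwz⟩ := hp
  obtain ⟨hw', hz', hm', hwz'⟩ := hq
  simp only at hw hz hm hwz hw' hz' hm' hwz' hline
  have hβ := h.sumForm_apex_pos hz
  have hβ' := h.sumForm_apex_pos hz'
  have hℓ := sumForm_line_pos (hS.isMid w hw) (hS.thin w hw) hm
  have hℓ' := sumForm_line_pos (hS.isMid w' hw') (hS.thin w' hw') hm
  rw [exitKey, exitKey, Prod.Lex.toLex_lt_toLex] at hlt
  simp only at hlt
  rcases hlt with hlt | ⟨heq, hlt⟩
  · right
    rw [div_lt_div_iff₀ hβ hβ'] at hlt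
    rw [exitForm_apply]
    simp only
    have h0 := sumForm_line_self (P := P) (u := u) z'
    rw [← hline] at h0
    rw [h0, mul_zero, sub_zero]
    exact mul_pos hℓ (by linarith)
  · left
    rw [div_eq_div_iff hβ.ne' hβ'.ne'] at heq
    obtain rfl := hα.pair z z' hz hz' (by linarith)
    rw [div_lt_div_iff₀ hℓ hℓ'] at hlt
    rw [exitForm_apply]
    simp only
    linarith

omit hα in
theorem cell_eq_of_exitForm_pos {p : E × E} (hp : p ∈ P.exits u v S) {c c' : Set ι}
    (hc : P.IsCell u v c) (hc' : P.IsCell u v c') (hp₁ : c ⊆ P.act p.1) (hp₂ : c ⊆ P.act p.2)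
    (hp₁' : c' ⊆ P.act p.1) (hp₂' : c' ⊆ P.act p.2) {x x' : E} (hx : P.IsMid u v x)
    (hx' : P.IsMid u v x') (hcx : c ⊆ P.act x) (hcx' : c' ⊆ P.act x')
    (hpos : 0 < P.exitForm u α p (x - u)) (hpos' : 0 < P.exitForm u α p (x' - u)) : c = c' := by
  obtain ⟨w, z⟩ := p
  obtain ⟨hw, hz, hm, hwz⟩ := hp
  simp only at hw hz hm hwz hp₁ hp₂ hp₁' hp₂'
  have hwm := hS.isMid w hw
  set ν := P.exitForm u α (w, z) with hν
  have hνz : ν (z - u) = 0 := by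
    rw [hν, exitForm_apply]
    simp only
    rw [sumForm_line_self]; ring
  have hνw : ν (w - u) = 0 := by
    rw [hν, exitForm_apply]
    simp only
    ring
  have hsub : ∀ y, ν (y - z) = ν (y - u) := fun y => by
    rw [show y - z = (y - u) - (z - u) by abel, map_sub, hνz, sub_zero]
  have hnex : ∀ {y}, 0 < ν (y - u) → y ≠ z ∧ y ≠ w := fun hy =>
    ⟨by rintro rfl; rw [hνz] at hy; exact lt_irrefl _ hy,
      by rintro rfl; rw [hνw] at hy; exact lt_irrefl _ hy⟩
  by_contra hne
  obtain ⟨a, b, s, t, hs, ht, hab⟩ := h.edge_decomposition hz hwm hwz.symm hc hc' hne hp₂ hp₁ hp₂'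
    hp₁' hx hx' hcx hcx' (hnex hpos).1 (hnex hpos).2 (hnex hpos').1 (hnex hpos').2 h.vert_u.1
  have h1 := congrArg ν hab
  rw [map_add, map_add, map_add, map_smul, map_smul, map_smul, map_smul, hsub, hsub, hsub, hsub,
    sub_self, map_zero, hνw, smul_zero, add_zero, smul_eq_mul, smul_eq_mul, smul_eq_mul] at h1
  have hi : ∀ {c : Set ι} {y}, P.IsCell u v c → c ⊆ P.act w → c ⊆ P.act y → i ∈ P.act y := by
    intro c y hc hcw hcy
    obtain ⟨k, hk, -, rfl⟩ := hc.exists_pair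
    rw [← (hS.thin w hw).eq_of_mem hS.mem_apex (hS.mem_act w hw) hk (hcw (Or.inl rfl))]
    exact hcy (Or.inl rfl)
  have hiz : i ∈ P.act z := hi hc hp₁ hp₂
  have h2 := congrArg (P.n i) hab
  rw [map_add, map_add, map_add, map_smul, map_smul, map_smul, map_smul,
    n_sub_eq_zero hiz hS.mem_apex, n_sub_eq_zero hiz (hi hc hp₁ hp₁),
    n_sub_eq_zero hiz (hi hc hp₁ hcx), n_sub_eq_zero hiz (hi hc' hp₁' hcx'), smul_zero, smul_zero,
    smul_zero, add_zero, add_zero, add_zero, smul_eq_mul, zero_eq_mul] at h2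
  have ha := h2.resolve_right (h.pos_of_mem_u hS.mem_apex).ne'
  have hνq : s * ν (x - u) + t * ν (x' - u) = 0 := by rw [ha] at h1; linarith
  have e1 := mul_nonneg hs hpos.le
  have e2 := mul_nonneg ht hpos'.le
  have hs0 : s = 0 := (mul_eq_zero.1 (by linarith : s * ν (x - u) = 0)).resolve_right hpos.ne'
  have ht0 : t = 0 := (mul_eq_zero.1 (by linarith : t * ν (x' - u) = 0)).resolve_right hpos'.ne'
  rw [ha, hs0, ht0, zero_smul, zero_smul, zero_smul, zero_add, add_zero, add_zero] at hab
  rcases hz.1.eq_or_eq_of_collinear hwm.1 h.vert_u hab with h3 | h3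
  · exact hz.2.1 h3.symm
  · exact hwm.2.1 h3.symm

end

omit h in
theorem finite_exits {S : Set E} (hS : ∀ w ∈ S, P.IsMid u v w) : (P.exits u v S).Finite :=
  (finite_setOf_isMid.prod finite_setOf_isMid).subset fun _ hp => ⟨hS _ hp.1, hp.2.1⟩

theorem card_gaps_add_two_le {i : ι} {S : Set E} (hS : P.Node u v i S) :
    (P.gaps u v S).ncard + 2 ≤ (P.exits u v S).ncard := by
  classical
  obtain ⟨α, hα⟩ := h.exists_generic
  have hfin := finite_exits hS.isMid
  have hlow : ∀ c ∈ P.gaps u v S, ∃ p ∈ P.exits u v S, c ⊆ P.act p.1 ∧ c ⊆ P.act p.2 ∧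
      (∃ q ∈ P.exits u v S, P.act p.2 ∩ P.act u = P.act q.2 ∩ P.act u ∧
        P.exitKey u α p < P.exitKey u α q) ∧
      ∃ x, P.IsMid u v x ∧ c ⊆ P.act x ∧ 0 < P.exitForm u α p (x - u) := by
    have main : ∀ {c : Set ι} {p q : E × E}, p ∈ P.exits u v S → q ∈ P.exits u v S →
        c ⊆ P.act q.1 → c ⊆ P.act q.2 → P.act p.2 ∩ P.act u = P.act q.2 ∩ P.act u →
        P.exitKey u α p < P.exitKey u α q →
        ∃ x, P.IsMid u v x ∧ c ⊆ P.act x ∧ 0 < P.exitForm u α p (x - u) := by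
      intro c p q hp hq hq₁ hq₂ hline hlt
      rcases h.exitForm_pos_of_lt hα hS hp hq hline hlt with h1 | h1
      · exact ⟨q.1, hS.isMid _ hq.1, hq₁, h1⟩
      · exact ⟨q.2, hq.2.1, hq₂, h1⟩
    rintro c ⟨hc, p, hp, q, hq, hpq, ⟨hp₁, hp₂⟩, ⟨hq₁, hq₂⟩, hline⟩
    rcases lt_or_gt_of_ne (h.exitKey_ne hα hS hp hq hpq hc hp₁ hp₂ hq₁) with hlt | hlt
    · exact ⟨p, hp, hp₁, hp₂, ⟨q, hq, hline, hlt⟩, main hp hq hq₁ hq₂ hline hlt⟩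
    · exact ⟨q, hq, hq₁, hq₂, ⟨p, hp, hline.symm, hlt⟩, main hq hp hp₁ hp₂ hline.symm hlt⟩
  choose! pick hpick hpick₁ hpick₂ hpickq hpickx using hlow
  have hmax : ∀ q ∈ P.exits u v S, ∃ p ∈ P.exits u v S,
      P.act p.2 ∩ P.act u = P.act q.2 ∩ P.act u ∧ ∀ c ∈ P.gaps u v S, pick c ≠ p := by
    intro q hq
    obtain ⟨p, ⟨hp, hpq⟩, hle⟩ := Set.exists_max_image
      {p | p ∈ P.exits u v S ∧ P.act p.2 ∩ P.act u = P.act q.2 ∩ P.act u} (P.exitKey u α)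
      (hfin.subset fun p hp => hp.1) ⟨q, hq, rfl⟩
    refine ⟨p, hp, hpq, fun c hc e => ?_⟩
    obtain ⟨r, hr, hline, hlt⟩ := hpickq c hc
    rw [e] at hline hlt
    exact absurd (hle r ⟨hr, hline.symm.trans hpq⟩) (not_le.2 hlt)
  obtain ⟨q₀, hq₀⟩ := h.exits_nonempty hS
  obtain ⟨p₁, hp₁, hl₁, hn₁⟩ := hmax q₀ hq₀
  obtain ⟨q₁, hq₁, hl⟩ := h.exists_exit_ne hS hp₁
  obtain ⟨p₂, hp₂, hl₂, hn₂⟩ := hmax q₁ hq₁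
  have hp₁₂ : p₁ ≠ p₂ := by rintro rfl; exact hl hl₂.symm
  have hinj : Set.InjOn pick (P.gaps u v S) := by
    intro c hc c' hc' e
    obtain ⟨x, hx, hcx, hpos⟩ := hpickx c hc
    obtain ⟨x', hx', hcx', hpos'⟩ := hpickx c' hc'
    have h1 := hpick₁ c' hc'
    have h2 := hpick₂ c' hc'
    rw [← e] at h1 h2 hpos'
    exact h.cell_eq_of_exitForm_pos hS (hpick c hc) hc.1 hc'.1 (hpick₁ c hc) (hpick₂ c hc) h1 h2
      hx hx' hcx hcx' hpos hpos'
  have hdisj : Disjoint (pick '' P.gaps u v S) {p₁, p₂} := by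
    rw [Set.disjoint_left]
    rintro _ ⟨c, hc, rfl⟩ (e | e)
    · exact hn₁ c hc e
    · exact hn₂ c hc e
  rw [← hinj.ncard_image, ← Set.ncard_pair hp₁₂,
    ← Set.ncard_union_eq hdisj ((Set.toFinite _).image _) (Set.toFinite _)]
  refine Set.ncard_le_ncard ?_ hfin
  rintro _ (⟨c, hc, rfl⟩ | rfl | rfl)
  exacts [hpick c hc, hp₁, hp₂]

end Spindle

end IneqSystem

namespace IneqSystem

variable {ι E : Type*} [AddCommGroup E] [Module ℝ E] {P : IneqSystem ι E} {u v : E}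

variable (P) in
/-- The vertex `x` is a vertex other than the apices that is not mixed. -/
def Pure (u v x : E) : Prop := P.IsMid u v x ∧ ¬ P.Mixed u v x

variable (P) in
/-- The vertices that can be reached from `x` along edges between vertices that are not mixed. -/
def comp (u v x : E) : Set E :=
  {y | Relation.ReflTransGen (fun a b => P.Pure u v a ∧ P.Pure u v b ∧ P.Adj a b) x y}

theorem Pure.swap {x : E} (h : P.Pure u v x) : P.Pure v u x :=
  ⟨h.1.swap, fun hm => h.2 hm.swap⟩

theorem comp_swap (x : E) : P.comp v u x = P.comp u v x := by
  have : (fun a b => P.Pure v u a ∧ P.Pure v u b ∧ P.Adj a b) =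
      fun a b => P.Pure u v a ∧ P.Pure u v b ∧ P.Adj a b := by
    ext a b
    exact ⟨fun h => ⟨h.1.swap, h.2.1.swap, h.2.2⟩, fun h => ⟨h.1.swap, h.2.1.swap, h.2.2⟩⟩
  rw [comp, comp, this]

theorem mem_comp_self (x : E) : x ∈ P.comp u v x := Relation.ReflTransGen.refl

theorem comp_eq_of_mem {x y : E} (h : y ∈ P.comp u v x) : P.comp u v y = P.comp u v x := by
  have hsymm : y ∈ P.comp u v x → x ∈ P.comp u v y := fun h => by
    have : Std.Symm fun a b => P.Pure u v a ∧ P.Pure u v b ∧ P.Adj a b :=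
      ⟨fun a b hab => ⟨hab.2.1, hab.1, hab.2.2.symm⟩⟩
    exact Relation.ReflTransGen.stdSymm.symm _ _ h
  ext z
  exact ⟨fun hz => Relation.ReflTransGen.trans h hz,
    fun hz => Relation.ReflTransGen.trans (hsymm h) hz⟩

theorem comp_eq_of_adj {x y : E} (hx : P.Pure u v x) (hy : P.Pure u v y) (h : P.Adj x y) :
    P.comp u v x = P.comp u v y :=
  (comp_eq_of_mem (Relation.ReflTransGen.single ⟨hx, hy, h⟩)).symm

theorem Pure.of_mem_comp {x y : E} (hx : P.Pure u v x) (h : y ∈ P.comp u v x) : P.Pure u v y := by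
  induction h with
  | refl => exact hx
  | tail _ h _ => exact h.2.1

theorem exits_swap (S : Set E) : P.exits v u S = P.exits u v S := by
  ext p
  exact ⟨fun h => ⟨h.1, h.2.1.swap, h.2.2.1.swap, h.2.2.2⟩,
    fun h => ⟨h.1, h.2.1.swap, h.2.2.1.swap, h.2.2.2⟩⟩

namespace Spindle

variable [Finite ι] (h : P.Spindle u v)
include h

theorem node_comp {x : E} (hx : P.Pure u v x) (hux : P.Thin u x) {i : ι} (hi : i ∈ P.act u)
    (hix : i ∈ P.act x) : P.Node u v i (P.comp u v x) := by
  have key : ∀ y ∈ P.comp u v x, P.Thin u y ∧ i ∈ P.act y := by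
    intro y hy
    induction hy with
    | refl => exact ⟨hux, hix⟩
    | tail _ hab ih =>
      have ht := (not_mixed_iff.1 hab.2.1.2).resolve_right
        (h.not_adj_of_thin_of_thin hab.1.1 hab.2.1.1 hab.2.2 ih.1)
      exact ⟨ht, (h.thin_inter_eq hab.1.1 hab.2.1.1 hab.2.2 ih.1 ht hi).1 ih.2⟩
  refine ⟨hi, ⟨x, mem_comp_self x⟩, fun y hy => (hx.of_mem_comp hy).1, fun y hy => (key y hy).1,
    fun y hy => (key y hy).2, fun w hw y hy hwy hm => ?_⟩
  exact Relation.ReflTransGen.tail hw ⟨hx.of_mem_comp hw, ⟨hy, hm⟩, hwy⟩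

theorem mem_gaps_of_exits {c : Set ι} (hc : P.IsCell u v c) {z₁ z₂ w₁ w₂ : E}
    (hz₁ : P.IsMid u v z₁) (hz₂ : P.IsMid u v z₂) (hm₁ : P.Mixed u v z₁) (hm₂ : P.Mixed u v z₂)
    (hcz₁ : c ⊆ P.act z₁) (hcz₂ : c ⊆ P.act z₂)
    (hw₁ : P.Pure u v w₁) (hw₂ : P.Pure u v w₂) (hcw₁ : c ⊆ P.act w₁) (hcw₂ : c ⊆ P.act w₂)
    (hadj₁ : P.Adj w₁ z₁) (hadj₂ : P.Adj w₂ z₂) (hz : z₁ = z₂ ∨ P.Adj z₁ z₂)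
    (hne : (w₁, z₁) ≠ (w₂, z₂)) (hline : P.act z₁ ∩ P.act u = P.act z₂ ∩ P.act u)
    (hother : ∀ p, P.IsMid u v p → c ⊆ P.act p → P.Mixed u v p → p = z₁ ∨ p = z₂) :
    c ∈ P.gaps u v (P.comp u v w₁) := by
  have hℓ : ∀ {w}, P.Pure u v w →
      P.sumForm (P.act z₁ ∩ P.act z₂) z₁ < P.sumForm (P.act z₁ ∩ P.act z₂) w := by
    intro w hw
    have h1 : w ≠ z₁ := by rintro rfl; exact hw.2 hm₁
    have h2 : w ≠ z₂ := by rintro rfl; exact hw.2 hm₂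
    have := sumForm_sub_pos (Z := P.act z₁ ∩ P.act z₂) Set.inter_subset_left hw.1.1.1 fun hs => by
      rcases hz with rfl | hz
      · rw [Set.inter_self] at hs
        exact h1 (hz₁.1.eq_of_act_subset hs).symm
      · obtain ⟨e, he⟩ := hz.2 (w - z₁) fun k hk hk' => n_sub_eq_zero hk (hs ⟨hk, hk'⟩)
        rcases hz₁.1.eq_or_eq_of_collinear hz₂.1 hw.1.1 he with h3 | h3
        · exact h1 h3
        · exact h2 h3
    rwa [map_sub, sub_pos] at this
  have hcomp : P.comp u v w₁ = P.comp u v w₂ := by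
    refine h.eq_of_adj_eq_in_cell hc (P.sumForm (P.act z₁ ∩ P.act z₂)) _ (P.comp u v)
      (fun x y hx hy hcx hcy hxy htx hty => ?_) hw₁.1 hw₂.1 hcw₁ hcw₂ (hℓ hw₁) (hℓ hw₂)
    have hpure : ∀ {p}, P.IsMid u v p → c ⊆ P.act p → P.sumForm (P.act z₁ ∩ P.act z₂) z₁ <
        P.sumForm (P.act z₁ ∩ P.act z₂) p → P.Pure u v p := by
      refine fun hp hcp htp => ⟨hp, fun hm => ?_⟩
      rcases hother _ hp hcp hm with rfl | rfl
      · exact lt_irrefl _ htp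
      · refine htp.ne' ?_
        rw [← sub_eq_zero, ← map_sub]
        exact sumForm_eq_zero fun k hk => n_sub_eq_zero hk.1 hk.2
    exact comp_eq_of_adj (hpure hx hcx htx) (hpure hy hcy hty) hxy
  exact ⟨hc, (w₁, z₁), ⟨mem_comp_self _, hz₁, hm₁, hadj₁⟩, (w₂, z₂),
    ⟨hcomp ▸ mem_comp_self _, hz₂, hm₂, hadj₂⟩, hne, ⟨hcw₁, hcz₁⟩, ⟨hcw₂, hcz₂⟩, hline⟩

variable (hM : P.NoShortWalk u v)
include hM

theorem thin_u_of_vType {z y : E} (hz : P.IsMid u v z) (hy : P.Pure u v y) (hzy : P.Adj z y)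
    (ht : P.VType u v z y) : P.Thin u y :=
  (not_mixed_iff.1 hy.2).resolve_right fun hv =>
    h.not_vType_of_thin_v hy.1 hz hzy.symm hv (h.vType_symm hM hz hy.1 hzy ht)

omit [Finite ι] in
theorem thin_v_of_not_vType {z y : E} (hz : P.IsMid u v z) (hy : P.Pure u v y) (hzy : P.Adj z y)
    (ht : ¬ P.VType u v z y) : P.Thin v y :=
  (not_mixed_iff.1 hy.2).resolve_left fun hu =>
    ht (h.vType_symm hM hy.1 hz hzy.symm (vType_of_thin_u hu))

/-- A cell with a single mixed vertex is a gap. -/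
theorem exists_gap_of_unique_mixed {c : Set ι} (hc : P.IsCell u v c) {z : E} (hz : P.IsMid u v z)
    (hm : P.Mixed u v z) (hcz : c ⊆ P.act z)
    (hother : ∀ p, P.IsMid u v p → c ⊆ P.act p → P.Mixed u v p → p = z) :
    ∃ x, P.Pure u v x ∧ (P.Thin u x ∧ c ∈ P.gaps u v (P.comp u v x) ∨
      P.Thin v x ∧ c ∈ P.gaps v u (P.comp u v x)) := by
  obtain ⟨y, y', hy, hy', hne, -⟩ := h.exists_two_sides hz hc hcz
  have hpure : ∀ {p}, P.Side u v c z p → P.Pure u v p := fun hp =>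
    ⟨hp.1, fun hmp => hp.2.1.1 (hother _ hp.1 hp.2.2 hmp).symm⟩
  have hpair : (y, z) ≠ (y', z) := fun e => hne (Prod.ext_iff.1 e).1
  refine ⟨y, hpure hy, ?_⟩
  by_cases hv : P.VType u v z y
  · exact Or.inl ⟨h.thin_u_of_vType hM hz (hpure hy) hy.2.1 hv,
      h.mem_gaps_of_exits hc hz hz hm hm hcz hcz (hpure hy) (hpure hy') hy.2.2 hy'.2.2
        hy.2.1.symm hy'.2.1.symm (Or.inl rfl) hpair rfl
        fun p hp hcp hmp => Or.inl (hother p hp hcp hmp)⟩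
  · refine Or.inr ⟨h.thin_v_of_not_vType hM hz (hpure hy) hy.2.1 hv, ?_⟩
    rw [← comp_swap]
    exact h.swap.mem_gaps_of_exits hc.swap hz.swap hz.swap hm.swap hm.swap hcz hcz (hpure hy).swap
      (hpure hy').swap hy.2.2 hy'.2.2 hy.2.1.symm hy'.2.1.symm (Or.inl rfl) hpair rfl
      fun p hp hcp hmp => Or.inl (hother p hp.swap hcp hmp.swap)

/-- A cell with two mixed vertices that turns at both of them is a gap. -/
theorem exists_gap_of_turn {c : Set ι} (hc : P.IsCell u v c) {z₁ z₂ : E} (hz : z₁ ≠ z₂)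
    (hz₁ : P.IsMid u v z₁) (hz₂ : P.IsMid u v z₂) (hm₁ : P.Mixed u v z₁) (hm₂ : P.Mixed u v z₂)
    (hcz₁ : c ⊆ P.act z₁) (hcz₂ : c ⊆ P.act z₂) (ht₁ : P.Turn u v c z₁) (ht₂ : P.Turn u v c z₂)
    (hother : ∀ p, P.IsMid u v p → c ⊆ P.act p → P.Mixed u v p → p = z₁ ∨ p = z₂) :
    ∃ x, P.Pure u v x ∧ (P.Thin u x ∧ c ∈ P.gaps u v (P.comp u v x) ∨
      P.Thin v x ∧ c ∈ P.gaps v u (P.comp u v x)) := by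
  obtain ⟨y, y', hy, hy', hv, hv'⟩ := ht₁
  obtain ⟨p, p', hp, hp', hvp, hvp'⟩ := ht₂
  have hpure₁ : ∀ {q}, P.Side u v c z₁ q → q ≠ z₂ → P.Pure u v q := fun hq hne =>
    ⟨hq.1, fun hmq => (hother _ hq.1 hq.2.2 hmq).elim (fun e => hq.2.1.1 e.symm) hne⟩
  have hpure₂ : ∀ {q}, P.Side u v c z₂ q → q ≠ z₁ → P.Pure u v q := fun hq hne =>
    ⟨hq.1, fun hmq => (hother _ hq.1 hq.2.2 hmq).elim hne (fun e => hq.2.1.1 e.symm)⟩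
  have hpair : ∀ {w w' : E}, (w, z₁) ≠ (w', z₂) := fun e => hz (Prod.ext_iff.1 e).2
  by_cases hyz : y = z₂
  · subst hyz
    have hvs := h.vType_symm hM hz₁ hz₂ hy.2.1 hv
    have hw := hpure₁ hy' (by rintro rfl; exact hv' hv)
    have hw' := hpure₂ hp' (by rintro rfl; exact hvp' hvs)
    have hwt := h.thin_v_of_not_vType hM hz₁ hw hy'.2.1 hv'
    have hwt' := h.thin_v_of_not_vType hM hz₂ hw' hp'.2.1 hvp'
    have hn₁ := h.not_adj_v_of_exit hM hw.1 hz₁ hy'.2.1.symm hwt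
    have hn₂ := h.not_adj_v_of_exit hM hw'.1 hz₂ hp'.2.1.symm hwt'
    have hs₁ := (h.vType_iff_of_not_adj_v hz₁ hz₂ hy.2.1 hm₁ hn₁).1 hv
    have hs₂ := (h.vType_iff_of_not_adj_v hz₂ hz₁ hy.2.1.symm hm₂ hn₂).1 hvs
    refine ⟨y', hw, Or.inr ⟨hwt, ?_⟩⟩
    rw [← comp_swap]
    exact h.swap.mem_gaps_of_exits hc.swap hz₁.swap hz₂.swap hm₁.swap hm₂.swap hcz₁ hcz₂ hw.swap
      hw'.swap hy'.2.2 hp'.2.2 hy'.2.1.symm hp'.2.1.symm (Or.inr hy.2.1) hpair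
      (Set.Subset.antisymm (fun k hk => ⟨hs₁ hk, hk.2⟩) fun k hk => ⟨hs₂ hk, hk.2⟩)
      fun p hp hcp hmp => hother p hp.swap hcp hmp.swap
  · have hw := hpure₁ hy hyz
    have hwt := h.thin_u_of_vType hM hz₁ hw hy.2.1 hv
    have hyz' : y' = z₂ := by
      by_contra hne
      have hw' := hpure₁ hy' hne
      exact h.not_adj_thin_thin hM hw'.1 hz₁ hw.1 hm₁
        (h.thin_v_of_not_vType hM hz₁ hw' hy'.2.1 hv') hwt hy'.2.1.symm hy.2.1
    subst hyz'
    have hvs : ¬ P.VType u v y' z₁ := fun ht => hv' (h.vType_symm hM hz₂ hz₁ hy'.2.1.symm ht)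
    have hw' := hpure₂ hp (by rintro rfl; exact hvs hvp)
    have hwt' := h.thin_u_of_vType hM hz₂ hw' hp.2.1 hvp
    have hn₁ := h.not_adj_u_of_exit hM hw.1 hz₁ hy.2.1.symm hwt
    have hn₂ := h.not_adj_u_of_exit hM hw'.1 hz₂ hp.2.1.symm hwt'
    have hs₁ := (h.not_vType_iff_of_not_adj_u hz₁ hm₁ hn₁).1 hv'
    have hs₂ := (h.not_vType_iff_of_not_adj_u hz₂ hm₂ hn₂).1 hvs
    exact ⟨y, hw, Or.inl ⟨hwt, h.mem_gaps_of_exits hc hz₁ hz₂ hm₁ hm₂ hcz₁ hcz₂ hw hw' hy.2.2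
      hp.2.2 hy.2.1.symm hp.2.1.symm (Or.inr hy'.2.1) hpair
      (Set.Subset.antisymm (fun k hk => ⟨hs₁ hk, hk.2⟩) fun k hk => ⟨hs₂ hk, hk.2⟩) hother⟩⟩

end Spindle

end IneqSystem

theorem LinearMap.exists_dual_ker_le_range {V W : Type*} [AddCommGroup V] [Module ℝ V]
    [AddCommGroup W] [Module ℝ W] [FiniteDimensional ℝ V] [FiniteDimensional ℝ W] (f : V →ₗ[ℝ] W)
    (hle : Module.finrank ℝ W ≤ Module.finrank ℝ V) (e : V) (he : ∀ x, f x = 0 → ∃ c : ℝ, c • e = x) :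
    ∃ l : W →ₗ[ℝ] ℝ, ∀ y, l y = 0 → ∃ x, f x = y := by
  have h1 : Module.finrank ℝ f.ker ≤ 1 := by
    have hsub : f.ker ≤ Submodule.span ℝ {e} := fun x hx =>
      Submodule.mem_span_singleton.2 (he x hx)
    refine (Submodule.finrank_mono hsub).trans ?_
    have := finrank_span_le_card (R := ℝ) ({e} : Set V)
    simpa using this
  have h2 := f.finrank_range_add_finrank_ker
  have h3 := f.range.finrank_quotient_add_finrank
  obtain ⟨l, hl⟩ : ∃ l : (W ⧸ f.range) →ₗ[ℝ] ℝ, Function.Injective l := by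
    rcases Nat.lt_or_ge 0 (Module.finrank ℝ (W ⧸ f.range)) with h4 | h4
    · have h5 : Module.finrank ℝ (W ⧸ f.range) = Module.finrank ℝ ℝ := by
        rw [Module.finrank_self]; omega
      exact ⟨LinearEquiv.ofFinrankEq _ _ h5, LinearEquiv.injective _⟩
    · have := Module.finrank_zero_iff.1 (Nat.le_zero.1 h4)
      exact ⟨0, Function.injective_of_subsingleton _⟩
  refine ⟨l.comp f.range.mkQ, fun y hy => ?_⟩
  rw [LinearMap.comp_apply, map_eq_zero_iff l hl, Submodule.mkQ_apply,
    Submodule.Quotient.mk_eq_zero] at hy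
  exact hy

theorem LinearMap.finrank_add_one_le_of_ker_le_range {U V W : Type*} [AddCommGroup U] [Module ℝ U]
    [AddCommGroup V] [Module ℝ V] [AddCommGroup W] [Module ℝ W] [FiniteDimensional ℝ U]
    [FiniteDimensional ℝ V] [FiniteDimensional ℝ W] (f : U →ₗ[ℝ] V) (g : V →ₗ[ℝ] W)
    (hfg : ∀ y, g y = 0 → ∃ x, f x = y) {e : U} (he : e ≠ 0) (hfe : f e = 0) :
    Module.finrank ℝ V + 1 ≤ Module.finrank ℝ W + Module.finrank ℝ U := by
  have h1 := f.finrank_range_add_finrank_ker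
  have h2 := g.finrank_range_add_finrank_ker
  have h3 : Module.finrank ℝ g.ker ≤ Module.finrank ℝ f.range :=
    Submodule.finrank_mono fun y hy => hfg y hy
  have h4 : 0 < Module.finrank ℝ f.ker := by
    have : Nontrivial f.ker := ⟨⟨⟨e, hfe⟩, 0, fun h => he (Subtype.ext_iff.1 h)⟩⟩
    exact Module.finrank_pos
  have h5 := g.range.finrank_le
  omega

namespace IneqSystem

variable {ι E : Type*} [AddCommGroup E] [Module ℝ E] {P : IneqSystem ι E} {u v : E}

variable (P) in
/-- The edges between non-apex vertices, oriented by `φ`. -/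
def sides (u v : E) (φ : E →ₗ[ℝ] ℝ) : Set (E × E) :=
  {p | P.IsMid u v p.1 ∧ P.IsMid u v p.2 ∧ P.Adj p.1 p.2 ∧ φ p.1 < φ p.2}

variable (P) in
/-- The edges with a mixed end, oriented by `φ`. -/
def mixedSides (u v : E) (φ : E →ₗ[ℝ] ℝ) : Set (E × E) :=
  {p | p ∈ P.sides u v φ ∧ (P.Mixed u v p.1 ∨ P.Mixed u v p.2)}

variable (P) in
/-- The cells with a mixed vertex. -/
def mixedCells (u v : E) : Set (Set ι) :=
  {c | P.IsCell u v c ∧ ∃ x, P.IsMid u v x ∧ P.Mixed u v x ∧ c ⊆ P.act x}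

variable [Finite ι]

theorem finite_sides {φ : E →ₗ[ℝ] ℝ} : (P.sides u v φ).Finite :=
  (finite_setOf_isMid.prod finite_setOf_isMid).subset fun _ hp => ⟨hp.1, hp.2.1⟩

theorem finite_mixedSides {φ : E →ₗ[ℝ] ℝ} : (P.mixedSides u v φ).Finite :=
  finite_sides.subset fun _ hp => hp.1

namespace Spindle

variable (h : P.Spindle u v)
include h

theorem exists_isMid : ∃ x, P.IsMid u v x := by
  have := h.finiteDimensional
  obtain ⟨d, -, hd⟩ := exists_not_smul_of_two_le_finrank (W := (⊤ : Submodule ℝ E))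
    (by rw [finrank_top, h.finrank_eq]; norm_num) (v - u)
  have huv : v - u ≠ 0 := fun e => by
    obtain rfl := sub_eq_zero.1 e
    refine hd 0 ((h.vert_u.2 d fun k hk => absurd hk (h.disj k hk)).trans (zero_smul _ _).symm)
  obtain ⟨θ, -, hθ⟩ := exists_dual_of_not_smul (e := 0) (d := v - u) fun c => by
    rwa [smul_zero]
  obtain ⟨r, hr, hθr, hext⟩ := exists_extremal_direction (Set.toFinite (P.act u)) P.n (-θ) (v - u)
    (fun k hk => (h.pos_of_mem_u hk).le) (by rw [LinearMap.neg_apply]; linarith)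
  have hr0 : r ≠ 0 := by rintro rfl; simp at hθr
  obtain ⟨τ, -, hvert, hadj, -⟩ := h.vert_u.exists_travel (h.bdd r hr0) hr fun d hd => by
    obtain ⟨c, hc⟩ := hext d hd
    exact ⟨c, sub_eq_zero.1 (h.vert_u.2 _ hc)⟩
  refine ⟨_, hvert, hadj.1.symm, fun e => ?_⟩
  rw [e] at hadj
  obtain ⟨c, hc⟩ := hadj.2 d fun k hk hk' => absurd hk' (h.disj k hk)
  exact hd c hc

/-- A cell has at most as many edges as vertices. -/
theorem card_sides_le {c : Set ι} (hc : P.IsCell u v c) (φ : E →ₗ[ℝ] ℝ) :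
    {p | p ∈ P.sides u v φ ∧ c ⊆ P.act p.1 ∧ c ⊆ P.act p.2}.ncard ≤
      {x | P.IsMid u v x ∧ c ⊆ P.act x}.ncard := by
  classical
  have hS : {p | p ∈ P.sides u v φ ∧ c ⊆ P.act p.1 ∧ c ⊆ P.act p.2}.Finite :=
    finite_sides.subset fun _ hp => hp.1
  have hX : {x | P.IsMid u v x ∧ c ⊆ P.act x}.Finite :=
    finite_setOf_isMid.subset fun _ hx => hx.1
  rw [Set.ncard_eq_toFinset_card _ hS, Set.ncard_eq_toFinset_card _ hX]
  refine le_of_mul_le_mul_right (Finset.card_mul_le_card_mul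
    (fun (p : E × E) (x : E) => x = p.1 ∨ x = p.2) (m := 2) (n := 2) ?_ ?_) two_pos
  · rintro ⟨x, y⟩ hp
    rw [Set.Finite.mem_toFinset] at hp
    rw [← Finset.card_pair hp.1.2.2.1.1]
    refine Finset.card_le_card fun z hz => ?_
    rw [Finset.mem_bipartiteAbove, Set.Finite.mem_toFinset]
    rw [Finset.mem_insert, Finset.mem_singleton] at hz
    refine ⟨?_, hz⟩
    rcases hz with rfl | rfl
    exacts [⟨hp.1.1, hp.2.1⟩, ⟨hp.1.2.1, hp.2.2⟩]
  · intro x hx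
    rw [Set.Finite.mem_toFinset] at hx
    obtain ⟨y, y', -, -, -, huniq⟩ := h.exists_two_sides hx.1 hc hx.2
    let o : E → E × E := fun z => if φ x < φ z then (x, z) else (z, x)
    refine (Finset.card_le_card (t := {o y, o y'}) fun p hp => ?_).trans Finset.card_le_two
    rw [Finset.mem_bipartiteBelow, Set.Finite.mem_toFinset] at hp
    obtain ⟨⟨⟨h₁, h₂, hadj, hlt⟩, hc₁, hc₂⟩, hp⟩ := hp
    have key : ∃ z, P.Side u v c x z ∧ p = o z := by
      rcases hp with rfl | rfl
      · exact ⟨p.2, ⟨h₂, hadj, hc₂⟩, by simp only [o]; rw [if_pos hlt]⟩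
      · exact ⟨p.1, ⟨h₁, hadj.symm, hc₁⟩, by simp only [o]; rw [if_neg hlt.not_gt]⟩
    obtain ⟨z, hz, rfl⟩ := key
    rw [Finset.mem_insert, Finset.mem_singleton]
    rcases (huniq z).1 hz with rfl | rfl
    exacts [Or.inl rfl, Or.inr rfl]

/-- Around a cell, being a coboundary is a single linear condition. -/
theorem exists_dual_of_cell {c : Set ι} (hc : P.IsCell u v c) {φ : E →ₗ[ℝ] ℝ}
    (hφ : ∀ x y, P.IsMid u v x → P.IsMid u v y → φ x = φ y → x = y) :
    ∃ l : (P.mixedSides u v φ → ℝ) →ₗ[ℝ] ℝ, ∀ ω, l ω = 0 → ∃ p : E → ℝ,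
      ∀ s ∈ P.sides u v φ, c ⊆ P.act s.1 → c ⊆ P.act s.2 →
        ∀ r, (∀ hs : s ∈ P.mixedSides u v φ, r = ω ⟨s, hs⟩) → (s ∉ P.mixedSides u v φ → r = 0) →
          r = p s.2 - p s.1 := by
  classical
  set S := {p | p ∈ P.sides u v φ ∧ c ⊆ P.act p.1 ∧ c ⊆ P.act p.2} with hSdef
  set X := {x | P.IsMid u v x ∧ c ⊆ P.act x} with hXdef
  have hS : Finite S := (finite_sides.subset fun _ hp => hp.1 : S.Finite)
  have hX : Finite X := (finite_setOf_isMid.subset fun _ hx => hx.1 : X.Finite)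
  have := Fintype.ofFinite S
  have := Fintype.ofFinite X
  let δ : (X → ℝ) →ₗ[ℝ] (S → ℝ) := LinearMap.pi fun s =>
    (LinearMap.proj (⟨s.1.2, s.2.1.2.1, s.2.2.2⟩ : X) : (X → ℝ) →ₗ[ℝ] ℝ) -
      LinearMap.proj (⟨s.1.1, s.2.1.1, s.2.2.1⟩ : X)
  have hδ : ∀ f s, δ f s = f ⟨s.1.2, s.2.1.2.1, s.2.2.2⟩ - f ⟨s.1.1, s.2.1.1, s.2.2.1⟩ :=
    fun f s => rfl
  let e : (P.mixedSides u v φ → ℝ) →ₗ[ℝ] (S → ℝ) := LinearMap.pi fun s =>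
    if hs : s.1 ∈ P.mixedSides u v φ then LinearMap.proj ⟨s.1, hs⟩ else 0
  obtain ⟨l, hl⟩ := δ.exists_dual_ker_le_range (by
    rw [Module.finrank_fintype_fun_eq_card, Module.finrank_fintype_fun_eq_card,
      ← Nat.card_eq_fintype_card, ← Nat.card_eq_fintype_card]
    exact h.card_sides_le hc φ) 1 (fun f hf => by
    have hconst : ∀ x y : X, f x = f y := by
      intro x y
      let F : E → ℝ := fun x => if hx : x ∈ X then f ⟨x, hx⟩ else 0
      have hF : ∀ x : X, F x.1 = f x := fun x => dif_pos x.2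
      rw [← hF, ← hF]
      refine h.eq_of_adj_eq_in_cell hc 0 (-1) F (fun a b ha hb hca hcb hab _ _ => ?_)
        x.2.1 y.2.1 x.2.2 y.2.2 (by simp) (by simp)
      have key : ∀ {a b} (ha : a ∈ X) (hb : b ∈ X), P.Adj a b → φ a < φ b → F a = F b := by
        intro a b ha hb hab hlt
        have := congrFun hf ⟨(a, b), ⟨ha.1, hb.1, hab, hlt⟩, ha.2, hb.2⟩
        rw [hδ, Pi.zero_apply, sub_eq_zero] at this
        rw [hF ⟨a, ha⟩, hF ⟨b, hb⟩, this]
      rcases lt_trichotomy (φ a) (φ b) with hlt | heq | hgt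
      · exact key ⟨ha, hca⟩ ⟨hb, hcb⟩ hab hlt
      · exact absurd (hφ a b ha hb heq) hab.1
      · exact (key ⟨hb, hcb⟩ ⟨ha, hca⟩ hab.symm hgt).symm
    rcases isEmpty_or_nonempty X with hX | ⟨⟨x⟩⟩
    · exact ⟨0, funext fun x => (hX.false x).elim⟩
    · exact ⟨f x, funext fun y => by
        rw [Pi.smul_apply, Pi.one_apply, smul_eq_mul, mul_one, hconst x y]⟩)
  refine ⟨l.comp e, fun ω hω => ?_⟩
  obtain ⟨f, hf⟩ := hl _ hω
  let F : E → ℝ := fun x => if hx : x ∈ X then f ⟨x, hx⟩ else 0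
  have hF : ∀ x : X, F x.1 = f x := fun x => dif_pos x.2
  refine ⟨F, fun s hs hc₁ hc₂ r hr hr' => ?_⟩
  have h1 := congrFun hf ⟨s, hs, hc₁, hc₂⟩
  have h2 : e ω ⟨s, hs, hc₁, hc₂⟩ = r := by
    by_cases hm : s ∈ P.mixedSides u v φ
    · rw [hr hm]; simp [e, hm]
    · rw [hr' hm]; simp [e, hm]
  rw [hδ, h2] at h1
  rw [← h1]
  exact (congrArg₂ (· - ·) (hF ⟨s.2, hs.2.1, hc₂⟩) (hF ⟨s.1, hs.1, hc₁⟩)).symm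

theorem card_mixedSides_add_one_le {φ : E →ₗ[ℝ] ℝ}
    (hφ : ∀ x y, P.IsMid u v x → P.IsMid u v y → φ x = φ y → x = y) :
    (P.mixedSides u v φ).ncard + 1 ≤
      (P.mixedCells u v).ncard + (P.comp u v '' {x | P.IsMid u v x}).ncard := by
  classical
  have hS : Finite (P.mixedSides u v φ) := finite_mixedSides
  have := Fintype.ofFinite (P.mixedSides u v φ)
  set V := P.comp u v '' {x | P.IsMid u v x} with hV
  have hVf : Finite V := (finite_setOf_isMid.image _ : V.Finite)
  have := Fintype.ofFinite V
  have := Fintype.ofFinite (P.mixedCells u v)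
  let node : ∀ x, P.IsMid u v x → V := fun x hx => ⟨P.comp u v x, x, hx, rfl⟩
  let δ : (V → ℝ) →ₗ[ℝ] (P.mixedSides u v φ → ℝ) := LinearMap.pi fun s =>
    (LinearMap.proj (node s.1.2 s.2.1.2.1) : (V → ℝ) →ₗ[ℝ] ℝ) - LinearMap.proj (node s.1.1 s.2.1.1)
  choose! l hl using fun (c : Set ι) (hc : P.IsCell u v c) => h.exists_dual_of_cell hc hφ
  let Λ : (P.mixedSides u v φ → ℝ) →ₗ[ℝ] (P.mixedCells u v → ℝ) := LinearMap.pi fun c => l c.1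
  have hrange : ∀ ω, Λ ω = 0 → ∃ f, δ f = ω := by
    intro ω hω
    let ω' : E → E → ℝ := fun x y =>
      if hs : (x, y) ∈ P.mixedSides u v φ then ω ⟨_, hs⟩ else
      if hs : (y, x) ∈ P.mixedSides u v φ then -ω ⟨_, hs⟩ else 0
    have hpos : ∀ {x y}, φ x < φ y → (∀ hs : (x, y) ∈ P.mixedSides u v φ, ω' x y = ω ⟨_, hs⟩) ∧
        ((x, y) ∉ P.mixedSides u v φ → ω' x y = 0) := by
      intro x y hlt
      refine ⟨fun hs => dif_pos hs, fun hs => ?_⟩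
      simp only [ω']
      rw [dif_neg hs, dif_neg fun hs' => hlt.not_gt hs'.1.2.2.2]
    have hneg : ∀ {x y}, φ x < φ y → ω' y x = -ω' x y := by
      intro x y hlt
      simp only [ω']
      rw [dif_neg fun hs' => hlt.not_gt hs'.1.2.2.2]
      by_cases hs : (x, y) ∈ P.mixedSides u v φ
      · rw [dif_pos hs, dif_pos hs]
      · rw [dif_neg hs, dif_neg hs, dif_neg fun hs' => hlt.not_gt hs'.1.2.2.2, neg_zero]
    have hpure : ∀ {x y}, P.Pure u v x → P.Pure u v y → ω' x y = 0 := by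
      intro x y hx hy
      simp only [ω']
      rw [dif_neg fun hs => hs.2.elim hx.2 hy.2, dif_neg fun hs => hs.2.elim hy.2 hx.2]
    obtain ⟨p, hp⟩ := h.exists_potential ω' fun c hc => by
      by_cases hcm : c ∈ P.mixedCells u v
      · obtain ⟨p, hp⟩ := hl c hc ω (congrFun hω ⟨c, hcm⟩)
        have key : ∀ {x y}, P.IsMid u v x → P.IsMid u v y → P.Adj x y → c ⊆ P.act x →
            c ⊆ P.act y → φ x < φ y → ω' x y = p y - p x := fun hx hy hxy hcx hcy hlt =>
          hp (_, _) ⟨hx, hy, hxy, hlt⟩ hcx hcy _ (hpos hlt).1 (hpos hlt).2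
        refine ⟨p, fun x y hx hy hxy hcx hcy => ?_⟩
        rcases lt_trichotomy (φ x) (φ y) with hlt | heq | hgt
        · exact key hx hy hxy hcx hcy hlt
        · exact absurd (hφ x y hx hy heq) hxy.1
        · rw [hneg hgt, key hy hx hxy.symm hcy hcx hgt, neg_sub]
      · refine ⟨0, fun x y hx hy _ hcx hcy => ?_⟩
        rw [hpure ⟨hx, fun hm => hcm ⟨hc, x, hx, hm, hcx⟩⟩ ⟨hy, fun hm => hcm ⟨hc, y, hy, hm, hcy⟩⟩]
        simp
    have hconst : ∀ {x y}, y ∈ P.comp u v x → p y = p x := by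
      intro x y hy
      induction hy with
      | refl => rfl
      | tail _ hab ih =>
        have := hp _ _ hab.1.1 hab.2.1.1 hab.2.2
        rw [hpure hab.1 hab.2.1] at this
        linarith
    have hrep : ∀ S : V, ∃ x, S.1 = P.comp u v x := by
      rintro ⟨_, x, -, rfl⟩
      exact ⟨x, rfl⟩
    choose rep hrep using hrep
    have hq : ∀ x (hx : P.IsMid u v x), p (rep (node x hx)) = p x := fun x hx => by
      have hmem := mem_comp_self (P := P) (u := u) (v := v) x
      rw [show P.comp u v x = _ from hrep (node x hx)] at hmem
      exact (hconst hmem).symm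
    refine ⟨fun S => p (rep S), funext fun s => ?_⟩
    change p (rep (node s.1.2 s.2.1.2.1)) - p (rep (node s.1.1 s.2.1.1)) = ω s
    rw [hq _ s.2.1.2.1, hq _ s.2.1.1, ← hp _ _ s.2.1.1 s.2.1.2.1 s.2.1.2.2.1]
    exact dif_pos s.2
  obtain ⟨x, hx⟩ := h.exists_isMid
  have := δ.finrank_add_one_le_of_ker_le_range Λ hrange (e := 1)
    (fun e => one_ne_zero (congrFun e (node x hx))) (funext fun s => sub_self 1)
  rw [Module.finrank_fintype_fun_eq_card, Module.finrank_fintype_fun_eq_card,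
    Module.finrank_fintype_fun_eq_card, ← Nat.card_eq_fintype_card, ← Nat.card_eq_fintype_card,
    ← Nat.card_eq_fintype_card] at this
  exact this

end Spindle

end IneqSystem

namespace IneqSystem

variable {ι E : Type*} [AddCommGroup E] [Module ℝ E] {P : IneqSystem ι E} {u v : E}

variable (P) in
/-- The cell `c` joins two edges that leave a component of vertices that are not mixed. -/
def IsGap (u v : E) (c : Set ι) (x : E) : Prop :=
  P.Pure u v x ∧ (P.Thin u x ∧ c ∈ P.gaps u v (P.comp u v x) ∨
    P.Thin v x ∧ c ∈ P.gaps v u (P.comp u v x))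

namespace Spindle

variable [Finite ι] (h : P.Spindle u v)
include h

/-- A vertex lies on at most as many cells as edges. -/
theorem card_cells_le {x : E} (hx : P.IsMid u v x) :
    {c | P.IsCell u v c ∧ c ⊆ P.act x}.ncard ≤ {y | P.IsMid u v y ∧ P.Adj x y}.ncard := by
  classical
  have hC : {c | P.IsCell u v c ∧ c ⊆ P.act x}.Finite := Set.toFinite _
  have hY : {y | P.IsMid u v y ∧ P.Adj x y}.Finite := finite_setOf_isMid.subset fun _ hy => hy.1
  rw [Set.ncard_eq_toFinset_card _ hC, Set.ncard_eq_toFinset_card _ hY]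
  refine le_of_mul_le_mul_right (Finset.card_mul_le_card_mul
    (fun (c : Set ι) (y : E) => c ⊆ P.act y) (m := 2) (n := 2) ?_ ?_) two_pos
  · intro c hc
    rw [Set.Finite.mem_toFinset] at hc
    obtain ⟨y, y', hy, hy', hne, -⟩ := h.exists_two_sides hx hc.1 hc.2
    rw [← Finset.card_pair hne]
    refine Finset.card_le_card fun z hz => ?_
    rw [Finset.mem_bipartiteAbove, Set.Finite.mem_toFinset]
    rw [Finset.mem_insert, Finset.mem_singleton] at hz
    rcases hz with rfl | rfl
    exacts [⟨⟨hy.1, hy.2.1⟩, hy.2.2⟩, ⟨⟨hy'.1, hy'.2.1⟩, hy'.2.2⟩]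
  · intro y hy
    rw [Set.Finite.mem_toFinset] at hy
    obtain ⟨c₁, c₂, -, -, -, -, -, -, -, huniq⟩ := h.exists_two_cells hx hy.1 hy.2
    refine (Finset.card_le_card (t := {c₁, c₂}) fun c hc => ?_).trans Finset.card_le_two
    rw [Finset.mem_bipartiteBelow, Set.Finite.mem_toFinset] at hc
    rw [Finset.mem_insert, Finset.mem_singleton]
    exact huniq c hc.1.1 hc.1.2 hc.2

omit h in
theorem card_adj_le {φ : E →ₗ[ℝ] ℝ}
    (hφ : ∀ x y, P.IsMid u v x → P.IsMid u v y → φ x = φ y → x = y) :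
    {p : E × E | P.IsMid u v p.1 ∧ P.IsMid u v p.2 ∧ P.Adj p.1 p.2 ∧
      (P.Mixed u v p.1 ∨ P.Mixed u v p.2)}.ncard ≤ 2 * (P.mixedSides u v φ).ncard := by
  have hsub : {p : E × E | P.IsMid u v p.1 ∧ P.IsMid u v p.2 ∧ P.Adj p.1 p.2 ∧
      (P.Mixed u v p.1 ∨ P.Mixed u v p.2)} ⊆
      P.mixedSides u v φ ∪ Prod.swap '' P.mixedSides u v φ := by
    rintro ⟨x, y⟩ ⟨hx, hy, hadj, hm⟩
    rcases lt_trichotomy (φ x) (φ y) with hlt | heq | hlt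
    · exact Or.inl ⟨⟨hx, hy, hadj, hlt⟩, hm⟩
    · exact absurd (hφ x y hx hy heq) hadj.1
    · exact Or.inr ⟨(y, x), ⟨⟨hy, hx, hadj.symm, hlt⟩, hm.symm⟩, rfl⟩
  refine (Set.ncard_le_ncard hsub (finite_mixedSides.union (finite_mixedSides.image _))).trans
    ((Set.ncard_union_le _ _).trans ?_)
  have := Set.ncard_image_le (f := Prod.swap) (P.finite_mixedSides (u := u) (v := v) (φ := φ))
  omega

theorem card_gap_add_two_le {x : E} (hx : P.Pure u v x) :
    {c | ∃ y, P.IsGap u v c y ∧ P.comp u v y = P.comp u v x}.ncard + 2 ≤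
      (P.exits u v (P.comp u v x)).ncard := by
  rcases not_mixed_iff.1 hx.2 with hu | hv
  · obtain ⟨i, hi, hix⟩ := h.exists_mem_u hx.1
    have hN := h.node_comp hx hu hi hix
    refine le_trans (Nat.add_le_add_right (Set.ncard_le_ncard ?_ (Set.toFinite _)) 2)
      (h.card_gaps_add_two_le hN)
    rintro c ⟨y, ⟨hy, hg⟩, hyx⟩
    rw [hyx] at hg
    refine (hg.resolve_right fun hv => h.not_thin hy.1 (hN.thin y ?_) hv.1).2
    rw [← hyx]
    exact mem_comp_self y
  · obtain ⟨i, hi, hix⟩ := h.exists_mem_v hx.1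
    have hN := h.swap.node_comp hx.swap hv hi hix
    rw [comp_swap] at hN
    refine le_trans (Nat.add_le_add_right (Set.ncard_le_ncard ?_ (Set.toFinite _)) 2)
      ((h.swap.card_gaps_add_two_le hN).trans_eq (by rw [exits_swap]))
    rintro c ⟨y, ⟨hy, hg⟩, hyx⟩
    rw [hyx] at hg
    refine (hg.resolve_left fun hu => h.not_thin hy.1 hu.1 (hN.thin y ?_)).2
    rw [← hyx]
    exact mem_comp_self y

/-- A cell with few mixed vertices is a gap. -/
theorem exists_isGap (hM : P.NoShortWalk u v) {c : Set ι} (hc : c ∈ P.mixedCells u v)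
    (hlt : 2 * {x | P.IsMid u v x ∧ P.Mixed u v x ∧ c ⊆ P.act x}.ncard <
      4 + {x | P.IsMid u v x ∧ c ⊆ P.act x ∧ P.Turn u v c x}.ncard) :
    ∃ x, P.IsGap u v c x := by
  obtain ⟨hc, z, hz, hmz, hcz⟩ := hc
  have hfin : {x | P.IsMid u v x ∧ P.Mixed u v x ∧ c ⊆ P.act x}.Finite :=
    finite_setOf_isMid.subset fun _ hy => hy.1
  have hsub : {x | P.IsMid u v x ∧ c ⊆ P.act x ∧ P.Turn u v c x} ⊆
      {x | P.IsMid u v x ∧ P.Mixed u v x ∧ c ⊆ P.act x} := fun x hx =>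
    ⟨hx.1, by_contra fun hm => h.not_turn_of_not_mixed hx.1 hm hx.2.2, hx.2.1⟩
  have hle := Set.ncard_le_ncard hsub hfin
  have hpos : 0 < {x | P.IsMid u v x ∧ P.Mixed u v x ∧ c ⊆ P.act x}.ncard :=
    (Set.ncard_pos hfin).2 ⟨z, hz, hmz, hcz⟩
  obtain ⟨k, hk⟩ := h.even_card_turn hM hc
  have hcases : {x | P.IsMid u v x ∧ P.Mixed u v x ∧ c ⊆ P.act x}.ncard = 1 ∨
      {x | P.IsMid u v x ∧ P.Mixed u v x ∧ c ⊆ P.act x}.ncard = 2 ∧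
      {x | P.IsMid u v x ∧ c ⊆ P.act x ∧ P.Turn u v c x}.ncard = 2 := by omega
  rcases hcases with h1 | ⟨h1, h2⟩
  · obtain ⟨a, ha⟩ := Set.ncard_eq_one.1 h1
    have key : ∀ p, P.IsMid u v p → c ⊆ P.act p → P.Mixed u v p → p = a := fun p hp hcp hmp => by
      have : p ∈ {x | P.IsMid u v x ∧ P.Mixed u v x ∧ c ⊆ P.act x} := ⟨hp, hmp, hcp⟩
      rwa [ha] at this
    obtain rfl := key z hz hcz hmz
    exact h.exists_gap_of_unique_mixed hM hc hz hmz hcz key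
  · have heq := Set.eq_of_subset_of_ncard_le hsub (by omega) hfin
    obtain ⟨a, b, hab, hset⟩ := Set.ncard_eq_two.1 h2
    have ha : a ∈ {x | P.IsMid u v x ∧ c ⊆ P.act x ∧ P.Turn u v c x} := by
      rw [hset]; exact Or.inl rfl
    have hb : b ∈ {x | P.IsMid u v x ∧ c ⊆ P.act x ∧ P.Turn u v c x} := by
      rw [hset]; exact Or.inr rfl
    refine h.exists_gap_of_turn hM hc hab ha.1 hb.1 (hsub ha).2.1 (hsub hb).2.1 ha.2.1 hb.2.1
      ha.2.2 hb.2.2 fun p hp hcp hmp => ?_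
    have : p ∈ {x | P.IsMid u v x ∧ P.Mixed u v x ∧ c ⊆ P.act x} := ⟨hp, hmp, hcp⟩
    rwa [← heq, hset] at this

theorem not_noShortWalk : ¬ P.NoShortWalk u v := by
  classical
  intro hM
  obtain ⟨φ, -, hφ⟩ := h.exists_injOn_dual
  have hMf : {x | P.IsMid u v x ∧ P.Mixed u v x}.Finite :=
    finite_setOf_isMid.subset fun _ hx => hx.1
  have hKf : (P.comp u v '' {x | P.Pure u v x}).Finite :=
    (finite_setOf_isMid.subset fun _ hx => hx.1).image _
  have hNf : (P.mixedCells u v).Finite := Set.toFinite _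
  obtain ⟨M, hMmem⟩ : ∃ M : Finset E, ∀ x, x ∈ M ↔ P.IsMid u v x ∧ P.Mixed u v x :=
    ⟨hMf.toFinset, fun x => hMf.mem_toFinset⟩
  obtain ⟨X, hXmem⟩ : ∃ X : Finset E, ∀ x, x ∈ X ↔ P.IsMid u v x :=
    ⟨finite_setOf_isMid.toFinset, fun x => finite_setOf_isMid.mem_toFinset⟩
  obtain ⟨N, hNmem⟩ : ∃ N : Finset (Set ι), ∀ c, c ∈ N ↔ c ∈ P.mixedCells u v :=
    ⟨hNf.toFinset, fun x => hNf.mem_toFinset⟩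
  obtain ⟨K, hKmem⟩ : ∃ K : Finset (Set E), ∀ S, S ∈ K ↔ ∃ x, P.Pure u v x ∧ P.comp u v x = S :=
    ⟨hKf.toFinset, fun x => hKf.mem_toFinset⟩
  have hN : (P.mixedCells u v).ncard = N.card := by
    rw [← Set.ncard_coe_finset]; congr 1; ext c; exact (hNmem c).symm
  have hV : (P.comp u v '' {x | P.IsMid u v x}).ncard ≤ K.card + M.card := by
    have hsub : P.comp u v '' {x | P.IsMid u v x} ⊆ ↑(K ∪ M.image (P.comp u v)) := by
      rintro _ ⟨x, hx, rfl⟩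
      rw [Finset.mem_coe, Finset.mem_union, hKmem, Finset.mem_image]
      by_cases hm : P.Mixed u v x
      · exact Or.inr ⟨x, (hMmem x).2 ⟨hx, hm⟩, rfl⟩
      · exact Or.inl ⟨x, ⟨hx, hm⟩, rfl⟩
    refine (Set.ncard_le_ncard hsub (Finset.finite_toSet _)).trans ?_
    rw [Set.ncard_coe_finset]
    exact (Finset.card_union_le _ _).trans (Nat.add_le_add_left Finset.card_image_le _)
  have hEuler := h.card_mixedSides_add_one_le hφ
  -- the corners at mixed vertices
  have hcorner : ∑ x ∈ M, (N.filter fun c => c ⊆ P.act x).card ≤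
      ∑ x ∈ M, (X.filter fun y => P.Adj x y).card := by
    refine Finset.sum_le_sum fun x hx => ?_
    rw [hMmem] at hx
    refine Eq.trans_le ?_ ((h.card_cells_le hx.1).trans_eq ?_) <;> rw [← Set.ncard_coe_finset] <;>
      congr 1
    · ext c
      rw [Finset.mem_coe, Finset.mem_filter, hNmem]
      exact ⟨fun hc => ⟨hc.1.1, hc.2⟩, fun hc => ⟨⟨hc.1, x, hx.1, hx.2, hc.2⟩, hc.2⟩⟩
    · ext y
      rw [Finset.mem_coe, Finset.mem_filter, hXmem]
      rfl
  have hturn : 4 * M.card ≤ ∑ x ∈ M, (N.filter fun c => c ⊆ P.act x ∧ P.Turn u v c x).card := by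
    rw [mul_comm, ← smul_eq_mul]
    refine Finset.card_nsmul_le_sum _ _ _ fun x hx => ?_
    rw [hMmem] at hx
    refine (h.four_le_card_turn hM hx.1 hx.2).trans_eq ?_
    rw [← Set.ncard_coe_finset]
    congr 1
    ext c
    rw [Finset.mem_coe, Finset.mem_filter, hNmem]
    exact ⟨fun hc => ⟨⟨hc.1, x, hx.1, hx.2, hc.2.1⟩, hc.2⟩, fun hc => ⟨hc.1.1, hc.2⟩⟩
  -- exchange the order of summation
  have hsw₁ : ∑ x ∈ M, (N.filter fun c => c ⊆ P.act x).card =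
      ∑ c ∈ N, (M.filter fun x => c ⊆ P.act x).card :=
    Finset.sum_card_bipartiteAbove_eq_sum_card_bipartiteBelow fun (x : E) c => c ⊆ P.act x
  have hsw₂ : ∑ x ∈ M, (N.filter fun c => c ⊆ P.act x ∧ P.Turn u v c x).card =
      ∑ c ∈ N, (M.filter fun x => c ⊆ P.act x ∧ P.Turn u v c x).card :=
    Finset.sum_card_bipartiteAbove_eq_sum_card_bipartiteBelow
      fun (x : E) c => c ⊆ P.act x ∧ P.Turn u v c x
  have hcell : ∑ c ∈ N, (4 + (M.filter fun x => c ⊆ P.act x ∧ P.Turn u v c x).card) ≤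
      ∑ c ∈ N, (2 * (M.filter fun x => c ⊆ P.act x).card +
        2 * if ∃ x, P.IsGap u v c x then 1 else 0) := by
    refine Finset.sum_le_sum fun c hc => ?_
    rw [hNmem] at hc
    have e₁ : {x | P.IsMid u v x ∧ P.Mixed u v x ∧ c ⊆ P.act x}.ncard =
        (M.filter fun x => c ⊆ P.act x).card := by
      rw [← Set.ncard_coe_finset]; congr 1; ext x
      rw [Finset.mem_coe, Finset.mem_filter, hMmem, and_assoc]
      rfl
    have e₂ : {x | P.IsMid u v x ∧ c ⊆ P.act x ∧ P.Turn u v c x}.ncard =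
        (M.filter fun x => c ⊆ P.act x ∧ P.Turn u v c x).card := by
      rw [← Set.ncard_coe_finset]; congr 1; ext x
      rw [Finset.mem_coe, Finset.mem_filter, hMmem]
      exact ⟨fun hx => ⟨⟨hx.1, by_contra fun hm => h.not_turn_of_not_mixed hx.1 hm hx.2.2⟩, hx.2⟩,
        fun hx => ⟨hx.1.1, hx.2⟩⟩
    have key := h.exists_isGap hM hc
    rw [e₁, e₂] at key
    obtain ⟨k, hk⟩ := h.even_card_turn hM hc.1
    rw [e₂] at hk
    obtain ⟨-, z, hz, hmz, hcz⟩ := hc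
    have hpos : 0 < (M.filter fun x => c ⊆ P.act x).card :=
      Finset.card_pos.2 ⟨z, Finset.mem_filter.2 ⟨(hMmem z).2 ⟨hz, hmz⟩, hcz⟩⟩
    have hle : (M.filter fun x => c ⊆ P.act x ∧ P.Turn u v c x).card ≤
        (M.filter fun x => c ⊆ P.act x).card :=
      Finset.card_le_card fun x hx => by
        rw [Finset.mem_filter] at hx ⊢
        exact ⟨hx.1, hx.2.1⟩
    split_ifs with hg
    · omega
    · have := not_lt.1 fun hlt => hg (key hlt)
      omega
  -- every component of vertices that are not mixed has more edges leaving it than gaps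
  have hgap : (N.filter fun c => ∃ x, P.IsGap u v c x).card + 2 * K.card ≤
      ∑ S ∈ K, (P.exits u v S).ncard := by
    have hsub : (N.filter fun c => ∃ x, P.IsGap u v c x) ⊆
        K.biUnion fun S => N.filter fun c => ∃ x, P.IsGap u v c x ∧ P.comp u v x = S := by
      intro c hc
      obtain ⟨hcN, x, hx⟩ := Finset.mem_filter.1 hc
      exact Finset.mem_biUnion.2 ⟨_, (hKmem _).2 ⟨x, hx.1, rfl⟩,
        Finset.mem_filter.2 ⟨hcN, x, hx, rfl⟩⟩
    refine (Nat.add_le_add_right ((Finset.card_le_card hsub).trans Finset.card_biUnion_le) _).trans ?_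
    rw [mul_comm, ← smul_eq_mul, ← Finset.sum_const, ← Finset.sum_add_distrib]
    refine Finset.sum_le_sum fun S hS => ?_
    obtain ⟨x, hx, rfl⟩ := (hKmem S).1 hS
    refine le_trans (Nat.add_le_add_right ?_ 2) (h.card_gap_add_two_le hx)
    rw [← Set.ncard_coe_finset]
    exact Set.ncard_le_ncard (fun c hc => (Finset.mem_filter.1 hc).2) (Set.toFinite _)
  -- the edges with a mixed end
  have hedge : ∑ x ∈ M, (X.filter fun y => P.Adj x y).card + ∑ S ∈ K, (P.exits u v S).ncard ≤
      2 * (P.mixedSides u v φ).ncard := by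
    refine le_trans ?_ (card_adj_le hφ)
    have hQf : {p : E × E | P.IsMid u v p.1 ∧ P.IsMid u v p.2 ∧ P.Adj p.1 p.2 ∧
        (P.Mixed u v p.1 ∨ P.Mixed u v p.2)}.Finite :=
      (finite_setOf_isMid.prod finite_setOf_isMid).subset fun p hp => ⟨hp.1, hp.2.1⟩
    have hKmid : ∀ S ∈ K, ∀ w ∈ S, P.Pure u v w ∧ P.comp u v w = S := by
      intro S hS w hw
      obtain ⟨x, hx, rfl⟩ := (hKmem S).1 hS
      exact ⟨hx.of_mem_comp hw, comp_eq_of_mem hw⟩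
    have hex : ∀ S ∈ K, (P.exits u v S).Finite := fun S hS =>
      finite_exits fun w hw => (hKmid S hS w hw).1.1
    have e₁ : ∑ x ∈ M, (X.filter fun y => P.Adj x y).card =
        ((M ×ˢ X).filter fun p => P.Adj p.1 p.2).card := by
      simp_rw [Finset.card_filter, Finset.sum_product]
    have e₂ : ∑ S ∈ K, (P.exits u v S).ncard = (⋃ S ∈ K, P.exits u v S).ncard := by
      rw [← finsum_mem_coe_finset, ← K.finite_toSet.ncard_biUnion hex]
      · rfl
      · intro S hS S' hS' hne
        refine Set.disjoint_left.2 fun p hp hp' => hne ?_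
        rw [← (hKmid S hS _ hp.1).2, (hKmid S' hS' _ hp'.1).2]
    rw [e₁, e₂, ← Set.ncard_coe_finset, ← Set.ncard_union_eq ?_ (Finset.finite_toSet _) ?_]
    · refine Set.ncard_le_ncard (Set.union_subset ?_ ?_) hQf
      · intro p hp
        rw [Finset.mem_coe, Finset.mem_filter, Finset.mem_product, hMmem, hXmem] at hp
        exact ⟨hp.1.1.1, hp.1.2, hp.2, Or.inl hp.1.1.2⟩
      · refine Set.iUnion₂_subset fun S hS p hp => ?_
        exact ⟨(hKmid S hS _ hp.1).1.1, hp.2.1, hp.2.2.2, Or.inr hp.2.2.1⟩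
    · rw [Set.disjoint_iUnion₂_right]
      refine fun S hS => Set.disjoint_left.2 fun p hp hp' => (hKmid S hS _ hp'.1).1.2 ?_
      rw [Finset.mem_coe, Finset.mem_filter, Finset.mem_product, hMmem] at hp
      exact hp.1.1.2
    · exact K.finite_toSet.biUnion hex
  rw [Finset.sum_add_distrib, Finset.sum_add_distrib, ← Finset.mul_sum, ← Finset.mul_sum,
    ← Finset.card_filter, Finset.sum_const, smul_eq_mul, ← hsw₁, ← hsw₂] at hcell
  omega

end Spindle

end IneqSystem

namespace IneqSystem

variable {ι E : Type*} [AddCommGroup E] [Module ℝ E] {P : IneqSystem ι E} {u v : E}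

namespace Spindle

variable (h : P.Spindle u v)
include h

/-- The last facets of an edge walk are new at the apex `v`. -/
theorem ssubset_apex {x : E} (hx : P.IsMid u v x) : P.act x ∩ P.act v ⊂ P.act v ∩ P.act v := by
  refine ⟨fun k hk => ⟨hk.2, hk.2⟩, fun hs => hx.2.2 ?_⟩
  exact (h.vert_v.eq_of_act_subset fun k hk => (hs ⟨hk, hk⟩).1).symm

/-- At the apex `u` no facet at `v` is active. -/
theorem apex_ssubset {x : E} (hx : P.IsMid u v x) : P.act u ∩ P.act v ⊂ P.act x ∩ P.act v := by
  obtain ⟨k, hk, hkx⟩ := h.exists_mem_v hx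
  exact ⟨fun k hk => absurd hk.2 (h.disj k hk.1), fun hs => h.disj k (hs ⟨hkx, hk⟩).1 hk⟩

/-- Stepping to a neighbour of `v` activates a new facet at `v` unless one is lost. -/
theorem ssubset_of_adj {x w : E} (hx : P.IsMid u v x) (hw : P.IsMid u v w) (hxw : P.Adj x w)
    (hvw : P.Adj v w) (hs : P.act x ∩ P.act v ⊆ P.act w) :
    P.act x ∩ P.act v ⊂ P.act w ∩ P.act v := by
  refine ⟨fun k hk => ⟨hs hk, hk.2⟩, fun hs' => ?_⟩
  obtain ⟨c, hc⟩ := hvw.2 (x - v) fun k hkv hkw => n_sub_eq_zero hkv (hs' ⟨hkw, hkv⟩).1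
  exact (h.vert_v.eq_or_eq_of_collinear hw.1 hx.1 hc).elim hx.2.2 hxw.1

end Spindle

end IneqSystem

namespace PolyData

variable {d f : ℕ}

/-- The system of inequalities defining a polyhedron. -/
def ineqSystem (P : PolyData d f) : IneqSystem (Fin f) (Fin d → ℝ) where
  n i := ∑ j, P.row i j • LinearMap.proj j
  b := P.rhs

theorem ineqSystem_apply (P : PolyData d f) (i : Fin f) (z : Fin d → ℝ) :
    P.ineqSystem.n i z = P.eval i z := by
  simp [ineqSystem, eval, LinearMap.sum_apply]

theorem act_ineqSystem (P : PolyData d f) (z : Fin d → ℝ) :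
    P.ineqSystem.act z = P.activeAt z := by
  ext i
  rw [IneqSystem.mem_act, ineqSystem_apply]
  rfl

theorem feas_ineqSystem {P : PolyData d f} {z : Fin d → ℝ} :
    P.ineqSystem.Feas z ↔ z ∈ P.toSet :=
  forall_congr' fun i => by rw [ineqSystem_apply]; rfl

theorem span_row_eq_top_iff {P : PolyData d f} {s : Set (Fin f)} :
    Submodule.span ℝ (P.row '' s) = ⊤ ↔ ∀ z, (∀ i ∈ s, P.eval i z = 0) → z = 0 := by
  constructor
  · intro hs z hz
    have hle : Submodule.span ℝ (P.row '' s) ≤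
        (∑ j, z j • LinearMap.proj j : (Fin d → ℝ) →ₗ[ℝ] ℝ).ker := by
      rw [Submodule.span_le]
      rintro _ ⟨i, hi, rfl⟩
      rw [SetLike.mem_coe, LinearMap.mem_ker, ← hz i hi]
      simp [eval, LinearMap.sum_apply, mul_comm]
    rw [hs] at hle
    have hzz := hle (Submodule.mem_top (x := z))
    rw [LinearMap.mem_ker] at hzz
    refine dotProduct_self_eq_zero.1 ?_
    simpa [LinearMap.sum_apply, dotProduct] using hzz
  · intro hs
    by_contra hne
    obtain ⟨g, hg, hle⟩ := Submodule.exists_le_ker_of_lt_top _ (lt_top_iff_ne_top.2 hne)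
    have hgz : ∀ x, g x = ∑ j, x j * g (Pi.single j 1) := fun x => by
      conv_lhs => rw [pi_eq_sum_univ' x, map_sum]
      exact Finset.sum_congr rfl fun j _ => by
        rw [map_smul, smul_eq_mul]
    have hz := hs (fun j => g (Pi.single j 1)) fun i hi => by
      rw [eval, ← hgz]
      exact hle (Submodule.subset_span ⟨i, hi, rfl⟩)
    refine hg (LinearMap.ext fun x => ?_)
    rw [hgz]
    simp only [funext_iff, Pi.zero_apply] at hz
    simp [hz]

theorem vert_ineqSystem {P : PolyData d f} {z : Fin d → ℝ} :
    P.ineqSystem.Vert z ↔ P.IsVertex z := by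
  rw [IneqSystem.Vert, IsVertex, feas_ineqSystem, span_row_eq_top_iff, act_ineqSystem]
  simp only [ineqSystem_apply]

theorem isEdge_of_adj {P : PolyData d f} {x y : Fin d → ℝ} (hx : P.ineqSystem.Vert x)
    (hy : P.ineqSystem.Vert y) (hxy : P.ineqSystem.Adj x y) : P.IsEdge x y := by
  refine ⟨vert_ineqSystem.1 hx, vert_ineqSystem.1 hy, hxy.1, ?_⟩
  ext z
  rw [segment_eq_image']
  simp only [← act_ineqSystem, ← feas_ineqSystem, Set.mem_image, Set.mem_ofPred_eq]
  have key : ∀ x y : Fin d → ℝ, P.ineqSystem.Vert x → P.ineqSystem.Feas y → x ≠ y →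
      ∀ c : ℝ, P.ineqSystem.Feas (x + c • (y - x)) → 0 ≤ c := by
    intro x y hx hy hne c hz
    obtain ⟨k, hk, hky⟩ : ∃ k ∈ P.ineqSystem.act x, k ∉ P.ineqSystem.act y := by
      by_contra! hcon
      exact hne (hx.eq_of_act_subset hcon)
    have h1 := hy.pos hk hky
    have h2 := hz.nonneg hk
    rw [add_sub_cancel_left, map_smul, smul_eq_mul] at h2
    exact nonneg_of_mul_nonneg_left h2 h1
  constructor
  · rintro ⟨c, ⟨hc0, hc1⟩, rfl⟩
    constructor
    · intro k
      have h1 := hx.1 k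
      have h2 := hy.1 k
      rw [map_add, map_smul, map_sub, smul_eq_mul]
      nlinarith
    · rintro k ⟨hkx, hky⟩
      rw [IneqSystem.mem_act, map_add, map_smul, IneqSystem.n_sub_eq_zero hkx hky, smul_zero,
        add_zero]
      exact hkx
  · rintro ⟨hz, hs⟩
    obtain ⟨c, hc⟩ := hxy.2 (z - x) fun k hkx hky =>
      IneqSystem.n_sub_eq_zero hkx (hs ⟨hkx, hky⟩)
    have hzc : z = x + c • (y - x) := by rw [← hc]; abel
    have hzc' : z = y + (1 - c) • (x - y) := by rw [hzc]; module
    refine ⟨c, ⟨key x y hx hy.1 hxy.1 c (hzc ▸ hz), ?_⟩, hzc.symm⟩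
    linarith [key y x hy hx.1 hxy.1.symm (1 - c) (hzc' ▸ hz)]

theorem exists_eval_neg {P : PolyData d f} (hb : Bornology.IsBounded P.toSet) {u r : Fin d → ℝ}
    (hu : u ∈ P.toSet) (hr : r ≠ 0) : ∃ k, P.ineqSystem.n k r < 0 := by
  by_contra! hcon
  obtain ⟨C, hC⟩ := hb.exists_norm_le
  have hpos : 0 < ‖r‖ := norm_pos_iff.2 hr
  have hC0 : 0 ≤ C := (norm_nonneg u).trans (hC u hu)
  have ht : 0 ≤ (2 * C + 1) / ‖r‖ := by positivity
  have h1 := hC (u + ((2 * C + 1) / ‖r‖) • r) (feas_ineqSystem.1 fun k => by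
    rw [map_add, map_smul, smul_eq_mul]
    linarith [feas_ineqSystem.2 hu k, mul_nonneg ht (hcon k)])
  have h2 : ‖((2 * C + 1) / ‖r‖) • r‖ = 2 * C + 1 := by
    rw [norm_smul, Real.norm_of_nonneg ht, div_mul_cancel₀ _ hpos.ne']
  have h3 := norm_sub_le (u + ((2 * C + 1) / ‖r‖) • r) u
  rw [add_sub_cancel_left, h2] at h3
  linarith [hC u hu]

theorem spindle_ineqSystem {P : PolyData 4 f} (hP : P.IsProper)
    (hb : Bornology.IsBounded P.toSet) {u v : Fin 4 → ℝ}
    (hu : P.IsVertex u) (hv : P.IsVertex v)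
    (hdisj : Disjoint (P.activeAt u) (P.activeAt v))
    (hcover : P.activeAt u ∪ P.activeAt v = Set.univ) : P.ineqSystem.Spindle u v where
  finrank_eq := by simp
  vert_u := vert_ineqSystem.2 hu
  vert_v := vert_ineqSystem.2 hv
  disj k hk hk' := by
    rw [act_ineqSystem] at hk hk'
    exact Set.disjoint_left.1 hdisj hk hk'
  cover k := by
    rw [act_ineqSystem, act_ineqSystem, ← Set.mem_union, hcover]
    trivial
  bdd r hr := exists_eval_neg hb hu.1 hr
  irr k k' hne := by
    obtain ⟨z, hz, hzk, hlt⟩ := hP.2 k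
    rw [← feas_ineqSystem] at hz
    refine ⟨z, hz, ?_, fun hk' => ?_⟩
    · rw [act_ineqSystem]; exact hzk
    · rw [act_ineqSystem] at hk'
      exact (hlt k' hne.symm).ne' hk'

/-- A walk along which the active facets in `s` strictly grow enters a new one at every step. -/
theorem exists_new_facet {P : PolyData d f} {s : Set (Fin f)} {k : ℕ}
    {w : Fin (k + 1) → Fin d → ℝ}
    (hw : ∀ i : Fin k, P.activeAt (w i.castSucc) ∩ s ⊂ P.activeAt (w i.succ) ∩ s) (i : Fin k) :
    ∃ j ∈ s, j ∈ P.activeAt (w i.succ) ∧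
      ∀ i' : Fin (k + 1), i' ≤ i.castSucc → j ∉ P.activeAt (w i') := by
  have hmono : StrictMono fun i => P.activeAt (w i) ∩ s := Fin.strictMono_iff_lt_succ.2 hw
  obtain ⟨j, hj, hj'⟩ := Set.exists_of_ssubset (hw i)
  exact ⟨j, hj.2, hj.1, fun i' hi' hji' => hj' (hmono.monotone hi' ⟨hji', hj.2⟩)⟩

end PolyData

/-- Corollary 18: in a bounded `4`-dimensional spindle
`P(u,v)` there is an edge walk from `u` to `v` such that in each step a new
facet incident to `v` becomes active, one containing no earlier vertex of
the walk. -/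
theorem spindle_edge_walk (f : ℕ) (P : PolyData 4 f) (hP : P.IsProper)
    (hb : Bornology.IsBounded P.toSet) (u v : Fin 4 → ℝ)
    (hu : P.IsVertex u) (hv : P.IsVertex v)
    (hdisj : Disjoint (P.activeAt u) (P.activeAt v))
    (hcover : P.activeAt u ∪ P.activeAt v = Set.univ) :
    ∃ (k : ℕ) (w : Fin (k+1) → Fin 4 → ℝ), w 0 = u ∧ w (Fin.last k) = v ∧
      P.IsEdgeWalk w ∧
      ∀ i : Fin k, ∃ j ∈ P.activeAt v, j ∈ P.activeAt (w i.succ) ∧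
        ∀ i' : Fin (k+1), i' ≤ i.castSucc → j ∉ P.activeAt (w i') := by
  have h := PolyData.spindle_ineqSystem hP hb hu hv hdisj hcover
  have main : ∃ (k : ℕ) (w : Fin (k+1) → Fin 4 → ℝ), w 0 = u ∧ w (Fin.last k) = v ∧
      ∀ i : Fin k, P.IsEdge (w i.castSucc) (w i.succ) ∧
        P.activeAt (w i.castSucc) ∩ P.activeAt v ⊂ P.activeAt (w i.succ) ∩ P.activeAt v := by
    by_contra hcon
    simp only [← PolyData.act_ineqSystem] at hcon
    refine h.not_noShortWalk ⟨fun x hx hux hvx => hcon ?_,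
      fun a w ha hw hua hvw haw hs => hcon ?_,
      fun a x w ha hx hw hua hvw hax hxw hs hs' hs'' => hcon ?_⟩
    · refine ⟨2, ![u, x, v], rfl, rfl, fun i => ?_⟩
      fin_cases i
      · exact ⟨PolyData.isEdge_of_adj h.vert_u hx.1 hux, h.apex_ssubset hx⟩
      · exact ⟨PolyData.isEdge_of_adj hx.1 h.vert_v hvx.symm, h.ssubset_apex hx⟩
    · refine ⟨3, ![u, a, w, v], rfl, rfl, fun i => ?_⟩
      fin_cases i
      · exact ⟨PolyData.isEdge_of_adj h.vert_u ha.1 hua, h.apex_ssubset ha⟩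
      · exact ⟨PolyData.isEdge_of_adj ha.1 hw.1 haw, h.ssubset_of_adj ha hw haw hvw hs⟩
      · exact ⟨PolyData.isEdge_of_adj hw.1 h.vert_v hvw.symm, h.ssubset_apex hw⟩
    · refine ⟨4, ![u, a, x, w, v], rfl, rfl, fun i => ?_⟩
      fin_cases i
      · exact ⟨PolyData.isEdge_of_adj h.vert_u ha.1 hua, h.apex_ssubset ha⟩
      · exact ⟨PolyData.isEdge_of_adj ha.1 hx.1 hax, fun k hk => ⟨hs hk, hk.2⟩,
          fun hss => hs' fun k hk => (hss hk).1⟩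
      · exact ⟨PolyData.isEdge_of_adj hx.1 hw.1 hxw, h.ssubset_of_adj hx hw hxw hvw hs''⟩
      · exact ⟨PolyData.isEdge_of_adj hw.1 h.vert_v hvw.symm, h.ssubset_apex hw⟩
  obtain ⟨k, w, h0, hk, hw⟩ := main
  exact ⟨k, w, h0, hk, fun i => (hw i).1, PolyData.exists_new_facet fun i => (hw i).2⟩
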